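/- arXiv:math/9809041 — 8 statements merged into one kernel-verified Lean document; each statement's English description precedes it below -/
import Mathlib

section
/- Let C be the conic in ℙ²(ℂ) defined by f(x,y,z) = x² + y² + z² + 2(xz − xy + yz) = 0 and let L₀, L₁, L₂ be the coordinate lines x = 0, y = 0, z = 0 (to each of which C is tangent). Then the fundamental group G = π₁(ℙ²(ℂ) ∖ (C ∪ L₀ ∪ L₁ ∪ L₂)) is isomorphic to the group with generators e, ℓ₁, ℓ₂ and relations: [e ℓ₁ e⁻¹, ℓ₂] = 1, (ℓ₁ e)² = (e ℓ₁)², (ℓ₂ e)² = (e ℓ₂)², and (ℓ₁ ℓ₂ e)² = (e ℓ₁ ℓ₂)². -/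
open MvPolynomial FreeGroup

noncomputable section

/-- The conic `f(x,y,z) = x² + y² + z² + 2(xz − xy + yz)`. -/
def fPoly : MvPolynomial (Fin 3) ℂ :=
  X 0 ^ 2 + X 1 ^ 2 + X 2 ^ 2 + 2 * (X 0 * X 2 - X 0 * X 1 + X 1 * X 2)

instance : TopologicalSpace (Projectivization ℂ (Fin 3 → ℂ)) :=
  inferInstanceAs (TopologicalSpace (Quotient (projectivizationSetoid ℂ (Fin 3 → ℂ))))

/-- The conic `C = {f = 0} ⊆ ℙ²(ℂ)`. -/
def conicC : Set (Projectivization ℂ (Fin 3 → ℂ)) :=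
  {p | eval p.rep fPoly = 0}

/-- The coordinate line `L_i = {x_i = 0} ⊆ ℙ²(ℂ)`. -/
def lineL (i : Fin 3) : Set (Projectivization ℂ (Fin 3 → ℂ)) :=
  {p | p.rep i = 0}

/-- Generators `e`, `ℓ₁`, `ℓ₂` of the presentation of `G`. -/
inductive GenG : Type
  | e : GenG
  | l1 : GenG
  | l2 : GenG

open GenG

/-- The relators `[e ℓ₁ e⁻¹, ℓ₂]`, `(ℓ₁ e)²(e ℓ₁)⁻²`, `(ℓ₂ e)²(e ℓ₂)⁻²`,
`(ℓ₁ ℓ₂ e)²(e ℓ₁ ℓ₂)⁻²`. -/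
def relsG : Set (FreeGroup GenG) :=
  { (of e * of l1 * (of e)⁻¹) * of l2 * (of e * of l1 * (of e)⁻¹)⁻¹ * (of l2)⁻¹,
    (of l1 * of e) ^ 2 * ((of e * of l1) ^ 2)⁻¹,
    (of l2 * of e) ^ 2 * ((of e * of l2) ^ 2)⁻¹,
    (of l1 * of l2 * of e) ^ 2 * ((of e * of l1 * of l2) ^ 2)⁻¹ }

namespace ConicPi

open Topology Filter Set

/-- Every property of homotopy classes of paths that is stable under concatenation and holds for
paths inside members of an open cover holds for all classes. -/
theorem path_induction {X ι : Type*} [TopologicalSpace X] (U : ι → Set X)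
    (hU : ∀ i, IsOpen (U i)) (hc : ∀ x, ∃ i, x ∈ U i)
    (motive : ∀ y z : X, Path.Homotopic.Quotient y z → Prop)
    (hloc : ∀ i (y z : X) (γ : Path y z), (∀ t, γ t ∈ U i) →
      motive y z (Path.Homotopic.Quotient.mk γ))
    (htrans : ∀ (y z w : X) (p : Path.Homotopic.Quotient y z) (q : Path.Homotopic.Quotient z w),
      motive y z p → motive z w q → motive y w (p.trans q))
    {y z : X} (p : Path.Homotopic.Quotient y z) : motive y z p := by
  induction p using Path.Homotopic.Quotient.ind with
  | mk γ =>
  have hcast : ∀ {y z y' z' : X} (p : Path y z) (h : y' = y) (h' : z' = z),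
      motive y' z' (Path.Homotopic.Quotient.mk (p.cast h h')) →
      motive y z (Path.Homotopic.Quotient.mk p) := by
    intro y z y' z' p h h' hm
    subst h; subst h'; simpa using hm
  obtain ⟨t, ht0, hmono, ⟨n, hn⟩, hsub⟩ :=
    exists_monotone_Icc_subset_open_cover_unitInterval
      (c := fun i => γ ⁻¹' (U i)) (fun i => (hU i).preimage γ.continuous)
      (by intro s _; obtain ⟨i, hi⟩ := hc (γ s); exact mem_iUnion.2 ⟨i, hi⟩)
  have key : ∀ m, motive _ _ (Path.Homotopic.Quotient.mk (γ.subpath (t 0) (t m))) := by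
    intro m
    induction m with
    | zero =>
      obtain ⟨i, hi⟩ := hc (γ (t 0))
      refine hloc i _ _ _ ?_
      intro s
      rw [Path.subpath_self]; exact hi
    | succ m ih =>
      obtain ⟨i, hi⟩ := hsub m
      have h2 : motive _ _ (Path.Homotopic.Quotient.mk (γ.subpath (t m) (t (m+1)))) := by
        refine hloc i _ _ _ ?_
        intro s
        have : γ.subpath (t m) (t (m+1)) s ∈ range (γ.subpath (t m) (t (m+1))) := ⟨s, rfl⟩
        rw [Path.range_subpath_of_le _ _ _ (hmono (Nat.le_succ m))] at this
        obtain ⟨r, hr, hr'⟩ := this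
        rw [← hr']; exact hi hr
      have := htrans _ _ _ _ _ ih h2
      rw [← Path.Homotopic.Quotient.mk_trans] at this
      rwa [Path.Homotopic.Quotient.eq.2 ⟨Path.Homotopy.subpathTransSubpath γ (t 0) (t m) (t (m+1))⟩] at this
  have := key n
  rw [ht0, hn n le_rfl, Path.subpath_zero_one] at this
  exact hcast _ _ _ this

open Classical in
/-- The covering space attached to a locally constant cocycle, and its monodromy. -/
theorem exists_mon {X ι G : Type*} [TopologicalSpace X] [Group G] (U : ι → Set X)
    (hU : ∀ i, IsOpen (U i)) (hc : ∀ x, ∃ i, x ∈ U i) (f : ι → X → G)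
    (hf : ∀ i j x, x ∈ U i → x ∈ U j →
      ∀ᶠ y in 𝓝 x, f i y * (f j y)⁻¹ = f i x * (f j x)⁻¹) :
    ∃ T : ∀ (y z : X), Path.Homotopic.Quotient y z → G → G,
      (∀ y z w (p : Path.Homotopic.Quotient y z) (q : Path.Homotopic.Quotient z w) g,
        T y w (p.trans q) g = T z w q (T y z p g)) ∧
      ∀ i y z (γ : Path y z), (∀ t, γ t ∈ U i) → ∀ g,
        T y z (Path.Homotopic.Quotient.mk γ) g = g * ((f i y)⁻¹ * f i z) := by
  let _ : TopologicalSpace G := ⊥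
  have : DiscreteTopology G := ⟨rfl⟩
  let Z : FiberBundleCore ι X G :=
    { baseSet := U
      isOpen_baseSet := hU
      indexAt := fun x => (hc x).choose
      mem_baseSet_at := fun x => (hc x).choose_spec
      coordChange := fun i j x v => v * (f i x * (f j x)⁻¹)
      coordChange_self := by intros; simp
      continuousOn_coordChange := by
        intro i j p hp
        apply ContinuousAt.continuousWithinAt
        have h1 := hf i j p.1 hp.1.1 hp.1.2
        have h2 : ∀ᶠ q : X × G in 𝓝 p, f i q.1 * (f j q.1)⁻¹ = f i p.1 * (f j p.1)⁻¹ :=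
          continuous_fst.continuousAt.eventually h1
        have h3 : ContinuousAt (fun q : X × G => q.2 * (f i p.1 * (f j p.1)⁻¹)) p := by
          have : Continuous (fun v : G => v * (f i p.1 * (f j p.1)⁻¹)) := continuous_of_discreteTopology
          exact (this.comp continuous_snd).continuousAt
        refine h3.congr ?_
        filter_upwards [h2] with q hq
        rw [hq]
      coordChange_comp := by intros; group }
  have cov : IsCoveringMap (Bundle.TotalSpace.proj : Bundle.TotalSpace G Z.Fiber → X) :=
    FiberBundle.isCoveringMap
  let at' : X → ι := Z.indexAt
  let ab : Bundle.TotalSpace G Z.Fiber → G := fun e => (show G from e.2) * f (at' e.1) e.1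
  let st : ∀ y : X, G → (Bundle.TotalSpace.proj : Bundle.TotalSpace G Z.Fiber → X) ⁻¹' {y} :=
    fun y g => ⟨⟨y, (g * (f (at' y) y)⁻¹ : G)⟩, rfl⟩
  have hst : ∀ y (e : (Bundle.TotalSpace.proj : Bundle.TotalSpace G Z.Fiber → X) ⁻¹' {y}),
      st y (ab e.1) = e := by
    rintro y ⟨⟨y', v⟩, h⟩
    have h' : y' = y := h
    subst h'
    apply Subtype.ext
    simp only [st, ab]
    congr 1
    exact mul_inv_cancel_right (G := G) _ _
  have hab : ∀ y g, ab (st y g).1 = g := by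
    intro y g
    simp only [st, ab]
    exact inv_mul_cancel_right (G := G) _ _
  refine ⟨fun y z p g => ab (cov.monodromy p (st y g)).1, ?_, ?_⟩
  · intro y z w p q g
    simp only
    rw [cov.monodromy_trans_apply, hst]
  · intro i y z γ hγ g
    have hc1 : Continuous (fun t => (Z.localTriv i).toOpenPartialHomeomorph.symm (γ t, g * (f i y)⁻¹)) := by
      rw [continuous_iff_continuousAt]
      intro t
      have h1 : ContinuousAt (Z.localTriv i).toOpenPartialHomeomorph.symm (γ t, g * (f i y)⁻¹) := by
        apply OpenPartialHomeomorph.continuousAt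
        simp only [OpenPartialHomeomorph.symm_source]
        rw [FiberBundleCore.mem_localTriv_target]
        exact hγ t
      exact ContinuousAt.comp (f := fun t => (γ t, g * (f i y)⁻¹)) h1 (by fun_prop)
    have happ : ∀ t, (Z.localTriv i).toOpenPartialHomeomorph.symm (γ t, g * (f i y)⁻¹)
        = (st (γ t) (g * ((f i y)⁻¹ * f i (γ t)))).1 := by
      intro t
      rw [FiberBundleCore.localTriv_symm_apply]
      simp only [st, Z, at']
      congr 1
      have h : ∀ a b c d : G, (a * b) * (c * d) = (a * (b * c)) * d := by intros; group
      exact h _ _ _ _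
    have h0 : (cov.monodromy (Path.Homotopic.Quotient.mk γ) (st y g)).1
        = cov.liftPath γ (st y g).1 (γ.source.trans (st y g).2.symm) 1 := rfl
    change ab (cov.monodromy (Path.Homotopic.Quotient.mk γ) (st y g)).1 = _
    rw [h0]
    have h1 := (cov.eq_liftPath_iff (γ := γ) (e := (st y g).1) (γ.source.trans (st y g).2.symm)
      (Γ := fun t => (Z.localTriv i).toOpenPartialHomeomorph.symm (γ t, g * (f i y)⁻¹))).2
      ⟨hc1, by ext t; simp only [Function.comp]; rw [happ]; rfl, by
        have h : ∀ y', y' = y → (st y' g).1 = (st y g).1 := by rintro _ rfl; rfl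
        simp only [happ]; simp [h _ γ.source]⟩
    rw [← congrFun h1 1]
    simp only [happ]
    rw [hab]; simp

theorem exists_transport {X ι G : Type*} [TopologicalSpace X] [Group G] (U : ι → Set X)
    (hU : ∀ i, IsOpen (U i)) (hc : ∀ x, ∃ i, x ∈ U i) (f : ι → X → G)
    (hf : ∀ i j x, x ∈ U i → x ∈ U j →
      ∀ᶠ y in 𝓝 x, f i y * (f j y)⁻¹ = f i x * (f j x)⁻¹) :
    ∃ T : ∀ (y z : X), Path.Homotopic.Quotient y z → G,
      (∀ y z w (p : Path.Homotopic.Quotient y z) (q : Path.Homotopic.Quotient z w),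
        T y w (p.trans q) = T y z p * T z w q) ∧
      ∀ i y z (γ : Path y z), (∀ t, γ t ∈ U i) →
        T y z (Path.Homotopic.Quotient.mk γ) = (f i y)⁻¹ * f i z := by
  obtain ⟨T, hT, hT'⟩ := exists_mon U hU hc f hf
  have key : ∀ {y z : X} (p : Path.Homotopic.Quotient y z), ∀ g, T y z p g = g * T y z p 1 := by
    intro y z p
    refine path_induction U hU hc (fun y z p => ∀ g, T y z p g = g * T y z p 1) ?_ ?_ p
    · intro i y z γ hγ g
      rw [hT' i y z γ hγ, hT' i y z γ hγ, one_mul]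
    · intro y z w p q hp hq g
      rw [hT, hT, hp, hq, hq (T y z p 1), mul_assoc]
  refine ⟨fun y z p => T y z p 1, ?_, ?_⟩
  · intro y z w p q
    simp only [hT]
    rw [key]
  · intro i y z γ hγ
    simp only [hT' i y z γ hγ, one_mul]

end ConicPi

namespace ConicPi

open Topology Filter Set

theorem simplyConn_of_push (S W : Set (ℂ × ℂ)) (u : ℂ × ℂ) (g : ℂ × ℂ → ℝ) (hgc : Continuous g)
    (hg : ∀ p, 0 ≤ g p) (hS : ∀ p ∈ S, ∀ r : ℝ, 0 ≤ r → p + r • u ∈ S) (hW : Convex ℝ W)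
    (hWS : W ⊆ S) (hne : W.Nonempty) (hgW : ∀ p ∈ S, p + g p • u ∈ W) : IsSimplyConnected S := by
  obtain ⟨w, hw⟩ := hne
  let r : C(S, S) := ⟨fun p => ⟨p.1 + g p.1 • u, hWS (hgW _ p.2)⟩, by fun_prop⟩
  let H1 : ContinuousMap.Homotopy (ContinuousMap.id S) r :=
    { toFun := fun x => ⟨x.2.1 + ((x.1 : ℝ) * g x.2.1) • u,
        hS _ x.2.2 _ (mul_nonneg x.1.2.1 (hg _))⟩
      continuous_toFun := by fun_prop
      map_zero_left := by intro x; apply Subtype.ext; simp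
      map_one_left := by intro x; apply Subtype.ext; simp [r] }
  let H2 : ContinuousMap.Homotopy r (ContinuousMap.const S ⟨w, hWS hw⟩) :=
    { toFun := fun x => ⟨(1 - (x.1 : ℝ)) • (x.2.1 + g x.2.1 • u) + (x.1 : ℝ) • w,
        hWS (hW (hgW _ x.2.2) hw (sub_nonneg.2 x.1.2.2) x.1.2.1 (by ring))⟩
      continuous_toFun := by fun_prop
      map_zero_left := by intro x; apply Subtype.ext; simp [r]
      map_one_left := by intro x; apply Subtype.ext; simp }
  have : ContractibleSpace S :=
    (contractible_iff_id_nullhomotopic S).2 ⟨_, ⟨H1.trans H2⟩⟩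
  exact (inferInstance : SimplyConnectedSpace S)

theorem simplyConn_of_convex (S : Set (ℂ × ℂ)) (hS : Convex ℝ S) (hne : S.Nonempty) :
    IsSimplyConnected S :=
  simplyConn_of_push S S 0 (fun _ => 0) continuous_const (fun _ => le_rfl)
    (by intro p hp r _; simpa using hp) hS
    Subset.rfl hne (by simp)

/-- The plane slit downwards from `0` and from `1`. -/
def Dn : Set ℂ := {z | 0 < z.im ∨ (z.re ≠ 0 ∧ z.re ≠ 1)}
/-- The lower half plane. -/
def Lw : Set ℂ := {z | z.im < 0}
/-- The three vertical strips. -/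
def Str : Fin 3 → Set ℂ
  | 0 => {z | z.re < 0}
  | 1 => {z | 0 < z.re ∧ z.re < 1}
  | 2 => {z | 1 < z.re}

theorem isOpen_Dn : IsOpen Dn := by
  refine (isOpen_lt continuous_const Complex.continuous_im).union
    ((isOpen_ne_fun Complex.continuous_re continuous_const).inter
      (isOpen_ne_fun Complex.continuous_re continuous_const))

theorem isOpen_Lw : IsOpen Lw := isOpen_lt Complex.continuous_im continuous_const

theorem isOpen_Str (k) : IsOpen (Str k) := by
  fin_cases k
  · exact isOpen_lt Complex.continuous_re continuous_const
  · exact (isOpen_lt continuous_const Complex.continuous_re).inter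
      (isOpen_lt Complex.continuous_re continuous_const)
  · exact isOpen_lt continuous_const Complex.continuous_re

theorem convex_Lw : Convex ℝ Lw := convex_halfSpace_im_lt 0

theorem convex_Str (k) : Convex ℝ (Str k) := by
  fin_cases k
  · exact convex_halfSpace_re_lt 0
  · exact (convex_halfSpace_re_gt 0).inter (convex_halfSpace_re_lt 1)
  · exact convex_halfSpace_re_gt 1

theorem Str_sub (k) : Str k ⊆ Dn := by
  intro z hz
  right
  fin_cases k
  · have h : z.re < 0 := hz
    constructor <;> intro h' <;> linarith
  · have h : 0 < z.re ∧ z.re < 1 := hz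
    constructor <;> intro h' <;> linarith [h.1, h.2]
  · have h : 1 < z.re := hz
    constructor <;> intro h' <;> linarith

theorem exists_Str {z : ℂ} (hz : z ∈ Dn) (hz' : z ∈ Lw) : ∃ k, z ∈ Str k := by
  rcases hz with h | ⟨h0, h1⟩
  · exact absurd h (not_lt.2 (le_of_lt hz'))
  · rcases lt_or_gt_of_ne h0 with h | h
    · exact ⟨0, h⟩
    · rcases lt_or_gt_of_ne h1 with h' | h'
      · exact ⟨1, h, h'⟩
      · exact ⟨2, h'⟩

def ReLt : Set (ℂ × ℂ) := {p | p.1.re < p.2.re}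
def ImLt : Set (ℂ × ℂ) := {p | p.1.im < p.2.im}
def ImGt : Set (ℂ × ℂ) := {p | p.2.im < p.1.im}

theorem isOpen_ReLt : IsOpen ReLt := isOpen_lt (by fun_prop) (by fun_prop)
theorem isOpen_ImLt : IsOpen ImLt := isOpen_lt (by fun_prop) (by fun_prop)
theorem isOpen_ImGt : IsOpen ImGt := isOpen_lt (by fun_prop) (by fun_prop)

theorem convex_ReLt : Convex ℝ ReLt := by
  intro p hp q hq a b ha hb hab
  simp only [ReLt, mem_ofPred_eq, Prod.fst_add, Prod.smul_fst, Complex.add_re, Complex.real_smul,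
    Complex.re_ofReal_mul, Prod.snd_add, Prod.smul_snd] at *
  nlinarith [mul_nonneg ha (sub_nonneg.2 hp.le), mul_nonneg hb (sub_nonneg.2 hq.le), mul_pos (sub_pos.2 hp) (sub_pos.2 hq),
    mul_nonneg ha hb]
theorem convex_ImLt : Convex ℝ ImLt := by
  intro p hp q hq a b ha hb hab
  simp only [ImLt, mem_ofPred_eq, Prod.fst_add, Prod.smul_fst, Complex.add_im, Complex.real_smul,
    Complex.im_ofReal_mul, Prod.snd_add, Prod.smul_snd] at *
  nlinarith [mul_nonneg ha (sub_nonneg.2 hp.le), mul_nonneg hb (sub_nonneg.2 hq.le),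
    mul_pos (sub_pos.2 hp) (sub_pos.2 hq), mul_nonneg ha hb]
theorem convex_ImGt : Convex ℝ ImGt := by
  intro p hp q hq a b ha hb hab
  simp only [ImGt, mem_ofPred_eq, Prod.fst_add, Prod.smul_fst, Complex.add_im, Complex.real_smul,
    Complex.im_ofReal_mul, Prod.snd_add, Prod.smul_snd] at *
  nlinarith [mul_nonneg ha (sub_nonneg.2 hp.le), mul_nonneg hb (sub_nonneg.2 hq.le),
    mul_pos (sub_pos.2 hp) (sub_pos.2 hq), mul_nonneg ha hb]

/-- push both points upwards -/
theorem simplyConn_DD (O : Set (ℂ × ℂ)) (hO : Convex ℝ O)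
    (hOinv : ∀ p ∈ O, ∀ r : ℝ, p + r • (Complex.I, Complex.I) ∈ O) (hne : O.Nonempty) :
    IsSimplyConnected (Dn ×ˢ Dn ∩ O) := by
  have hD : ∀ z ∈ Dn, ∀ r : ℝ, 0 ≤ r → z + r • Complex.I ∈ Dn := by
    rintro z (h | h) r hr
    · left; simp; linarith
    · right; simpa using h
  have hpos : ∀ p ∈ O, p + (1 + |p.1.im| + |p.2.im|) • ((Complex.I, Complex.I) : ℂ × ℂ) ∈
      ({z : ℂ | 0 < z.im} ×ˢ {z : ℂ | 0 < z.im} ∩ O : Set (ℂ × ℂ)) := by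
    intro p hp
    refine ⟨⟨?_, ?_⟩, hOinv p hp _⟩
    · simp
      linarith [neg_abs_le p.1.im, abs_nonneg p.2.im]
    · simp
      linarith [neg_abs_le p.2.im, abs_nonneg p.1.im]
  refine simplyConn_of_push _ ({z : ℂ | 0 < z.im} ×ˢ {z : ℂ | 0 < z.im} ∩ O)
    (Complex.I, Complex.I) (fun p => 1 + |p.1.im| + |p.2.im|) (by fun_prop)
    (fun p => by positivity) ?_ ?_ ?_ ?_ ?_
  · rintro p ⟨⟨h1, h2⟩, h3⟩ r hr
    exact ⟨⟨hD _ h1 r hr, hD _ h2 r hr⟩, hOinv p h3 r⟩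
  · exact ((convex_halfSpace_im_gt 0).prod (convex_halfSpace_im_gt 0)).inter hO
  · rintro p ⟨⟨h1, h2⟩, h3⟩
    exact ⟨⟨Or.inl h1, Or.inl h2⟩, h3⟩
  · obtain ⟨p, hp⟩ := hne
    exact ⟨_, hpos p hp⟩
  · rintro p ⟨_, h3⟩
    exact hpos p h3

/-- push the second point upwards -/
theorem simplyConn_ND (N : Set ℂ) (hN : Convex ℝ N) (hNL : N ⊆ Lw) (hne : N.Nonempty) :
    IsSimplyConnected (N ×ˢ Dn ∩ ImLt) := by
  have hD : ∀ z ∈ Dn, ∀ r : ℝ, 0 ≤ r → z + r • Complex.I ∈ Dn := by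
    rintro z (h | h) r hr
    · left; simp; linarith
    · right; simpa using h
  refine simplyConn_of_push _ (N ×ˢ {z : ℂ | 0 < z.im})
    (0, Complex.I) (fun p => 1 + |p.1.im| + |p.2.im|) (by fun_prop)
    (fun p => by positivity) ?_ ?_ ?_ ?_ ?_
  · rintro p ⟨⟨h1, h2⟩, h3⟩ r hr
    refine ⟨⟨by simpa using h1, hD _ h2 r hr⟩, ?_⟩
    simp only [ImLt, mem_ofPred_eq] at h3 ⊢
    simp; linarith
  · exact hN.prod (convex_halfSpace_im_gt 0)
  · rintro p ⟨h1, h2⟩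
    exact ⟨⟨h1, Or.inl h2⟩, (show p.1.im < p.2.im from lt_trans (hNL h1) h2)⟩
  · obtain ⟨p, hp⟩ := hne
    exact ⟨(p, Complex.I), hp, by simp⟩
  · rintro p ⟨⟨h1, h2⟩, h3⟩
    refine ⟨by simpa using h1, ?_⟩
    simp
    linarith [neg_abs_le p.2.im, abs_nonneg p.1.im]

end ConicPi

namespace ConicPi

open Topology Filter Set

noncomputable section

/-- A homotopy class of loops as an element of the fundamental group; reversing the loop makes
this compatible with concatenation. -/
def lp {X : Type*} [TopologicalSpace X] {x : X} (p : Path.Homotopic.Quotient x x) :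
    FundamentalGroup X x := FundamentalGroup.fromPath p.symm

section Quot
variable {X : Type*} [TopologicalSpace X] {x y z w : X}

theorem qsymm_trans' (p : Path.Homotopic.Quotient x y) (q : Path.Homotopic.Quotient y z) :
    (p.trans q).symm = q.symm.trans p.symm := by
  induction p using Path.Homotopic.Quotient.ind with
  | mk p =>
  induction q using Path.Homotopic.Quotient.ind with
  | mk q =>
  rw [← Path.Homotopic.Quotient.mk_trans, ← Path.Homotopic.Quotient.mk_symm, Path.trans_symm]
  simp

theorem qsymm_symm (p : Path.Homotopic.Quotient x y) : p.symm.symm = p := by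
  induction p using Path.Homotopic.Quotient.ind with
  | mk p =>
  rw [← Path.Homotopic.Quotient.mk_symm, ← Path.Homotopic.Quotient.mk_symm, Path.symm_symm]

theorem lp_trans (p q : Path.Homotopic.Quotient x x) : lp (p.trans q) = lp p * lp q := by
  unfold lp
  rw [qsymm_trans', FundamentalGroup.mul_def]

theorem lp_refl : lp (Path.Homotopic.Quotient.refl x) = 1 := by
  have : lp (Path.Homotopic.Quotient.refl x) = lp (Path.Homotopic.Quotient.refl x) * lp (Path.Homotopic.Quotient.refl x) := by
    rw [← lp_trans]; simp
  exact mul_eq_left.1 this.symm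

theorem lp_surj (g : FundamentalGroup X x) : ∃ p, lp p = g :=
  ⟨Path.Homotopic.Quotient.symm g, qsymm_symm _⟩

theorem qtrans_cancel (a : Path.Homotopic.Quotient x y) (b : Path.Homotopic.Quotient z y)
    (c : Path.Homotopic.Quotient w y) :
    (a.trans b.symm).trans (b.trans c.symm) = a.trans c.symm := by
  rw [Path.Homotopic.Quotient.trans_assoc, ← Path.Homotopic.Quotient.trans_assoc b.symm]
  simp

end Quot

/-- Parallel sections over a simply connected set. -/
theorem exists_parallel {X : Type*} [TopologicalSpace X] [PathConnectedSpace X] (x0 : X)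
    (U : Set X) (hU : IsSimplyConnected U) (y0 : X) (hy0 : y0 ∈ U)
    (c : Path.Homotopic.Quotient x0 y0) :
    ∃ K : ∀ y, Path.Homotopic.Quotient x0 y, K y0 = c ∧
      ∀ y z (γ : Path y z), (∀ t, γ t ∈ U) →
        K z = (K y).trans (Path.Homotopic.Quotient.mk γ) := by
  classical
  have hpc := hU.isPathConnected
  rw [isSimplyConnected_iff_exists_homotopy_refl_forall_mem] at hU
  have huniq : ∀ y z (γ δ : Path y z), (∀ t, γ t ∈ U) → (∀ t, δ t ∈ U) →
      Path.Homotopic.Quotient.mk γ = Path.Homotopic.Quotient.mk δ := by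
    intro y z γ δ hγ hδ
    obtain ⟨F, _⟩ := hU.2 _ (γ.trans δ.symm) (by
      intro t
      have : (γ.trans δ.symm) t ∈ range (γ.trans δ.symm) := ⟨t, rfl⟩
      rw [Path.trans_range, Path.symm_range] at this
      rcases this with ⟨s, hs⟩ | ⟨s, hs⟩
      · rw [← hs]; exact hγ s
      · rw [← hs]; exact hδ s)
    have h := Path.Homotopic.Quotient.eq.2 ⟨F⟩
    rw [Path.Homotopic.Quotient.mk_trans, Path.Homotopic.Quotient.mk_symm,
      Path.Homotopic.Quotient.mk_refl] at h
    have h2 := congrArg (fun p => p.trans (Path.Homotopic.Quotient.mk δ)) h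
    simpa using h2
  let K : ∀ y, Path.Homotopic.Quotient x0 y := fun y =>
    if h : y ∈ U then c.trans (Path.Homotopic.Quotient.mk (hpc.joinedIn y0 hy0 y h).somePath)
    else Path.Homotopic.Quotient.mk (PathConnectedSpace.somePath x0 y)
  refine ⟨K, ?_, ?_⟩
  · simp only [K, dif_pos hy0]
    rw [huniq _ _ _ (Path.refl y0) (JoinedIn.somePath_mem _) (fun t => hy0)]
    simp
  · intro y z γ hγ
    have hy : y ∈ U := by simpa using hγ 0
    have hz : z ∈ U := by simpa using hγ 1
    simp only [K, dif_pos hy, dif_pos hz]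
    rw [Path.Homotopic.Quotient.trans_assoc, ← Path.Homotopic.Quotient.mk_trans]
    congr 1
    refine huniq _ _ _ _ (JoinedIn.somePath_mem _) ?_
    intro t
    have : ((hpc.joinedIn y0 hy0 y hy).somePath.trans γ) t ∈
      range ((hpc.joinedIn y0 hy0 y hy).somePath.trans γ) := ⟨t, rfl⟩
    rw [Path.trans_range] at this
    rcases this with ⟨s, hs⟩ | ⟨s, hs⟩
    · rw [← hs]; exact JoinedIn.somePath_mem _ s
    · rw [← hs]; exact hγ s

/-- The loop comparing two parallel sections at a point. -/
def Hl {X ι : Type*} [TopologicalSpace X] {x0 : X}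
    (K : ι → ∀ y, Path.Homotopic.Quotient x0 y) (i j : ι) (y : X) : FundamentalGroup X x0 :=
  lp ((K i y).trans (K j y).symm)

section H
variable {X ι : Type*} [TopologicalSpace X] {x0 : X}
    (K : ι → ∀ y, Path.Homotopic.Quotient x0 y)

theorem Hl_mul (i j k : ι) (y : X) : Hl K i j y * Hl K j k y = Hl K i k y := by
  unfold Hl
  rw [← lp_trans, qtrans_cancel]

theorem Hl_self (i : ι) (y : X) : Hl K i i y = 1 := by
  exact mul_eq_left.1 (Hl_mul K i i i y)

theorem Hl_inv (i j : ι) (y : X) : (Hl K i j y)⁻¹ = Hl K j i y := by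
  rw [inv_eq_iff_mul_eq_one, Hl_mul, Hl_self]

theorem Hl_one_of_eq (i j : ι) (y : X) (h : K i y = K j y) : Hl K i j y = 1 := by
  unfold Hl
  rw [h]; simp [lp_refl]

theorem Hl_const (U : ι → Set X)
    (hK : ∀ i y z (γ : Path y z), (∀ t, γ t ∈ U i) →
        K i z = (K i y).trans (Path.Homotopic.Quotient.mk γ)) (i j : ι) (W : Set X)
    (hW : IsPathConnected W) (hi : W ⊆ U i) (hj : W ⊆ U j) {y z : X} (hy : y ∈ W) (hz : z ∈ W) :
    Hl K i j y = Hl K i j z := by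
  have hJ := hW.joinedIn y hy z hz
  unfold Hl
  rw [hK i y z hJ.somePath (fun t => hi (hJ.somePath_mem t)),
    hK j y z hJ.somePath (fun t => hj (hJ.somePath_mem t)), qsymm_trans',
    Path.Homotopic.Quotient.trans_assoc,
    ← Path.Homotopic.Quotient.trans_assoc (Path.Homotopic.Quotient.mk _)]
  simp

end H

/-- The abstract comparison theorem: the homomorphism `Ψ` given on the cocycle values by comparing
parallel sections is bijective. -/
theorem abstract_bij {X ι κ G : Type*} [TopologicalSpace X] [Group G] (x0 : X)
    (U : ι → Set X) (hU : ∀ i, IsOpen (U i)) (hc : ∀ x, ∃ i, x ∈ U i)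
    (hpc : ∀ i, IsPathConnected (U i))
    (W : κ → Set X) (hW : ∀ k, IsOpen (W k)) (a b : κ → ι)
    (hrel : ∀ (x : X) (R : ι → ι → Prop), Equivalence R → (∀ k, x ∈ W k → R (a k) (b k)) →
      ∀ i j, x ∈ U i → x ∈ U j → R i j)
    (w : κ → G) (f : ι → X → G) (hf : ∀ k x, x ∈ W k → f (a k) x * (f (b k) x)⁻¹ = w k)
    (hWU : ∀ k, W k ⊆ U (a k) ∩ U (b k)) (hWne : ∀ k, (W k).Nonempty)
    (K : ι → ∀ y, Path.Homotopic.Quotient x0 y)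
    (hK : ∀ i y z (γ : Path y z), (∀ t, γ t ∈ U i) →
        K i z = (K i y).trans (Path.Homotopic.Quotient.mk γ))
    (i0 : ι) (hx0 : x0 ∈ U i0) (hK0 : K i0 x0 = Path.Homotopic.Quotient.refl x0)
    (hf0 : f i0 x0 = 1)
    (Ψ : G →* FundamentalGroup X x0)
    (hΨ : ∀ k x, x ∈ W k → Hl K (a k) (b k) x = Ψ (w k))
    (htree : ∀ R : ι → ι → Prop, Equivalence R → (∀ k, w k = 1 → R (a k) (b k)) → ∀ i, R i i0)
    (hgen : Subgroup.closure (range w) = ⊤) : Function.Bijective Ψ := by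
  constructor
  · obtain ⟨T, hT, hT'⟩ := exists_transport U hU hc f (by
      intro i j x hi hj
      refine hrel x (fun i j => ∀ᶠ y in 𝓝 x, f i y * (f j y)⁻¹ = f i x * (f j x)⁻¹)
        ⟨?_, ?_, ?_⟩ ?_ i j hi hj
      · intro i; simp
      · intro i j h
        filter_upwards [h] with y hy
        have := congrArg (·⁻¹) hy
        simpa using this
      · intro i j k h h'
        filter_upwards [h, h'] with y hy hy'
        have := congrArg₂ (· * ·) hy hy'
        simpa [mul_assoc] using this
      · intro k hk
        filter_upwards [(hW k).mem_nhds hk] with y hy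
        rw [hf k y hy, hf k x hk])
    have hTr : ∀ y, T y y (Path.Homotopic.Quotient.refl y) = 1 := by
      intro y
      have := hT y y y (Path.Homotopic.Quotient.refl y) (Path.Homotopic.Quotient.refl y)
      simpa using this
    have hTs : ∀ y z (p : Path.Homotopic.Quotient y z), T z y p.symm = (T y z p)⁻¹ := by
      intro y z p
      have := hT y z y p p.symm
      rw [Path.Homotopic.Quotient.trans_symm, hTr] at this
      exact eq_inv_of_mul_eq_one_right this.symm
    let Φ : FundamentalGroup X x0 →* G :=
      { toFun := fun g => (T x0 x0 g)⁻¹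
        map_one' := by
          simp only [inv_eq_one]; exact hTr x0
        map_mul' := by
          intro p q
          rw [FundamentalGroup.mul_def]
          simp only
          rw [hT, mul_inv_rev] }
    have hΦ : ∀ p, Φ (lp p) = T x0 x0 p := by
      intro p
      change (T x0 x0 p.symm)⁻¹ = _
      rw [hTs, inv_inv]
    have hD : ∀ i y z, y ∈ U i → z ∈ U i →
        T x0 y (K i y) * (f i y)⁻¹ = T x0 z (K i z) * (f i z)⁻¹ := by
      intro i y z hy hz
      have hJ := (hpc i).joinedIn y hy z hz
      rw [hK i y z hJ.somePath (hJ.somePath_mem), hT, hT' i y z _ hJ.somePath_mem]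
      simp [mul_assoc]
    have hH : ∀ i j y, Φ (Hl K i j y) = T x0 y (K i y) * (T x0 y (K j y))⁻¹ := by
      intro i j y
      unfold Hl
      rw [hΦ, hT, hTs]
    have hN : ∀ i y, y ∈ U i → T x0 y (K i y) = f i y := by
      suffices h : ∀ i y, y ∈ U i → ∀ y', y' ∈ U i0 →
          T x0 y (K i y) * (f i y)⁻¹ = T x0 y' (K i0 y') * (f i0 y')⁻¹ by
        intro i y hy
        have := h i y hy x0 hx0
        rw [hK0, hTr, hf0] at this
        simpa [mul_inv_eq_one] using this
      intro i
      refine htree (fun i j => ∀ y, y ∈ U i → ∀ y', y' ∈ U j →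
          T x0 y (K i y) * (f i y)⁻¹ = T x0 y' (K j y') * (f j y')⁻¹) ⟨?_, ?_, ?_⟩ ?_ i
      · intro i y hy y' hy'; exact hD i y y' hy hy'
      · intro i j h y hy y' hy'; exact (h y' hy' y hy).symm
      · intro i j k h h' y hy y' hy'
        obtain ⟨z, hz⟩ := (hpc j).nonempty
        exact (h y hy z hz).trans (h' z hz y' hy')
      · intro k hk y hy y' hy'
        obtain ⟨z, hz⟩ := hWne k
        rw [hD _ y z hy (hWU k hz).1, hD _ y' z hy' (hWU k hz).2]
        have h1 := hf k z hz
        have h2 := hΨ k z hz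
        rw [hk] at h1 h2
        have h3 := congrArg Φ h2
        rw [hH, _root_.map_one, _root_.map_one, mul_inv_eq_one] at h3
        rw [mul_inv_eq_one] at h1
        rw [h1, h3]
    have hcomp : Φ.comp Ψ = MonoidHom.id G := by
      refine MonoidHom.eq_of_eqOn_dense hgen ?_
      rintro _ ⟨k, rfl⟩
      obtain ⟨z, hz⟩ := hWne k
      simp only [MonoidHom.comp_apply, MonoidHom.id_apply]
      rw [← hΨ k z hz, hH, hN _ _ (hWU k hz).1, hN _ _ (hWU k hz).2, hf k z hz]
    intro g g' hg
    have := DFunLike.congr_fun hcomp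
    simp only [MonoidHom.comp_apply, MonoidHom.id_apply] at this
    rw [← this g, hg, this]
  · have hHr : ∀ i j y, y ∈ U i → y ∈ U j → Hl K i j y ∈ Ψ.range := by
      intro i j y hi hj
      refine hrel y (fun i j => Hl K i j y ∈ Ψ.range) ⟨?_, ?_, ?_⟩ ?_ i j hi hj
      · intro i; rw [Hl_self]; exact one_mem _
      · intro i j h; rw [← Hl_inv]; exact inv_mem h
      · intro i j k h h'; rw [← Hl_mul K i j k]; exact mul_mem h h'
      · intro k hk; rw [hΨ k y hk]; exact ⟨_, rfl⟩
    intro g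
    obtain ⟨p, rfl⟩ := lp_surj g
    have key := path_induction U hU hc (fun y z p => ∀ i j, y ∈ U i → z ∈ U j →
      lp (((K i y).trans p).trans (K j z).symm) ∈ Ψ.range) (by
        intro l y z γ hγ i j hi hj
        have hy : y ∈ U l := by simpa using hγ 0
        have hz : z ∈ U l := by simpa using hγ 1
        have h1 := hHr i l y hi hy
        have h2 := hHr l j z hz hj
        have h3 := mul_mem h1 h2
        unfold Hl at h3
        rw [← lp_trans, hK l y z γ hγ] at h3
        convert h3 using 2
        rw [Path.Homotopic.Quotient.trans_assoc, Path.Homotopic.Quotient.trans_assoc (K i y)]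
        congr 1
        rw [Path.Homotopic.Quotient.trans_assoc (K l y), ← Path.Homotopic.Quotient.trans_assoc
          (K l y).symm]
        simp)
      (by
        intro y z v p q hp hq i j hi hj
        obtain ⟨l, hl⟩ := hc z
        have h3 := mul_mem (hp i l hi hl) (hq l j hl hj)
        rw [← lp_trans] at h3
        convert h3 using 2
        simp only [Path.Homotopic.Quotient.trans_assoc]
        congr 2
        rw [← Path.Homotopic.Quotient.trans_assoc (K l z).symm]
        simp) p i0 i0 hx0 hx0
    rw [hK0, ← Path.Homotopic.Quotient.mk_refl, ← Path.Homotopic.Quotient.mk_symm] at key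
    simpa using key

end

end ConicPi

namespace ConicPi

open Topology Filter Set

noncomputable section

section Alg
variable {Q : Type*} [Group Q] (e a c : Q)

/-- the standard triple `1, a, c` -/
def tau (a c : Q) : Fin 3 → Q
  | 0 => 1
  | 1 => a
  | 2 => c

theorem alg_rel1 (h1 : e * a * e * a = a * e * a * e) (h3 : e * c * e * a = a * e * c * e) :
    (e * a * e⁻¹) * (a⁻¹ * c) = (a⁻¹ * c) * (e * a * e⁻¹) := by
  have k1 : e * a * e⁻¹ * a⁻¹ = a⁻¹ * e⁻¹ * a * e := by
    have : e * a * e⁻¹ * a⁻¹ = a⁻¹ * e⁻¹ * (e * a * e * a) * e⁻¹ * a⁻¹ := by group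
    rw [this, h1]; group
  have k3 : c * e * a = e⁻¹ * (a * e * c * e) := by
    rw [← h3]; group
  have : (a⁻¹ * c) * (e * a * e⁻¹) = a⁻¹ * (c * e * a) * e⁻¹ := by group
  rw [this, k3, ← mul_assoc, k1]; group

theorem alg_rel3 (b : Q) (h1 : e * a * e * a = a * e * a * e)
    (hR : (e * a * e⁻¹) * b = b * (e * a * e⁻¹))
    (h2 : e * (a * b) * e * (a * b) = (a * b) * e * (a * b) * e) :
    b * e * b * e = e * b * e * b := by
  have k1 : e * (a * b) * e * (a * b) = e * a * e⁻¹ * e * (b * (e * a * e⁻¹)) * e * b := by group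
  have k2 : (a * b) * e * (a * b) * e = a * (b * (e * a * e⁻¹)) * e * b * e := by group
  rw [k1, k2, ← hR] at h2
  have k3 : e * a * e⁻¹ * e * (e * a * e⁻¹ * b) * e * b = (e * a * e * a) * e⁻¹ * b * e * b := by
    group
  rw [k3, h1] at h2
  have k4 : b * e * b * e = (a * e * a * e⁻¹)⁻¹ * (a * (e * a * e⁻¹ * b) * e * b * e) := by group
  rw [k4, ← h2]; group

theorem alg_conv (l1 l2 : Q) (h1 : e * l1 * e * l1 = l1 * e * l1 * e)
    (hR : (e * l1 * e⁻¹) * l2 = l2 * (e * l1 * e⁻¹)) :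
    e * (l1 * l2) * e * l1 = l1 * e * (l1 * l2) * e := by
  have k : e * (l1 * l2) * e * l1 = e * l1 * (l2 * (e * l1 * e⁻¹)) * e := by group
  rw [k, ← hR]
  have k : e * l1 * (e * l1 * e⁻¹ * l2) * e = (e * l1 * e * l1) * e⁻¹ * l2 * e := by group
  rw [k, h1]; group

theorem tau_rel (h1 : e * a * e * a = a * e * a * e) (h2 : e * c * e * c = c * e * c * e)
    (h3 : e * c * e * a = a * e * c * e) (k k' : Fin 3) (h : k ≤ k') :
    e * tau a c k' * e * tau a c k = tau a c k * e * tau a c k' * e := by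
  fin_cases k <;> fin_cases k' <;> simp [tau] at * <;> assumption

end Alg

/-- the five charts -/
inductive Ix | A | B | C | E | F

/-- the pieces of pairwise intersections -/
inductive Pc
  | AB1 | AB2
  | BC (k : Fin 3)
  | CF (k : Fin 3)
  | EF1 | EF2
  | AE (k k' : Fin 3) (h : k ≤ k')

/-- first chart of a piece -/
def Pc.fst : Pc → Ix
  | AB1 => .B
  | AB2 => .B
  | BC _ => .C
  | CF _ => .F
  | EF1 => .E
  | EF2 => .E
  | AE _ _ _ => .E

/-- second chart of a piece -/
def Pc.snd : Pc → Ix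
  | AB1 => .A
  | AB2 => .A
  | BC _ => .B
  | CF _ => .C
  | EF1 => .F
  | EF2 => .F
  | AE _ _ _ => .A

/-- cocycle values -/
def Pc.word {Q : Type*} [Group Q] (e a c : Q) : Pc → Q
  | AB1 => 1
  | AB2 => e
  | BC k => e * tau a c k * e⁻¹
  | CF k => tau a c k
  | EF1 => e
  | EF2 => 1
  | AE k k' _ => tau a c k * e * tau a c k'

theorem Pc.word_map {Q Q' : Type*} [Group Q] [Group Q'] (φ : Q →* Q') (e a c : Q) (k : Pc) :
    φ (Pc.word e a c k) = Pc.word (φ e) (φ a) (φ c) k := by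
  have : ∀ k, φ (tau a c k) = tau (φ a) (φ c) k := by
    intro k; fin_cases k <;> simp [tau]
  cases k <;> simp [Pc.word, this]

/-- the charts upstairs -/
def Ch : Ix → Set (ℂ × ℂ)
  | .A => Dn ×ˢ Dn ∩ ReLt
  | .B => Dn ×ˢ Dn ∩ ImLt
  | .C => Lw ×ˢ Dn ∩ ImLt
  | .E => Lw ×ˢ Lw ∩ ReLt
  | .F => Lw ×ˢ Lw ∩ ImLt

/-- the pieces upstairs -/
def Pc.set : Pc → Set (ℂ × ℂ)
  | .AB1 => Dn ×ˢ Dn ∩ (ReLt ∩ ImLt)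
  | .AB2 => Dn ×ˢ Dn ∩ (ReLt ∩ ImGt)
  | .BC k => (Lw ∩ Str k) ×ˢ Dn ∩ ImLt
  | .CF k => Lw ×ˢ (Lw ∩ Str k) ∩ ImLt
  | .EF1 => Lw ×ˢ Lw ∩ (ReLt ∩ ImLt)
  | .EF2 => Lw ×ˢ Lw ∩ (ReLt ∩ ImGt)
  | .AE k k' _ => (Lw ∩ Str k) ×ˢ (Lw ∩ Str k') ∩ ReLt

theorem isOpen_Ch (i) : IsOpen (Ch i) := by
  cases i
  · exact (isOpen_Dn.prod isOpen_Dn).inter isOpen_ReLt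
  · exact (isOpen_Dn.prod isOpen_Dn).inter isOpen_ImLt
  · exact (isOpen_Lw.prod isOpen_Dn).inter isOpen_ImLt
  · exact (isOpen_Lw.prod isOpen_Lw).inter isOpen_ReLt
  · exact (isOpen_Lw.prod isOpen_Lw).inter isOpen_ImLt

theorem isOpen_Pc (k : Pc) : IsOpen k.set := by
  cases k
  · exact (isOpen_Dn.prod isOpen_Dn).inter (isOpen_ReLt.inter isOpen_ImLt)
  · exact (isOpen_Dn.prod isOpen_Dn).inter (isOpen_ReLt.inter isOpen_ImGt)
  · exact ((isOpen_Lw.inter (isOpen_Str _)).prod isOpen_Dn).inter isOpen_ImLt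
  · exact (isOpen_Lw.prod (isOpen_Lw.inter (isOpen_Str _))).inter isOpen_ImLt
  · exact (isOpen_Lw.prod isOpen_Lw).inter (isOpen_ReLt.inter isOpen_ImLt)
  · exact (isOpen_Lw.prod isOpen_Lw).inter (isOpen_ReLt.inter isOpen_ImGt)
  · exact ((isOpen_Lw.inter (isOpen_Str _)).prod (isOpen_Lw.inter (isOpen_Str _))).inter isOpen_ReLt

theorem mem_ReLt {p : ℂ × ℂ} : p ∈ ReLt ↔ p.1.re < p.2.re := Iff.rfl
theorem mem_ImLt {p : ℂ × ℂ} : p ∈ ImLt ↔ p.1.im < p.2.im := Iff.rfl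
theorem mem_ImGt {p : ℂ × ℂ} : p ∈ ImGt ↔ p.2.im < p.1.im := Iff.rfl
theorem mem_Lw {z : ℂ} : z ∈ Lw ↔ z.im < 0 := Iff.rfl
theorem mem_Dn {z : ℂ} : z ∈ Dn ↔ 0 < z.im ∨ (z.re ≠ 0 ∧ z.re ≠ 1) := Iff.rfl

/-- left and right sample abscissae in the strips -/
def sL : Fin 3 → ℝ
  | 0 => -2
  | 1 => 1 / 4
  | 2 => 2
/-- left and right sample abscissae in the strips -/
def sR : Fin 3 → ℝ
  | 0 => -1
  | 1 => 3 / 4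
  | 2 => 3

theorem sL_mem (k : Fin 3) (y : ℝ) : (⟨sL k, y⟩ : ℂ) ∈ Str k := by
  fin_cases k
  · show (-2 : ℝ) < 0; norm_num
  · show (0 : ℝ) < 1 / 4 ∧ (1 / 4 : ℝ) < 1; norm_num
  · show (1 : ℝ) < 2; norm_num

theorem sR_mem (k : Fin 3) (y : ℝ) : (⟨sR k, y⟩ : ℂ) ∈ Str k := by
  fin_cases k
  · show (-1 : ℝ) < 0; norm_num
  · show (0 : ℝ) < 3 / 4 ∧ (3 / 4 : ℝ) < 1; norm_num
  · show (1 : ℝ) < 3; norm_num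

theorem sL_lt_sR (k k' : Fin 3) (h : k ≤ k') : sL k < sR k' := by
  fin_cases k <;> fin_cases k' <;> simp [sL, sR] at * <;> norm_num

/-- test points -/
def p1 (k k' : Fin 3) : ℂ × ℂ := (⟨sL k, -2⟩, ⟨sR k', -1⟩)
def p2 (k k' : Fin 3) : ℂ × ℂ := (⟨sL k, -1⟩, ⟨sR k', -2⟩)

section pts
variable (k k' : Fin 3)

theorem p1_AE (h : k ≤ k') : p1 k k' ∈ (Pc.AE k k' h).set :=
  ⟨⟨⟨by rw [mem_Lw]; norm_num [p1], sL_mem _ _⟩, ⟨by rw [mem_Lw]; norm_num [p1], sR_mem _ _⟩⟩,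
    sL_lt_sR _ _ h⟩
theorem p2_AE (h : k ≤ k') : p2 k k' ∈ (Pc.AE k k' h).set :=
  ⟨⟨⟨by rw [mem_Lw]; norm_num [p2], sL_mem _ _⟩, ⟨by rw [mem_Lw]; norm_num [p2], sR_mem _ _⟩⟩,
    sL_lt_sR _ _ h⟩
theorem p1_AB1 (h : k ≤ k') : p1 k k' ∈ Pc.AB1.set :=
  ⟨⟨Str_sub _ (sL_mem _ _), Str_sub _ (sR_mem _ _)⟩, sL_lt_sR _ _ h, by
    rw [mem_ImLt]; norm_num [p1]⟩
theorem p2_AB2 (h : k ≤ k') : p2 k k' ∈ Pc.AB2.set :=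
  ⟨⟨Str_sub _ (sL_mem _ _), Str_sub _ (sR_mem _ _)⟩, sL_lt_sR _ _ h, by
    rw [mem_ImGt]; norm_num [p2]⟩
theorem p1_EF1 (h : k ≤ k') : p1 k k' ∈ Pc.EF1.set :=
  ⟨⟨by rw [mem_Lw]; norm_num [p1], by rw [mem_Lw]; norm_num [p1]⟩, sL_lt_sR _ _ h, by
    rw [mem_ImLt]; norm_num [p1]⟩
theorem p2_EF2 (h : k ≤ k') : p2 k k' ∈ Pc.EF2.set :=
  ⟨⟨by rw [mem_Lw]; norm_num [p2], by rw [mem_Lw]; norm_num [p2]⟩, sL_lt_sR _ _ h, by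
    rw [mem_ImGt]; norm_num [p2]⟩
theorem p1_BC : p1 k k' ∈ (Pc.BC k).set :=
  ⟨⟨⟨by rw [mem_Lw]; norm_num [p1], sL_mem _ _⟩, Str_sub _ (sR_mem _ _)⟩, by
    rw [mem_ImLt]; norm_num [p1]⟩
theorem p1_CF : p1 k k' ∈ (Pc.CF k').set :=
  ⟨⟨by rw [mem_Lw]; norm_num [p1], ⟨by rw [mem_Lw]; norm_num [p1], sR_mem _ _⟩⟩, by
    rw [mem_ImLt]; norm_num [p1]⟩
theorem p2_BC : (p2 k k').swap ∈ (Pc.BC k').set :=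
  ⟨⟨⟨by rw [mem_Lw]; norm_num [p2], sR_mem _ _⟩, Str_sub _ (sL_mem _ _)⟩, by
    rw [mem_ImLt]; norm_num [p2]⟩
theorem p2_CF : (p2 k k').swap ∈ (Pc.CF k).set :=
  ⟨⟨by rw [mem_Lw]; norm_num [p2], ⟨by rw [mem_Lw]; norm_num [p2], sL_mem _ _⟩⟩, by
    rw [mem_ImLt]; norm_num [p2]⟩
end pts

theorem inv_ReLt : ∀ p ∈ ReLt, ∀ r : ℝ, p + r • (Complex.I, Complex.I) ∈ ReLt := by
  intro p hp r; rw [mem_ReLt] at *; simpa using hp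
theorem inv_ImLt : ∀ p ∈ ImLt, ∀ r : ℝ, p + r • (Complex.I, Complex.I) ∈ ImLt := by
  intro p hp r; rw [mem_ImLt] at *; simpa using hp
theorem inv_ImGt : ∀ p ∈ ImGt, ∀ r : ℝ, p + r • (Complex.I, Complex.I) ∈ ImGt := by
  intro p hp r; rw [mem_ImGt] at *; simpa using hp

theorem pathConn_Pc (k : Pc) : IsPathConnected k.set := by
  apply IsSimplyConnected.isPathConnected
  cases k with
  | AB1 => exact simplyConn_DD _ (convex_ReLt.inter convex_ImLt)
            (fun p hp r => ⟨inv_ReLt p hp.1 r, inv_ImLt p hp.2 r⟩) ⟨_, (p1_AB1 0 0 le_rfl).2⟩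
  | AB2 => exact simplyConn_DD _ (convex_ReLt.inter convex_ImGt)
            (fun p hp r => ⟨inv_ReLt p hp.1 r, inv_ImGt p hp.2 r⟩) ⟨_, (p2_AB2 0 0 le_rfl).2⟩
  | BC k => exact simplyConn_ND _ (convex_Lw.inter (convex_Str k)) inter_subset_left
              ⟨_, (p1_BC k k).1.1⟩
  | CF k => exact simplyConn_of_convex _ ((convex_Lw.prod (convex_Lw.inter (convex_Str k))).inter
              convex_ImLt) ⟨_, p1_CF k k⟩
  | EF1 => exact simplyConn_of_convex _ ((convex_Lw.prod convex_Lw).inter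
              (convex_ReLt.inter convex_ImLt)) ⟨_, p1_EF1 0 0 le_rfl⟩
  | EF2 => exact simplyConn_of_convex _ ((convex_Lw.prod convex_Lw).inter
              (convex_ReLt.inter convex_ImGt)) ⟨_, p2_EF2 0 0 le_rfl⟩
  | AE k k' h => exact simplyConn_of_convex _ (((convex_Lw.inter (convex_Str k)).prod
              (convex_Lw.inter (convex_Str k'))).inter convex_ReLt) ⟨_, p1_AE k k' h⟩

theorem simplyConn_Ch (i : Ix) : IsSimplyConnected (Ch i) := by
  cases i with
  | A => exact simplyConn_DD _ convex_ReLt inv_ReLt ⟨_, (p1_AB1 0 0 le_rfl).2.1⟩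
  | B => exact simplyConn_DD _ convex_ImLt inv_ImLt ⟨_, (p1_AB1 0 0 le_rfl).2.2⟩
  | C => exact simplyConn_ND _ convex_Lw Subset.rfl ⟨_, (p1_BC 0 0).1.1.1⟩
  | E => exact simplyConn_of_convex _ ((convex_Lw.prod convex_Lw).inter convex_ReLt)
            ⟨_, (p1_EF1 0 0 le_rfl).1, (p1_EF1 0 0 le_rfl).2.1⟩
  | F => exact simplyConn_of_convex _ ((convex_Lw.prod convex_Lw).inter convex_ImLt)
            ⟨_, (p1_EF1 0 0 le_rfl).1, (p1_EF1 0 0 le_rfl).2.2⟩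

end

end ConicPi

namespace ConicPi

open Topology Filter Set

noncomputable section

/-- ordered configurations in the twice punctured plane -/
def PP : Set (ℂ × ℂ) := {p | p.1 ≠ p.2 ∧ (p.1 ≠ 0 ∧ p.1 ≠ 1) ∧ (p.2 ≠ 0 ∧ p.2 ≠ 1)}

/-- points lying over a chart -/
def UP (i : Ix) : Set (ℂ × ℂ) := {p | p ∈ Ch i ∨ p.swap ∈ Ch i}

theorem mem_UP {i : Ix} {p : ℂ × ℂ} : p ∈ UP i ↔ p ∈ Ch i ∨ p.swap ∈ Ch i := Iff.rfl

theorem UP_swap {i : Ix} {p : ℂ × ℂ} (h : p ∈ UP i) : p.swap ∈ UP i := by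
  rcases h with h | h
  · exact Or.inr (by simpa using h)
  · exact Or.inl h

theorem Ch_swap {i : Ix} {p : ℂ × ℂ} (h : p ∈ Ch i) : p.swap ∉ Ch i := by
  intro h'
  cases i <;>
  · have h1 := h.2
    have h2 := h'.2
    simp only [mem_ReLt, mem_ImLt, Prod.fst_swap, Prod.snd_swap] at h1 h2
    exact lt_asymm h1 h2

theorem Dn_ne {z : ℂ} (h : z ∈ Dn) : z ≠ 0 ∧ z ≠ 1 := by
  constructor <;> rintro rfl <;> rw [mem_Dn] at h <;> simp at h

theorem Lw_ne {z : ℂ} (h : z ∈ Lw) : z ≠ 0 ∧ z ≠ 1 := by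
  constructor <;> rintro rfl <;> rw [mem_Lw] at h <;> simp at h

theorem ReLt_ne {p : ℂ × ℂ} (h : p ∈ ReLt) : p.1 ≠ p.2 := by
  intro h'; rw [mem_ReLt, h'] at h; exact lt_irrefl _ h

theorem ImLt_ne {p : ℂ × ℂ} (h : p ∈ ImLt) : p.1 ≠ p.2 := by
  intro h'; rw [mem_ImLt, h'] at h; exact lt_irrefl _ h

theorem Ch_sub (i : Ix) : Ch i ⊆ PP := by
  intro p h
  cases i
  · exact ⟨ReLt_ne h.2, Dn_ne h.1.1, Dn_ne h.1.2⟩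
  · exact ⟨ImLt_ne h.2, Dn_ne h.1.1, Dn_ne h.1.2⟩
  · exact ⟨ImLt_ne h.2, Lw_ne h.1.1, Dn_ne h.1.2⟩
  · exact ⟨ReLt_ne h.2, Lw_ne h.1.1, Lw_ne h.1.2⟩
  · exact ⟨ImLt_ne h.2, Lw_ne h.1.1, Lw_ne h.1.2⟩

theorem PP_swap {p : ℂ × ℂ} (h : p ∈ PP) : p.swap ∈ PP := ⟨h.1.symm, h.2.2, h.2.1⟩

theorem Dn_or_Lw {z : ℂ} (h : z ≠ 0 ∧ z ≠ 1) : z ∈ Dn ∨ z ∈ Lw := by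
  rw [mem_Dn, mem_Lw]
  by_contra! hc
  obtain ⟨⟨h1, h2⟩, h3⟩ := hc
  have him : z.im = 0 := le_antisymm h1 h3
  by_cases h0 : z.re = 0
  · exact h.1 (Complex.ext h0 him)
  · exact h.2 (Complex.ext (h2 h0) him)

theorem Dn_of_not_Lw {z z' : ℂ} (h : z ≠ 0 ∧ z ≠ 1) (h' : z' ∉ Lw) (hz : z'.im ≤ z.im) : z ∈ Dn := by
  rcases Dn_or_Lw h with h1 | h1
  · exact h1
  · exact absurd (lt_of_le_of_lt hz h1) h'

theorem cover_PP {p : ℂ × ℂ} (h : p ∈ PP) : ∃ i, p ∈ UP i := by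
  have main : ∀ p : ℂ × ℂ, p ∈ PP → p.1.im < p.2.im → ∃ i, p ∈ UP i := by
    rintro p ⟨h, h1, h2⟩ hlt
    by_cases ht : p.2 ∈ Dn
    · rcases Dn_or_Lw h1 with h3 | h3
      · exact ⟨.B, Or.inl ⟨⟨h3, ht⟩, hlt⟩⟩
      · exact ⟨.C, Or.inl ⟨⟨h3, ht⟩, hlt⟩⟩
    · have h3 : p.2 ∈ Lw := (Dn_or_Lw h2).resolve_left ht
      exact ⟨.F, Or.inl ⟨⟨lt_trans hlt h3, h3⟩, hlt⟩⟩
  have main2 : ∀ p : ℂ × ℂ, p ∈ PP → p.1.im = p.2.im → p.1.re < p.2.re → ∃ i, p ∈ UP i := by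
    rintro p ⟨h, h1, h2⟩ heq hlt
    by_cases hb : p.1 ∈ Dn ∧ p.2 ∈ Dn
    · exact ⟨.A, Or.inl ⟨hb, hlt⟩⟩
    · have : p.1 ∈ Lw ∧ p.2 ∈ Lw := by
        rw [mem_Lw, mem_Lw, heq, and_self]
        by_contra hc
        apply hb
        exact ⟨(Dn_or_Lw h1).resolve_right (by rw [mem_Lw, heq]; exact hc),
          (Dn_or_Lw h2).resolve_right hc⟩
      exact ⟨.E, Or.inl ⟨this, hlt⟩⟩
  have sw : (∃ i, p.swap ∈ UP i) → ∃ i, p ∈ UP i := by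
    rintro ⟨i, hi⟩
    exact ⟨i, by simpa using UP_swap hi⟩
  rcases lt_trichotomy p.1.im p.2.im with h1 | h1 | h1
  · exact main p h h1
  · rcases lt_trichotomy p.1.re p.2.re with h2 | h2 | h2
    · exact main2 p h h1 h2
    · exact absurd (Complex.ext h2 h1) h.1
    · exact sw (main2 _ (PP_swap h) h1.symm h2)
  · exact sw (main _ (PP_swap h) h1)

/-- how a piece sits in the charts -/
theorem Pc_sub_fst (k : Pc) {p : ℂ × ℂ} (h : p ∈ k.set) : p ∈ UP k.fst := by
  cases k with
  | AB1 => exact Or.inl ⟨h.1, h.2.2⟩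
  | AB2 => exact Or.inr ⟨⟨h.1.2, h.1.1⟩, h.2.2⟩
  | BC k => exact Or.inl ⟨⟨h.1.1.1, h.1.2⟩, h.2⟩
  | CF k => exact Or.inl ⟨⟨h.1.1, h.1.2.1⟩, h.2⟩
  | EF1 => exact Or.inl ⟨h.1, h.2.1⟩
  | EF2 => exact Or.inl ⟨h.1, h.2.1⟩
  | AE k k' _ => exact Or.inl ⟨⟨h.1.1.1, h.1.2.1⟩, h.2⟩

theorem Pc_sub_snd (k : Pc) {p : ℂ × ℂ} (h : p ∈ k.set) : p ∈ UP k.snd := by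
  cases k with
  | AB1 => exact Or.inl ⟨h.1, h.2.1⟩
  | AB2 => exact Or.inl ⟨h.1, h.2.1⟩
  | BC k => exact Or.inl ⟨⟨Str_sub _ h.1.1.2, h.1.2⟩, h.2⟩
  | CF k => exact Or.inl ⟨⟨h.1.1, Str_sub _ h.1.2.2⟩, h.2⟩
  | EF1 => exact Or.inl ⟨h.1, h.2.2⟩
  | EF2 => exact Or.inr ⟨⟨h.1.2, h.1.1⟩, h.2.2⟩
  | AE k k' _ => exact Or.inl ⟨⟨Str_sub _ h.1.1.2, Str_sub _ h.1.2.2⟩, h.2⟩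

theorem Str_mono {k k' : Fin 3} {z z' : ℂ} (h : z ∈ Str k) (h' : z' ∈ Str k') (hlt : z.re < z'.re) :
    k ≤ k' := by
  fin_cases k <;> fin_cases k' <;> simp only [Str, mem_ofPred_eq] at h h' <;>
    first
    | decide
    | (exfalso; linarith)

theorem UP_im {i : Ix} {p : ℂ × ℂ} (hlt : p.1.im < p.2.im) (hi : i = .B ∨ i = .C ∨ i = .F)
    (h : p ∈ UP i) : p ∈ Ch i := by
  rcases h with h | h
  · exact h
  · exfalso
    have : p.2.im < p.1.im := by rcases hi with rfl | rfl | rfl <;> exact h.2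
    exact lt_asymm hlt this

theorem UP_ne {i : Ix} {p : ℂ × ℂ} (hi : i = .B ∨ i = .C ∨ i = .F)
    (h : p ∈ UP i) : p.1.im < p.2.im ∨ p.2.im < p.1.im := by
  rcases h with h | h
  · left; rcases hi with rfl | rfl | rfl <;> exact h.2
  · right; rcases hi with rfl | rfl | rfl <;> exact h.2

theorem UP_A {p : ℂ × ℂ} (h : p ∈ UP .A) : p.1 ∈ Dn ∧ p.2 ∈ Dn := by
  rcases h with h | h
  · exact h.1
  · exact ⟨h.1.2, h.1.1⟩

theorem UP_E {p : ℂ × ℂ} (h : p ∈ UP .E) : p.1 ∈ Lw ∧ p.2 ∈ Lw := by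
  rcases h with h | h
  · exact h.1
  · exact ⟨h.1.2, h.1.1⟩

theorem rel_all (p : ℂ × ℂ) (R : Ix → Ix → Prop) (hR : Equivalence R)
    (h : ∀ k : Pc, (p ∈ k.set ∨ p.swap ∈ k.set) → R k.fst k.snd) (i j : Ix)
    (hi : p ∈ UP i) (hj : p ∈ UP j) : R i j := by
  -- statements for pairs with ordered imaginary parts
  have AB : p ∈ UP .A → p ∈ UP .B → R .B .A := by
    have : ∀ p : ℂ × ℂ, (∀ k : Pc, (p ∈ k.set ∨ p.swap ∈ k.set) → R k.fst k.snd) →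
        p ∈ Ch .A → p ∈ UP .B → R .B .A := by
      intro p h hA hB
      rcases hB with hB | hB
      · exact h .AB1 (Or.inl ⟨hA.1, hA.2, hB.2⟩)
      · exact h .AB2 (Or.inl ⟨hA.1, hA.2, hB.2⟩)
    intro hA hB
    rcases hA with hA | hA
    · exact this p h hA hB
    · exact this p.swap (fun k hk => h k (by simpa [or_comm] using hk)) hA (UP_swap hB)
  have EF : p ∈ UP .E → p ∈ UP .F → R .E .F := by
    have : ∀ p : ℂ × ℂ, (∀ k : Pc, (p ∈ k.set ∨ p.swap ∈ k.set) → R k.fst k.snd) →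
        p ∈ Ch .E → p ∈ UP .F → R .E .F := by
      intro p h hA hB
      rcases hB with hB | hB
      · exact h .EF1 (Or.inl ⟨hA.1, hA.2, hB.2⟩)
      · exact h .EF2 (Or.inl ⟨hA.1, hA.2, hB.2⟩)
    intro hA hB
    rcases hA with hA | hA
    · exact this p h hA hB
    · exact this p.swap (fun k hk => h k (by simpa [or_comm] using hk)) hA (UP_swap hB)
  have AE : p ∈ UP .A → p ∈ UP .E → R .E .A := by
    have : ∀ p : ℂ × ℂ, (∀ k : Pc, (p ∈ k.set ∨ p.swap ∈ k.set) → R k.fst k.snd) →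
        p ∈ Ch .A → p ∈ UP .E → R .E .A := by
      intro p h hA hE
      obtain ⟨k, hk⟩ := exists_Str hA.1.1 (UP_E hE).1
      obtain ⟨k', hk'⟩ := exists_Str hA.1.2 (UP_E hE).2
      exact h (.AE k k' (Str_mono hk hk' hA.2))
        (Or.inl ⟨⟨⟨(UP_E hE).1, hk⟩, ⟨(UP_E hE).2, hk'⟩⟩, hA.2⟩)
    intro hA hB
    rcases hA with hA | hA
    · exact this p h hA hB
    · exact this p.swap (fun k hk => h k (by simpa [or_comm] using hk)) hA (UP_swap hB)
  -- everything for ordered imaginary parts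
  have main : ∀ p : ℂ × ℂ, (∀ k : Pc, (p ∈ k.set ∨ p.swap ∈ k.set) → R k.fst k.snd) →
      p.1.im < p.2.im →
      (p ∈ UP .B → p ∈ UP .C → R .C .B) ∧ (p ∈ UP .C → p ∈ UP .F → R .F .C) ∧
      (p ∈ UP .A → p ∈ UP .C → p ∈ UP .B) ∧ (p ∈ UP .A → p ∈ UP .F → p ∈ UP .B ∧ p ∈ UP .C) ∧
      (p ∈ UP .B → p ∈ UP .E → p ∈ UP .C ∧ p ∈ UP .F) ∧ (p ∈ UP .B → p ∈ UP .F → p ∈ UP .C) ∧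
      (p ∈ UP .C → p ∈ UP .E → p ∈ UP .F) := by
    intro p h hlt
    refine ⟨?_, ?_, ?_, ?_, ?_, ?_, ?_⟩
    · intro hB hC
      have hB := UP_im hlt (by simp) hB
      have hC := UP_im hlt (by simp) hC
      obtain ⟨k, hk⟩ := exists_Str hB.1.1 hC.1.1
      exact h (.BC k) (Or.inl ⟨⟨⟨hC.1.1, hk⟩, hC.1.2⟩, hlt⟩)
    · intro hC hF
      have hC := UP_im hlt (by simp) hC
      have hF := UP_im hlt (by simp) hF
      obtain ⟨k, hk⟩ := exists_Str hC.1.2 hF.1.2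
      exact h (.CF k) (Or.inl ⟨⟨hC.1.1, ⟨hF.1.2, hk⟩⟩, hlt⟩)
    · intro hA hC
      exact Or.inl ⟨UP_A hA, hlt⟩
    · intro hA hF
      have hF := UP_im hlt (by simp) hF
      exact ⟨Or.inl ⟨UP_A hA, hlt⟩, Or.inl ⟨⟨hF.1.1, (UP_A hA).2⟩, hlt⟩⟩
    · intro hB hE
      have hB := UP_im hlt (by simp) hB
      exact ⟨Or.inl ⟨⟨(UP_E hE).1, hB.1.2⟩, hlt⟩, Or.inl ⟨UP_E hE, hlt⟩⟩
    · intro hB hF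
      have hB := UP_im hlt (by simp) hB
      have hF := UP_im hlt (by simp) hF
      exact Or.inl ⟨⟨hF.1.1, hB.1.2⟩, hlt⟩
    · intro hC hE
      exact Or.inl ⟨UP_E hE, hlt⟩
  have main' : (p.1.im < p.2.im ∨ p.2.im < p.1.im) →
      (p ∈ UP .B → p ∈ UP .C → R .C .B) ∧ (p ∈ UP .C → p ∈ UP .F → R .F .C) ∧
      (p ∈ UP .A → p ∈ UP .C → p ∈ UP .B) ∧ (p ∈ UP .A → p ∈ UP .F → p ∈ UP .B ∧ p ∈ UP .C) ∧
      (p ∈ UP .B → p ∈ UP .E → p ∈ UP .C ∧ p ∈ UP .F) ∧ (p ∈ UP .B → p ∈ UP .F → p ∈ UP .C) ∧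
      (p ∈ UP .C → p ∈ UP .E → p ∈ UP .F) := by
    rintro (hlt | hlt)
    · exact main p h hlt
    · have hs : ∀ i, p ∈ UP i ↔ p.swap ∈ UP i := fun i =>
        ⟨UP_swap, fun h => by simpa using UP_swap h⟩
      simp only [hs]
      exact main p.swap (fun k hk => h k (by simpa [or_comm] using hk)) hlt
  have hB := fun h => main' (UP_ne (i := .B) (by simp) h)
  have hC := fun h => main' (UP_ne (i := .C) (by simp) h)
  have hF := fun h => main' (UP_ne (i := .F) (by simp) h)
  have BC : p ∈ UP .B → p ∈ UP .C → R .C .B := fun b c => (hB b).1 b c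
  have CF : p ∈ UP .C → p ∈ UP .F → R .F .C := fun c f => (hC c).2.1 c f
  have AC : p ∈ UP .A → p ∈ UP .C → R .C .A := fun a c =>
    hR.trans (BC ((hC c).2.2.1 a c) c) (AB a ((hC c).2.2.1 a c))
  have AF : p ∈ UP .A → p ∈ UP .F → R .F .A := fun a f =>
    hR.trans (CF ((hF f).2.2.2.1 a f).2 f) (AC a ((hF f).2.2.2.1 a f).2)
  have BF : p ∈ UP .B → p ∈ UP .F → R .F .B := fun b f =>
    hR.trans (CF ((hF f).2.2.2.2.2.1 b f) f) (BC b ((hF f).2.2.2.2.2.1 b f))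
  have BE : p ∈ UP .B → p ∈ UP .E → R .E .B := fun b e =>
    hR.trans (EF e ((hB b).2.2.2.2.1 b e).2) (BF b ((hB b).2.2.2.2.1 b e).2)
  have CE : p ∈ UP .C → p ∈ UP .E → R .E .C := fun c e =>
    hR.trans (EF e ((hC c).2.2.2.2.2.2 c e)) (CF c ((hC c).2.2.2.2.2.2 c e))
  cases i <;> cases j <;> first
    | exact hR.refl _
    | exact AB ‹_› ‹_›
    | exact hR.symm (AB ‹_› ‹_›)
    | exact AC ‹_› ‹_›
    | exact hR.symm (AC ‹_› ‹_›)
    | exact AE ‹_› ‹_›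
    | exact hR.symm (AE ‹_› ‹_›)
    | exact AF ‹_› ‹_›
    | exact hR.symm (AF ‹_› ‹_›)
    | exact BC ‹_› ‹_›
    | exact hR.symm (BC ‹_› ‹_›)
    | exact BE ‹_› ‹_›
    | exact hR.symm (BE ‹_› ‹_›)
    | exact BF ‹_› ‹_›
    | exact hR.symm (BF ‹_› ‹_›)
    | exact CE ‹_› ‹_›
    | exact hR.symm (CE ‹_› ‹_›)
    | exact CF ‹_› ‹_›
    | exact hR.symm (CF ‹_› ‹_›)
    | exact EF ‹_› ‹_›
    | exact hR.symm (EF ‹_› ‹_›)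

/-- strip index -/
def sti (z : ℂ) : Fin 3 :=
  open Classical in if z.re ≤ 0 then 0 else if z.re ≤ 1 then 1 else 2

theorem sti_mono {z z' : ℂ} (h : z.re < z'.re) : sti z ≤ sti z' := by
  unfold sti
  split_ifs <;> first | decide | (exfalso; linarith)

theorem sti_eq {k : Fin 3} {z : ℂ} (h : z ∈ Str k) : sti z = k := by
  unfold sti
  fin_cases k
  · have h : z.re < 0 := h
    rw [if_pos h.le]; rfl
  · have h : 0 < z.re ∧ z.re < 1 := h
    rw [if_neg (not_le.2 h.1), if_pos h.2.le]; rfl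
  · have h : 1 < z.re := h
    rw [if_neg (by linarith), if_neg (by linarith)]; rfl

section coc
variable {Q : Type*} [Group Q] (e a c : Q)

open Classical in
/-- the cocycle potential on charts -/
def pot : Ix → ℂ × ℂ → Q
  | .A, _ => 1
  | .B, p => if p.1.re < p.2.re then 1 else e
  | .C, p => e * tau a c (sti p.1) * e⁻¹ * (if p.1.re < p.2.re then 1 else e)
  | .E, p => tau a c (sti p.1) * e * tau a c (sti p.2)
  | .F, p => tau a c (sti p.2) * (e * tau a c (sti p.1) * e⁻¹ * (if p.1.re < p.2.re then 1 else e))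

open Classical in
/-- symmetric extension -/
def spot (i : Ix) (p : ℂ × ℂ) : Q := if p ∈ Ch i then pot e a c i p else pot e a c i p.swap

theorem spot_of_mem {i : Ix} {p : ℂ × ℂ} (h : p ∈ Ch i) : spot e a c i p = pot e a c i p :=
  if_pos h
theorem spot_of_swap {i : Ix} {p : ℂ × ℂ} (h : p.swap ∈ Ch i) :
    spot e a c i p = pot e a c i p.swap :=
  if_neg (by have := Ch_swap h; simpa using this)

theorem spot_swap {i : Ix} {p : ℂ × ℂ} (h : p ∈ UP i) : spot e a c i p.swap = spot e a c i p := by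
  rcases h with h | h
  · rw [spot_of_mem e a c h, spot_of_swap e a c (by simpa using h)]; simp
  · rw [spot_of_mem e a c h, spot_of_swap e a c h]

theorem spot_word (h1 : e * a * e * a = a * e * a * e) (h2 : e * c * e * c = c * e * c * e)
    (h3 : e * c * e * a = a * e * c * e) (k : Pc) {p : ℂ × ℂ} (h : p ∈ k.set) :
    spot e a c k.fst p * (spot e a c k.snd p)⁻¹ = k.word e a c := by
  cases k with
  | AB1 =>
    have hA : p ∈ Ch .A := ⟨h.1, h.2.1⟩
    have hB : p ∈ Ch .B := ⟨h.1, h.2.2⟩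
    have hr : p.1.re < p.2.re := h.2.1
    simp only [Pc.fst, Pc.snd, spot_of_mem e a c hA, spot_of_mem e a c hB, pot, Pc.word, if_pos hr]
    simp
  | AB2 =>
    have hA : p ∈ Ch .A := ⟨h.1, h.2.1⟩
    have hB : p.swap ∈ Ch .B := ⟨⟨h.1.2, h.1.1⟩, h.2.2⟩
    have hr : p.1.re < p.2.re := h.2.1
    simp only [Pc.fst, Pc.snd, spot_of_mem e a c hA, spot_of_swap e a c hB, pot, Pc.word,
      Prod.fst_swap, Prod.snd_swap, if_neg (not_lt.2 hr.le)]
    simp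
  | BC k =>
    have hB : p ∈ Ch .B := ⟨⟨Str_sub _ h.1.1.2, h.1.2⟩, h.2⟩
    have hC : p ∈ Ch .C := ⟨⟨h.1.1.1, h.1.2⟩, h.2⟩
    simp only [Pc.fst, Pc.snd, spot_of_mem e a c hB, spot_of_mem e a c hC, pot, Pc.word,
      sti_eq h.1.1.2]
    exact mul_inv_cancel_right _ _
  | CF k =>
    have hF : p ∈ Ch .F := ⟨⟨h.1.1, h.1.2.1⟩, h.2⟩
    have hC : p ∈ Ch .C := ⟨⟨h.1.1, Str_sub _ h.1.2.2⟩, h.2⟩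
    simp only [Pc.fst, Pc.snd, spot_of_mem e a c hF, spot_of_mem e a c hC, pot, Pc.word,
      sti_eq h.1.2.2]
    exact mul_inv_cancel_right _ _
  | EF1 =>
    have hE : p ∈ Ch .E := ⟨h.1, h.2.1⟩
    have hF : p ∈ Ch .F := ⟨h.1, h.2.2⟩
    have hr : p.1.re < p.2.re := h.2.1
    simp only [Pc.fst, Pc.snd, spot_of_mem e a c hE, spot_of_mem e a c hF, pot, Pc.word, if_pos hr]
    have := tau_rel e a c h1 h2 h3 _ _ (sti_mono hr)
    rw [mul_inv_eq_iff_eq_mul, ← mul_left_inj e, ← this]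
    group
  | EF2 =>
    have hE : p ∈ Ch .E := ⟨h.1, h.2.1⟩
    have hF : p.swap ∈ Ch .F := ⟨⟨h.1.2, h.1.1⟩, h.2.2⟩
    have hr : p.1.re < p.2.re := h.2.1
    simp only [Pc.fst, Pc.snd, spot_of_mem e a c hE, spot_of_swap e a c hF, pot, Pc.word,
      Prod.fst_swap, Prod.snd_swap, if_neg (not_lt.2 hr.le)]
    group
  | AE k k' _ =>
    have hE : p ∈ Ch .E := ⟨⟨h.1.1.1, h.1.2.1⟩, h.2⟩
    have hA : p ∈ Ch .A := ⟨⟨Str_sub _ h.1.1.2, Str_sub _ h.1.2.2⟩, h.2⟩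
    simp only [Pc.fst, Pc.snd, spot_of_mem e a c hE, spot_of_mem e a c hA, pot, Pc.word,
      sti_eq h.1.1.2, sti_eq h.1.2.2]
    simp

end coc

end

end ConicPi

namespace ConicPi

open Topology Filter Set

noncomputable section

/-- generators of the presented group -/
def gE : PresentedGroup relsG := PresentedGroup.of GenG.e
def gA : PresentedGroup relsG := PresentedGroup.of GenG.l1
def gB : PresentedGroup relsG := PresentedGroup.of GenG.l2

theorem mkof (x : GenG) : PresentedGroup.mk relsG (FreeGroup.of x) = PresentedGroup.of x := rfl

theorem G_h1 : gE * gA * gE * gA = gA * gE * gA * gE := by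
  have h := PresentedGroup.one_of_mem (rels := relsG) (Or.inr (Or.inl rfl))
  simp only [_root_.map_mul, _root_.map_inv, _root_.map_pow, mkof, mul_inv_eq_one] at h
  have h : (gA * gE) ^ 2 = (gE * gA) ^ 2 := h
  simp only [pow_two, ← mul_assoc] at h
  exact h.symm

theorem G_R1 : (gE * gA * gE⁻¹) * gB = gB * (gE * gA * gE⁻¹) := by
  have h := PresentedGroup.one_of_mem (rels := relsG) (Or.inl rfl)
  simp only [_root_.map_mul, _root_.map_inv, mkof] at h
  have h : (gE * gA * gE⁻¹) * gB * (gE * gA * gE⁻¹)⁻¹ * gB⁻¹ = 1 := h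
  rw [mul_inv_eq_one, mul_inv_eq_iff_eq_mul] at h
  exact h

theorem G_h2 : gE * (gA * gB) * gE * (gA * gB) = (gA * gB) * gE * (gA * gB) * gE := by
  have h := PresentedGroup.one_of_mem (rels := relsG) (Or.inr (Or.inr (Or.inr rfl)))
  simp only [_root_.map_mul, _root_.map_inv, _root_.map_pow, mkof, mul_inv_eq_one] at h
  have h : (gA * gB * gE) ^ 2 = (gE * gA * gB) ^ 2 := h
  simp only [pow_two, ← mul_assoc] at h ⊢
  exact h.symm

theorem G_h3 : gE * (gA * gB) * gE * gA = gA * gE * (gA * gB) * gE :=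
  alg_conv gE gA gB G_h1 G_R1

/-- homomorphism out of the presented group -/
theorem exists_hom {Q : Type*} [Group Q] (e a c : Q) (h1 : e * a * e * a = a * e * a * e)
    (h2 : e * c * e * c = c * e * c * e) (h3 : e * c * e * a = a * e * c * e) :
    ∃ Ψ : PresentedGroup relsG →* Q, Ψ gE = e ∧ Ψ gA = a ∧ Ψ (gA * gB) = c := by
  let g : GenG → Q := fun x => match x with
    | .e => e
    | .l1 => a
    | .l2 => a⁻¹ * c
  have hR := alg_rel1 e a c h1 h3
  have hR3 := alg_rel3 e a (a⁻¹ * c) h1 hR (by simpa using h2)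
  have hrel : ∀ r ∈ relsG, FreeGroup.lift g r = 1 := by
    rintro r (rfl | rfl | rfl | rfl)
    · simp only [_root_.map_mul, _root_.map_inv, FreeGroup.lift_apply_of, g]
      rw [mul_inv_eq_one, mul_inv_eq_iff_eq_mul]; exact hR
    · simp only [_root_.map_mul, _root_.map_inv, _root_.map_pow, FreeGroup.lift_apply_of, g]
      rw [mul_inv_eq_one, pow_two, pow_two]
      simp only [← mul_assoc]; exact h1.symm
    · simp only [_root_.map_mul, _root_.map_inv, _root_.map_pow, FreeGroup.lift_apply_of, g]
      rw [mul_inv_eq_one, pow_two, pow_two]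
      simp only [← mul_assoc] at hR3 ⊢; exact hR3
    · simp only [_root_.map_mul, _root_.map_inv, _root_.map_pow, FreeGroup.lift_apply_of, g]
      rw [mul_inv_eq_one, pow_two, pow_two]
      have k1 : a * (a⁻¹ * c) * e * (a * (a⁻¹ * c) * e) = c * e * c * e := by group
      have k2 : e * a * (a⁻¹ * c) * (e * a * (a⁻¹ * c)) = e * c * e * c := by group
      rw [k1, k2, h2]
  refine ⟨PresentedGroup.toGroup hrel, ?_, ?_, ?_⟩
  · exact PresentedGroup.toGroup.of hrel
  · exact PresentedGroup.toGroup.of hrel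
  · rw [_root_.map_mul]
    have k1 : PresentedGroup.toGroup hrel gA = a := PresentedGroup.toGroup.of hrel
    have k2 : PresentedGroup.toGroup hrel gB = a⁻¹ * c := PresentedGroup.toGroup.of hrel
    rw [k1, k2, mul_inv_cancel_left]

theorem gen_word : Subgroup.closure (range (Pc.word gE gA (gA * gB))) = ⊤ := by
  set S := Subgroup.closure (range (Pc.word gE gA (gA * gB)))
  have hw : ∀ k, Pc.word gE gA (gA * gB) k ∈ S := fun k => Subgroup.subset_closure ⟨k, rfl⟩
  have hE : gE ∈ S := hw .AB2
  have hA : gA ∈ S := hw (.CF 1)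
  have hAB : gA * gB ∈ S := hw (.CF 2)
  have hB : gB ∈ S := by
    have := mul_mem (inv_mem hA) hAB
    simpa using this
  rw [eq_top_iff, ← PresentedGroup.closure_range_of, Subgroup.closure_le]
  rintro _ ⟨x, rfl⟩
  cases x
  · exact hE
  · exact hA
  · exact hB

theorem tree_all (R : Ix → Ix → Prop) (hR : Equivalence R) (h1 : R .B .A) (h2 : R .C .B)
    (h3 : R .F .C) (h4 : R .E .F) (i : Ix) : R i .A := by
  cases i
  · exact hR.refl _
  · exact h1
  · exact hR.trans h2 h1
  · exact hR.trans h4 (hR.trans h3 (hR.trans h2 h1))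
  · exact hR.trans h3 (hR.trans h2 h1)

theorem Pc_sub (k : Pc) : k.set ⊆ PP := by
  intro p hp
  rcases Pc_sub_fst k hp with h | h
  · exact Ch_sub _ h
  · simpa using PP_swap (Ch_sub _ h)

theorem main_abs {X : Type*} [TopologicalSpace X] (q : ℂ × ℂ → X) (hqc : ContinuousOn q PP)
    (hqo : ∀ V ⊆ PP, IsOpen V → IsOpen (q '' V)) (hqs : ∀ x, ∃ p ∈ PP, q p = x)
    (hqf : ∀ p ∈ PP, ∀ p' ∈ PP, q p = q p' ↔ p' = p ∨ p' = p.swap) (x : X) :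
    Nonempty (FundamentalGroup X x ≃* PresentedGroup relsG) := by
  let U : Ix → Set X := fun i => q '' Ch i
  let W : Pc → Set X := fun k => q '' k.set
  have hsw : ∀ p ∈ PP, q p.swap = q p := fun p hp =>
    ((hqf p hp p.swap (PP_swap hp)).2 (Or.inr rfl)).symm
  have hU : ∀ i, IsOpen (U i) := fun i => hqo _ (Ch_sub i) (isOpen_Ch i)
  have hW : ∀ k, IsOpen (W k) := fun k => hqo _ (Pc_sub k) (isOpen_Pc k)
  have hUP : ∀ i, ∀ p ∈ PP, q p ∈ U i ↔ p ∈ UP i := by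
    intro i p hp
    constructor
    · rintro ⟨p', hp', h⟩
      rcases (hqf p' (Ch_sub i hp') p hp).1 h with rfl | rfl
      · exact Or.inl hp'
      · exact Or.inr (by simpa using hp')
    · rintro (h | h)
      · exact ⟨p, h, rfl⟩
      · exact ⟨_, h, hsw p hp⟩
  have hWP : ∀ k : Pc, ∀ p ∈ PP, (p ∈ k.set ∨ p.swap ∈ k.set) → q p ∈ W k := by
    rintro k p hp (h | h)
    · exact ⟨p, h, rfl⟩
    · exact ⟨_, h, hsw p hp⟩
  have hc : ∀ x, ∃ i, x ∈ U i := by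
    intro x
    obtain ⟨p, hp, rfl⟩ := hqs x
    obtain ⟨i, hi⟩ := cover_PP hp
    exact ⟨i, (hUP i p hp).2 hi⟩
  have hsc : ∀ i, IsSimplyConnected (U i) := by
    intro i
    have hemb : IsOpenEmbedding (fun p : Ch i => q p.1) := by
      refine IsOpenEmbedding.of_continuous_injective_isOpenMap ?_ ?_ ?_
      · exact (hqc.mono (Ch_sub i)).domRestrict
      · intro p p' h
        rcases (hqf _ (Ch_sub i p.2) _ (Ch_sub i p'.2)).1 h with h | h
        · exact Subtype.ext h.symm
        · exfalso
          have := Ch_swap p.2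
          rw [← h] at this
          exact this p'.2
      · intro V hV
        have h1 : (fun p : Ch i => q p.1) '' V = q '' (Subtype.val '' V) := by
          rw [image_image]
        rw [h1]
        refine hqo _ ?_ ((isOpen_Ch i).isOpenMap_subtype_val V hV)
        rintro _ ⟨p, _, rfl⟩
        exact Ch_sub i p.2
    have : SimplyConnectedSpace (Ch i) := simplyConn_Ch i
    have hr : range (fun p : Ch i => q p.1) = U i := by
      ext y; simp [U]
    have h2 := hemb.isEmbedding.toHomeomorph.symm.toHomotopyEquiv.simplyConnectedSpace
    rw [hr] at h2
    exact h2
  have hpc : ∀ i, IsPathConnected (U i) := fun i => (hsc i).isPathConnected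
  have hWpc : ∀ k, IsPathConnected (W k) := fun k =>
    (pathConn_Pc k).image' (hqc.mono (Pc_sub k))
  have hWU : ∀ k, W k ⊆ U k.fst ∩ U k.snd := by
    rintro k _ ⟨p, hp, rfl⟩
    exact ⟨(hUP _ p (Pc_sub k hp)).2 (Pc_sub_fst k hp), (hUP _ p (Pc_sub k hp)).2 (Pc_sub_snd k hp)⟩
  have hrel : ∀ (x : X) (R : Ix → Ix → Prop), Equivalence R →
      (∀ k : Pc, x ∈ W k → R k.fst k.snd) → ∀ i j, x ∈ U i → x ∈ U j → R i j := by
    intro x R hR h i j hi hj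
    obtain ⟨p, hp, rfl⟩ := hqs x
    exact rel_all p R hR (fun k hk => h k (hWP k p hp hk)) i j ((hUP i p hp).1 hi)
      ((hUP j p hp).1 hj)
  -- path connectedness
  have hjoin : ∀ k : Pc, ∀ y ∈ U k.fst, ∀ z ∈ U k.snd, Joined y z := by
    intro k y hy z hz
    obtain ⟨v, hv⟩ := (hWpc k).nonempty
    exact ((hpc _).joinedIn y hy v (hWU k hv).1).joined.trans
      ((hpc _).joinedIn v (hWU k hv).2 z hz).joined
  have hEq : Equivalence (fun i j : Ix => ∀ y ∈ U i, ∀ z ∈ U j, Joined y z) := by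
    refine ⟨?_, ?_, ?_⟩
    · intro i y hy z hz; exact ((hpc i).joinedIn y hy z hz).joined
    · intro i j h y hy z hz; exact (h z hz y hy).symm
    · intro i j k h h' y hy z hz
      obtain ⟨v, hv⟩ := (hpc j).nonempty
      exact (h y hy v hv).trans (h' v hv z hz)
  have hPC : PathConnectedSpace X := by
    refine ⟨⟨x⟩, ?_⟩
    intro y z
    obtain ⟨i, hi⟩ := hc y
    obtain ⟨j, hj⟩ := hc z
    have t := tree_all _ hEq (hjoin .AB1) (hjoin (.BC 0)) (hjoin (.CF 0)) (hjoin .EF1)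
    exact hEq.trans (t i) (hEq.symm (t j)) y hi z hj
  -- base point and parallel sections
  let x0 : X := q (p1 0 0)
  have hp10 : p1 0 0 ∈ PP := Pc_sub _ (p1_AB1 0 0 le_rfl)
  have hp20 : p2 0 0 ∈ PP := Pc_sub _ (p2_AB2 0 0 le_rfl)
  have hA0 : x0 ∈ U .A := (hWU .AB1 ⟨_, p1_AB1 0 0 le_rfl, rfl⟩).2
  have hB0 : x0 ∈ U .B := (hWU .AB1 ⟨_, p1_AB1 0 0 le_rfl, rfl⟩).1
  have hC0 : x0 ∈ U .C := (hWU (.BC 0) ⟨_, p1_BC 0 0, rfl⟩).1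
  have hF0 : x0 ∈ U .F := (hWU (.CF 0) ⟨_, p1_CF 0 0, rfl⟩).1
  have hE2 : q (p2 0 0) ∈ U .E := (hWU .EF2 ⟨_, p2_EF2 0 0 le_rfl, rfl⟩).1
  obtain ⟨KA, hKA, hKA'⟩ := exists_parallel x0 _ (hsc .A) x0 hA0 (Path.Homotopic.Quotient.refl x0)
  obtain ⟨KB, hKB, hKB'⟩ := exists_parallel x0 _ (hsc .B) x0 hB0 (KA x0)
  obtain ⟨KC, hKC, hKC'⟩ := exists_parallel x0 _ (hsc .C) x0 hC0 (KB x0)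
  obtain ⟨KF, hKF, hKF'⟩ := exists_parallel x0 _ (hsc .F) x0 hF0 (KC x0)
  obtain ⟨KE, hKE, hKE'⟩ := exists_parallel x0 _ (hsc .E) (q (p2 0 0)) hE2 (KF (q (p2 0 0)))
  let K : Ix → ∀ y, Path.Homotopic.Quotient x0 y := fun i => match i with
    | .A => KA
    | .B => KB
    | .C => KC
    | .E => KE
    | .F => KF
  have hK : ∀ i y z (γ : Path y z), (∀ t, γ t ∈ U i) →
        K i z = (K i y).trans (Path.Homotopic.Quotient.mk γ) := by
    intro i
    cases i
    · exact hKA'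
    · exact hKB'
    · exact hKC'
    · exact hKE'
    · exact hKF'
  have hconst : ∀ k : Pc, ∀ p ∈ k.set, ∀ p' ∈ k.set,
      Hl K k.fst k.snd (q p) = Hl K k.fst k.snd (q p') := by
    intro k p hp p' hp'
    exact Hl_const K U hK _ _ (W k) (hWpc k) (fun y hy => (hWU k hy).1) (fun y hy => (hWU k hy).2)
      ⟨p, hp, rfl⟩ ⟨p', hp', rfl⟩
  -- the elements
  let e : FundamentalGroup X x0 := Hl K .B .A (q (p2 0 0))
  let α : FundamentalGroup X x0 := Hl K .E .F (q (p1 0 0))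
  let τ : Fin 3 → FundamentalGroup X x0 := fun k => Hl K .F .C (q (p1 k k))
  let ρ : Fin 3 → FundamentalGroup X x0 := fun k => Hl K .C .B (q (p1 k k))
  have cAB1 : ∀ p ∈ Pc.AB1.set, Hl K .B .A (q p) = 1 := fun p hp =>
    (hconst .AB1 p hp _ (p1_AB1 0 0 le_rfl)).trans (Hl_one_of_eq K _ _ _ hKB)
  have cAB2 : ∀ p ∈ Pc.AB2.set, Hl K .B .A (q p) = e := fun p hp =>
    hconst .AB2 p hp _ (p2_AB2 0 0 le_rfl)
  have cBC : ∀ k, ∀ p ∈ (Pc.BC k).set, Hl K .C .B (q p) = ρ k := fun k p hp =>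
    hconst (.BC k) p hp _ (p1_BC k k)
  have cCF : ∀ k, ∀ p ∈ (Pc.CF k).set, Hl K .F .C (q p) = τ k := fun k p hp =>
    hconst (.CF k) p hp _ (p1_CF k k)
  have cEF1 : ∀ p ∈ Pc.EF1.set, Hl K .E .F (q p) = α := fun p hp =>
    hconst .EF1 p hp _ (p1_EF1 0 0 le_rfl)
  have cEF2 : ∀ p ∈ Pc.EF2.set, Hl K .E .F (q p) = 1 := fun p hp =>
    (hconst .EF2 p hp _ (p2_EF2 0 0 le_rfl)).trans (Hl_one_of_eq K _ _ _ hKE)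
  have τ0 : τ 0 = 1 := Hl_one_of_eq K _ _ _ hKF
  have ρ0 : ρ 0 = 1 := Hl_one_of_eq K _ _ _ hKC
  have key1 : ∀ k k', k ≤ k' → Hl K .E .A (q (p1 k k')) = α * τ k' * ρ k := by
    intro k k' h
    rw [← Hl_mul K .E .B .A, cAB1 _ (p1_AB1 k k' h), mul_one, ← Hl_mul K .E .C .B,
      cBC k _ (p1_BC k k'), ← Hl_mul K .E .F .C, cCF k' _ (p1_CF k k'), cEF1 _ (p1_EF1 k k' h)]
  have key2 : ∀ k k', k ≤ k' → Hl K .E .A (q (p2 k k')) = τ k * ρ k' * e := by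
    intro k k' h
    have hs : q (p2 k k').swap = q (p2 k k') := hsw _ (Pc_sub _ (p2_AB2 k k' h))
    have h1 := cBC k' _ (p2_BC k k')
    have h2 := cCF k _ (p2_CF k k')
    rw [hs] at h1 h2
    rw [← Hl_mul K .E .B .A, cAB2 _ (p2_AB2 k k' h), ← Hl_mul K .E .C .B,
      h1, ← Hl_mul K .E .F .C, h2, cEF2 _ (p2_EF2 k k' h), one_mul]
  have key : ∀ k k', k ≤ k' → α * τ k' * ρ k = τ k * ρ k' * e := by
    intro k k' h
    rw [← key1 k k' h, ← key2 k k' h]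
    exact hconst (.AE k k' h) _ (p1_AE k k' h) _ (p2_AE k k' h)
  have hα : α = e := by
    have := key 0 0 le_rfl
    rwa [τ0, ρ0, mul_one, mul_one, one_mul, one_mul] at this
  have hρ : ∀ k, ρ k = e * τ k * e⁻¹ := by
    intro k
    have := key 0 k (Fin.zero_le k)
    rw [τ0, ρ0, mul_one, one_mul, hα] at this
    rw [this, mul_inv_cancel_right]
  have hτ : ∀ k, τ k = tau (τ 1) (τ 2) k := by
    intro k
    fin_cases k
    · exact τ0
    · rfl
    · rfl
  have krel : ∀ k k', k ≤ k' → e * τ k' * e * τ k = τ k * e * τ k' * e := by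
    intro k k' h
    have := key k k' h
    rw [hα, hρ, hρ] at this
    have h2 := congrArg (· * e) this
    simp only [mul_assoc, inv_mul_cancel, mul_one] at h2 ⊢
    exact h2
  obtain ⟨Ψ, hΨe, hΨa, hΨc⟩ := exists_hom e (τ 1) (τ 2) (krel 1 1 le_rfl) (krel 2 2 le_rfl)
    (krel 1 2 (by decide))
  have hΨ : ∀ k x, x ∈ W k → Hl K k.fst k.snd x = Ψ (k.word gE gA (gA * gB)) := by
    rintro k _ ⟨p, hp, rfl⟩
    rw [Pc.word_map, hΨe, hΨa, hΨc]
    cases k with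
    | AB1 => exact cAB1 p hp
    | AB2 => exact cAB2 p hp
    | BC k => rw [Pc.word, ← hτ, ← hρ]; exact cBC k p hp
    | CF k => rw [Pc.word, ← hτ]; exact cCF k p hp
    | EF1 => exact (cEF1 p hp).trans hα
    | EF2 => exact cEF2 p hp
    | AE k k' h =>
      rw [Pc.word, ← hτ, ← hτ, hconst (.AE k k' h) _ hp _ (p2_AE k k' h)]
      refine (key2 k k' h).trans ?_
      rw [hρ]
      simp only [mul_assoc, inv_mul_cancel, mul_one]
  -- the potential downstairs
  choose lift hlift hqlift using hqs
  let f : Ix → X → PresentedGroup relsG := fun i x => spot gE gA (gA * gB) i (lift x)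
  have hfq : ∀ i, ∀ p ∈ PP, p ∈ UP i → f i (q p) = spot gE gA (gA * gB) i p := by
    intro i p hp hi
    have := (hqf p hp _ (hlift (q p))).1 (hqlift (q p)).symm
    simp only [f]
    rcases this with h | h
    · rw [h]
    · rw [h, spot_swap _ _ _ hi]
  have hbij := abstract_bij x0 U hU hc hpc W hW Pc.fst Pc.snd hrel (Pc.word gE gA (gA * gB)) f (by
      rintro k _ ⟨p, hp, rfl⟩
      rw [hfq _ p (Pc_sub k hp) (Pc_sub_fst k hp), hfq _ p (Pc_sub k hp) (Pc_sub_snd k hp)]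
      exact spot_word _ _ _ G_h1 G_h2 G_h3 k hp)
    hWU (fun k => (hWpc k).nonempty) K hK .A hA0 hKA (by
      simp only [f, spot]
      split_ifs <;> rfl) Ψ hΨ (by
      intro R hR h i
      refine tree_all R hR (h .AB1 rfl) (h (.BC 0) ?_) (h (.CF 0) rfl) (h .EF2 rfl) i
      simp [Pc.word, tau]) gen_word
  exact ⟨(FundamentalGroup.fundamentalGroupMulEquivOfPathConnected x x0).trans
    (MulEquiv.ofBijective Ψ hbij).symm⟩

end

end ConicPi

namespace ConicPi

open Topology Filter Set

noncomputable section

/-- the complement of the arrangement -/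
abbrev Mset : Set (Projectivization ℂ (Fin 3 → ℂ)) := (conicC ∪ lineL 0 ∪ lineL 1 ∪ lineL 2)ᶜ

theorem eval_f (v : Fin 3 → ℂ) : MvPolynomial.eval v fPoly =
    v 0 ^ 2 + v 1 ^ 2 + v 2 ^ 2 + 2 * (v 0 * v 2 - v 0 * v 1 + v 1 * v 2) := by
  simp [fPoly]

theorem mem_M (x : Projectivization ℂ (Fin 3 → ℂ)) : x ∈ Mset ↔
    (MvPolynomial.eval x.rep fPoly ≠ 0 ∧ x.rep 0 ≠ 0 ∧ x.rep 1 ≠ 0 ∧ x.rep 2 ≠ 0) := by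
  have : x ∈ Mset ↔ ¬ (((MvPolynomial.eval x.rep fPoly = 0 ∨ x.rep 0 = 0) ∨ x.rep 1 = 0) ∨ x.rep 2 = 0) :=
    Iff.rfl
  rw [this]; tauto

theorem mem_M_mk (v : Fin 3 → ℂ) (hv : v ≠ 0) : Projectivization.mk ℂ v hv ∈ Mset ↔
    (MvPolynomial.eval v fPoly ≠ 0 ∧ v 0 ≠ 0 ∧ v 1 ≠ 0 ∧ v 2 ≠ 0) := by
  rw [mem_M]
  obtain ⟨a, ha⟩ := Projectivization.exists_smul_eq_mk_rep ℂ v hv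
  have ha0 : (a : ℂ) ≠ 0 := a.ne_zero
  have hi : ∀ i, (Projectivization.mk ℂ v hv).rep i = a * v i := by
    intro i; rw [← ha]; rfl
  have he : MvPolynomial.eval (Projectivization.mk ℂ v hv).rep fPoly
      = (a : ℂ) ^ 2 * MvPolynomial.eval v fPoly := by
    rw [eval_f, eval_f, hi, hi, hi]; ring
  rw [he, hi, hi, hi]
  simp [ha0]

/-- homogeneous coordinates of the point attached to an unordered pair -/
def vv (p : ℂ × ℂ) : Fin 3 → ℂ := ![p.1 * p.2, (1 - p.1) * (1 - p.2), -1]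

theorem vv_ne (p : ℂ × ℂ) : vv p ≠ 0 := by
  intro h
  have := congrFun h 2
  simp [vv] at this

theorem eval_vv (p : ℂ × ℂ) : MvPolynomial.eval (vv p) fPoly = (p.1 - p.2) ^ 2 := by
  rw [eval_f]; simp [vv]; ring

theorem vv_mem (p : ℂ × ℂ) : Projectivization.mk ℂ (vv p) (vv_ne p) ∈ Mset ↔ p ∈ PP := by
  rw [mem_M_mk, eval_vv]
  have : p ∈ PP ↔ p.1 ≠ p.2 ∧ (p.1 ≠ 0 ∧ p.1 ≠ 1) ∧ (p.2 ≠ 0 ∧ p.2 ≠ 1) := Iff.rfl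
  rw [this]
  have h1 : (1 - p.1 = 0) ↔ p.1 = 1 := by rw [sub_eq_zero, eq_comm]
  have h2 : (1 - p.2 = 0) ↔ p.2 = 1 := by rw [sub_eq_zero, eq_comm]
  simp [vv, sub_eq_zero, h1, h2]
  tauto

/-- affine form of the map -/
def gg (p : ℂ × ℂ) : ℂ × ℂ := (p.1 * p.2, (1 - p.1) * (1 - p.2))

theorem isOpen_gg (V : Set (ℂ × ℂ)) (hV : IsOpen V) (hVP : V ⊆ PP) : IsOpen (gg '' V) := by
  rw [isOpen_iff_mem_nhds]
  rintro _ ⟨p, hp, rfl⟩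
  have h1 : HasStrictFDerivAt (fun p : ℂ × ℂ => p.1) (ContinuousLinearMap.fst ℂ ℂ ℂ) p :=
    hasStrictFDerivAt_fst
  have h2 : HasStrictFDerivAt (fun p : ℂ × ℂ => p.2) (ContinuousLinearMap.snd ℂ ℂ ℂ) p :=
    hasStrictFDerivAt_snd
  have h := (h1.mul h2).prodMk ((h1.const_sub 1).mul (h2.const_sub 1))
  have hs : p.1 - p.2 ≠ 0 := sub_ne_zero.2 (hVP hp).1
  have hm := h.map_nhds_eq_of_surj (by
    rw [LinearMap.range_eq_top]
    rintro ⟨A, B⟩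
    refine ⟨(((1 - p.1) * A + p.1 * B) / (p.2 - p.1), ((1 - p.2) * A + p.2 * B) / (p.1 - p.2)), ?_⟩
    have hs' : p.2 - p.1 ≠ 0 := by rw [← neg_sub]; exact neg_ne_zero.2 hs
    ext
    · simp
      field_simp
      ring
    · simp
      field_simp
      ring)
  have : gg '' V ∈ map gg (𝓝 p) := image_mem_map (hV.mem_nhds hp)
  exact hm ▸ this

theorem gg_surj (A B : ℂ) : ∃ p, gg p = (A, B) := by
  obtain ⟨d, hd⟩ := IsAlgClosed.exists_pow_nat_eq ((1 + A - B) ^ 2 - 4 * A) (n := 2) (by norm_num)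
  refine ⟨((1 + A - B + d) / 2, (1 + A - B - d) / 2), ?_⟩
  unfold gg
  ext
  · simp only
    linear_combination (-1 / 4) * hd
  · simp only
    linear_combination (-1 / 4) * hd

theorem gg_inj {p p' : ℂ × ℂ} (h : gg p = gg p') : p' = p ∨ p' = p.swap := by
  have h1 : p.1 * p.2 = p'.1 * p'.2 := congrArg Prod.fst h
  have h2 : (1 - p.1) * (1 - p.2) = (1 - p'.1) * (1 - p'.2) := congrArg Prod.snd h
  have h3 : (p'.1 - p.1) * (p'.1 - p.2) = 0 := by
    linear_combination (1 - p'.1) * h1 + p'.1 * h2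
  rcases mul_eq_zero.1 h3 with h4 | h4
  · left
    have h4 : p'.1 = p.1 := sub_eq_zero.1 h4
    refine Prod.ext h4 ?_
    linear_combination h2 - h1 - h4
  · right
    have h4 : p'.1 = p.2 := sub_eq_zero.1 h4
    refine Prod.ext h4 ?_
    simp only [Prod.snd_swap]
    linear_combination h2 - h1 - h4

theorem mk_vv_eq (p : ℂ × ℂ) (v : Fin 3 → ℂ) (hv : v ≠ 0) :
    Projectivization.mk ℂ v hv = Projectivization.mk ℂ (vv p) (vv_ne p) ↔
      v 2 ≠ 0 ∧ gg p = (- v 0 / v 2, - v 1 / v 2) := by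
  rw [Projectivization.mk_eq_mk_iff']
  constructor
  · rintro ⟨a, ha⟩
    have h0 : a * (p.1 * p.2) = v 0 := congrFun ha 0
    have h1 : a * ((1 - p.1) * (1 - p.2)) = v 1 := congrFun ha 1
    have h2 : a * (-1) = v 2 := congrFun ha 2
    have ha0 : a ≠ 0 := by
      rintro rfl
      exact hv (by rw [← ha, zero_smul])
    have hv2 : v 2 ≠ 0 := by rw [← h2]; simpa using ha0
    refine ⟨hv2, ?_⟩
    rw [← h0, ← h1, ← h2]
    unfold gg
    ext <;> simp only <;> field_simp
  · rintro ⟨hv2, h⟩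
    have h0 : p.1 * p.2 = - v 0 / v 2 := congrArg Prod.fst h
    have h1 : (1 - p.1) * (1 - p.2) = - v 1 / v 2 := congrArg Prod.snd h
    refine ⟨- v 2, ?_⟩
    ext i
    fin_cases i
    · simp [vv, h0]; field_simp
    · simp [vv, h1]; field_simp
    · simp [vv]

theorem isOpen_mk_vv (V : Set (ℂ × ℂ)) (hV : IsOpen V) (hVP : V ⊆ PP) :
    IsOpen ((fun p => Projectivization.mk ℂ (vv p) (vv_ne p)) '' V) := by
  have key : IsOpen ({v : { v : Fin 3 → ℂ // v ≠ 0 } | v.1 2 ≠ 0} ∩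
      (fun v : { v : Fin 3 → ℂ // v ≠ 0 } => (- v.1 0 / v.1 2, - v.1 1 / v.1 2)) ⁻¹' (gg '' V)) := by
    refine ContinuousOn.isOpen_inter_preimage ?_ ?_ (isOpen_gg V hV hVP)
    · have hc : ∀ i : Fin 3, Continuous (fun v : { v : Fin 3 → ℂ // v ≠ 0 } => v.1 i) :=
        fun i => (continuous_apply i).comp continuous_subtype_val
      refine ContinuousOn.prodMk ?_ ?_
      · exact (hc 0).neg.continuousOn.div (hc 2).continuousOn (fun v hv => hv)
      · exact (hc 1).neg.continuousOn.div (hc 2).continuousOn (fun v hv => hv)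
    · exact isOpen_ne_fun ((continuous_apply 2).comp continuous_subtype_val) continuous_const
  have : IsQuotientMap (Quotient.mk (projectivizationSetoid ℂ (Fin 3 → ℂ))) := isQuotientMap_quot_mk
  refine this.isOpen_preimage.1 ?_
  convert key using 1
  ext v
  constructor
  · rintro ⟨p, hp, h⟩
    have h' : Projectivization.mk ℂ v.1 v.2 = Projectivization.mk ℂ (vv p) (vv_ne p) := h.symm
    obtain ⟨h1, h2⟩ := (mk_vv_eq p v.1 v.2).1 h'
    exact ⟨h1, p, hp, h2⟩
  · rintro ⟨h1, p, hp, h2⟩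
    refine ⟨p, hp, ?_⟩
    exact ((mk_vv_eq p v.1 v.2).2 ⟨h1, h2⟩).symm

theorem main_M (x : Mset) : Nonempty (FundamentalGroup Mset x ≃* PresentedGroup relsG) := by
  classical
  let q : ℂ × ℂ → Mset := fun p => if h : p ∈ PP then
    ⟨Projectivization.mk ℂ (vv p) (vv_ne p), (vv_mem p).2 h⟩ else x
  have hq : ∀ p ∈ PP, (q p).1 = Projectivization.mk ℂ (vv p) (vv_ne p) := by
    intro p hp; simp only [q, dif_pos hp]
  refine main_abs q ?_ ?_ ?_ ?_ x
  · rw [continuousOn_iff_continuous_domRestrict]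
    rw [continuous_induced_rng]
    have h1 : Continuous (fun p : PP => Projectivization.mk ℂ (vv p.1) (vv_ne p.1)) := by
      have h2 : Continuous (fun p : PP => (⟨vv p.1, vv_ne p.1⟩ : { v : Fin 3 → ℂ // v ≠ 0 })) := by
        refine Continuous.subtype_mk ?_ _
        refine continuous_pi ?_
        intro i
        fin_cases i
        · simp [vv]; fun_prop
        · simp [vv]; fun_prop
        · simp [vv]; fun_prop
      have h3 : Continuous (Quotient.mk (projectivizationSetoid ℂ (Fin 3 → ℂ))) :=
        continuous_quot_mk
      exact h3.comp h2
    refine h1.congr ?_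
    intro p
    exact (hq p.1 p.2).symm
  · intro V hVP hV
    refine isOpen_induced_iff.2 ⟨_, isOpen_mk_vv V hV hVP, ?_⟩
    ext y
    constructor
    · rintro ⟨p, hp, h⟩
      exact ⟨p, hp, Subtype.ext ((hq p (hVP hp)).trans h)⟩
    · rintro ⟨p, hp, rfl⟩
      exact ⟨p, hp, (hq p (hVP hp)).symm⟩
  · intro y
    have hy := y.2
    rw [mem_M] at hy
    obtain ⟨p, hp⟩ := gg_surj (- y.1.rep 0 / y.1.rep 2) (- y.1.rep 1 / y.1.rep 2)
    have h := (mk_vv_eq p y.1.rep y.1.rep_nonzero).2 ⟨hy.2.2.2, hp⟩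
    rw [Projectivization.mk_rep] at h
    have hpP : p ∈ PP := (vv_mem p).1 (h ▸ y.2)
    exact ⟨p, hpP, Subtype.ext ((hq p hpP).trans h.symm)⟩
  · intro p hp p' hp'
    rw [Subtype.ext_iff, hq p hp, hq p' hp', mk_vv_eq]
    constructor
    · rintro ⟨_, h⟩
      have h' : gg p' = gg p := by rw [h]; simp [vv, gg]
      exact gg_inj h'.symm
    · intro h
      refine ⟨by simp [vv], ?_⟩
      rcases h with rfl | rfl
      · simp [vv, gg]
      · simp [vv, gg, mul_comm]

end

end ConicPi

/-- The fundamental group `G = π₁(ℙ²(ℂ) ∖ (C ∪ L₀ ∪ L₁ ∪ L₂))` is the group with generators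
`e, ℓ₁, ℓ₂` and relations `[e ℓ₁ e⁻¹, ℓ₂] = 1`, `(ℓ₁ e)² = (e ℓ₁)²`, `(ℓ₂ e)² = (e ℓ₂)²`,
`(ℓ₁ ℓ₂ e)² = (e ℓ₁ ℓ₂)²`. -/
theorem fundamental_group_complement_conic_and_lines
    (x : ↥(conicC ∪ lineL 0 ∪ lineL 1 ∪ lineL 2)ᶜ) :
    Nonempty (FundamentalGroup (↥(conicC ∪ lineL 0 ∪ lineL 1 ∪ lineL 2)ᶜ) x ≃*
      PresentedGroup relsG) := by
  exact ConicPi.main_M x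

end
end

section
/- The group presented by generators e₁, e₂, ℓ₀, ℓ₁, ℓ₂ and relations e₁ = e₂ (call the common value e), [e ℓ₁ e⁻¹, ℓ₂] = 1, (ℓ₁ e)² = (e ℓ₁)², (ℓ₂ e)² = (e ℓ₂)², [e ℓ₁ e⁻¹, ℓ₀] = 1, (ℓ₀ · ℓ₁⁻¹ e ℓ₁)² = (ℓ₁⁻¹ e ℓ₁ · ℓ₀)², ℓ₀⁻¹ ℓ₁⁻¹ e ℓ₁ ℓ₀ = ℓ₂ e ℓ₂⁻¹, [ℓ₂, ℓ₁⁻¹ e ℓ₁ ℓ₀ ℓ₁⁻¹ e⁻¹ ℓ₁] = 1, and ℓ₂ e² ℓ₁ ℓ₀ = 1, is isomorphic to the group presented by generators e, ℓ₁, ℓ₂ and relations [e ℓ₁ e⁻¹, ℓ₂] = 1, (ℓ₁ e)² = (e ℓ₁)², (ℓ₂ e)² = (e ℓ₂)², (ℓ₁ ℓ₂ e)² = (e ℓ₁ ℓ₂)². -/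
open FreeGroup

/-- Generators `e₁, e₂, ℓ₀, ℓ₁, ℓ₂` of the first presentation. -/
inductive GenA : Type
  | e1 : GenA
  | e2 : GenA
  | l0 : GenA
  | l1 : GenA
  | l2 : GenA

/-- Generators `e, ℓ₁, ℓ₂` of the second presentation. -/
inductive GenB : Type
  | e : GenB
  | l1 : GenB
  | l2 : GenB

namespace GenA

/-- `e` denotes the common value `e₁ = e₂`; here we take the word `e₁`. -/
def E : FreeGroup GenA := of e1
def L0 : FreeGroup GenA := of l0
def L1 : FreeGroup GenA := of l1
def L2 : FreeGroup GenA := of l2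

/-- The relators of the first presentation: `e₁ = e₂`, `[e ℓ₁ e⁻¹, ℓ₂] = 1`,
`(ℓ₁ e)² = (e ℓ₁)²`, `(ℓ₂ e)² = (e ℓ₂)²`, `[e ℓ₁ e⁻¹, ℓ₀] = 1`,
`(ℓ₀ · ℓ₁⁻¹ e ℓ₁)² = (ℓ₁⁻¹ e ℓ₁ · ℓ₀)²`, `ℓ₀⁻¹ ℓ₁⁻¹ e ℓ₁ ℓ₀ = ℓ₂ e ℓ₂⁻¹`,
`[ℓ₂, ℓ₁⁻¹ e ℓ₁ ℓ₀ ℓ₁⁻¹ e⁻¹ ℓ₁] = 1` and `ℓ₂ e² ℓ₁ ℓ₀ = 1`. -/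
def relsA : Set (FreeGroup GenA) :=
  { of e1 * (of e2)⁻¹,
    (E * L1 * E⁻¹) * L2 * (E * L1 * E⁻¹)⁻¹ * L2⁻¹,
    (L1 * E) ^ 2 * ((E * L1) ^ 2)⁻¹,
    (L2 * E) ^ 2 * ((E * L2) ^ 2)⁻¹,
    (E * L1 * E⁻¹) * L0 * (E * L1 * E⁻¹)⁻¹ * L0⁻¹,
    (L0 * (L1⁻¹ * E * L1)) ^ 2 * (((L1⁻¹ * E * L1) * L0) ^ 2)⁻¹,
    (L0⁻¹ * L1⁻¹ * E * L1 * L0) * (L2 * E * L2⁻¹)⁻¹,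
    L2 * (L1⁻¹ * E * L1 * L0 * L1⁻¹ * E⁻¹ * L1) * L2⁻¹ *
      (L1⁻¹ * E * L1 * L0 * L1⁻¹ * E⁻¹ * L1)⁻¹,
    L2 * E ^ 2 * L1 * L0 }

end GenA

namespace GenB

/-- The relators of the second presentation: `[e ℓ₁ e⁻¹, ℓ₂] = 1`, `(ℓ₁ e)² = (e ℓ₁)²`,
`(ℓ₂ e)² = (e ℓ₂)²`, `(ℓ₁ ℓ₂ e)² = (e ℓ₁ ℓ₂)²`. -/
def relsB : Set (FreeGroup GenB) :=
  { (of e * of l1 * (of e)⁻¹) * of l2 * (of e * of l1 * (of e)⁻¹)⁻¹ * (of l2)⁻¹,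
    (of l1 * of e) ^ 2 * ((of e * of l1) ^ 2)⁻¹,
    (of l2 * of e) ^ 2 * ((of e * of l2) ^ 2)⁻¹,
    (of l1 * of l2 * of e) ^ 2 * ((of e * of l1 * of l2) ^ 2)⁻¹ }

end GenB

/-- `[e ℓ₁ e⁻¹, ℓ₀] = 1` follows from the second presentation. -/
theorem aux_rel5 {G : Type*} [Group G] (e a b : G)
    (h1 : (e * a * e⁻¹) * b * (e * a * e⁻¹)⁻¹ * b⁻¹ = 1)
    (h2 : (a * e) ^ 2 * ((e * a) ^ 2)⁻¹ = 1) :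
    (e * a * e⁻¹) * (b * e ^ 2 * a)⁻¹ * (e * a * e⁻¹)⁻¹ * ((b * e ^ 2 * a)⁻¹)⁻¹ = 1 := by
  have c1 : Commute (e * a * e⁻¹) b := by
    rw [mul_inv_eq_one, mul_inv_eq_iff_eq_mul] at h1; exact h1
  have c2 : Commute (e * a * e⁻¹) (e ^ 2 * a) := by
    rw [mul_inv_eq_one] at h2
    change _ = _
    calc (e * a * e⁻¹) * (e ^ 2 * a) = (e * a) ^ 2 := by simp only [pow_two]; group
      _ = e * (a * e) ^ 2 * e⁻¹ := by simp only [pow_two]; group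
      _ = e * (e * a) ^ 2 * e⁻¹ := by rw [h2]
      _ = (e ^ 2 * a) * (e * a * e⁻¹) := by simp only [pow_two]; group
  have c3 : Commute (e * a * e⁻¹) (b * e ^ 2 * a)⁻¹ := by
    rw [mul_assoc b]; exact (c1.mul_right c2).inv_right
  rw [mul_inv_eq_one, mul_inv_eq_iff_eq_mul]; exact c3

/-- Relation six (with `ℓ₀` eliminated) is equivalent to `(ℓ₁ ℓ₂ e)² = (e ℓ₁ ℓ₂)²`. -/
theorem aux_rel6 {G : Type*} [Group G] (e a b : G) :
    ((b * e ^ 2 * a)⁻¹ * (a⁻¹ * e * a)) ^ 2 * (((a⁻¹ * e * a) * (b * e ^ 2 * a)⁻¹) ^ 2)⁻¹ = 1 ↔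
    (a * b * e) ^ 2 * ((e * a * b) ^ 2)⁻¹ = 1 := by
  have key : ((b * e ^ 2 * a)⁻¹ * (a⁻¹ * e * a)) ^ 2 *
      (((a⁻¹ * e * a) * (b * e ^ 2 * a)⁻¹) ^ 2)⁻¹ =
      (a⁻¹ * (e ^ 2)⁻¹ * (a * b * e * a * b)⁻¹) * ((a * b * e) ^ 2 * ((e * a * b) ^ 2)⁻¹)⁻¹ *
      (a⁻¹ * (e ^ 2)⁻¹ * (a * b * e * a * b)⁻¹)⁻¹ := by
    simp only [pow_two]; group
  rw [key, conj_eq_one_iff, inv_eq_one]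

/-- `[ℓ₂, ℓ₁⁻¹ e ℓ₁ ℓ₀ ℓ₁⁻¹ e⁻¹ ℓ₁] = 1` follows from the second presentation. -/
theorem aux_rel8 {G : Type*} [Group G] (e a b : G)
    (h1 : (e * a * e⁻¹) * b * (e * a * e⁻¹)⁻¹ * b⁻¹ = 1)
    (h2 : (a * e) ^ 2 * ((e * a) ^ 2)⁻¹ = 1)
    (h3 : (b * e) ^ 2 * ((e * b) ^ 2)⁻¹ = 1) :
    b * (a⁻¹ * e * a * (b * e ^ 2 * a)⁻¹ * a⁻¹ * e⁻¹ * a) * b⁻¹ *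
      (a⁻¹ * e * a * (b * e ^ 2 * a)⁻¹ * a⁻¹ * e⁻¹ * a)⁻¹ = 1 := by
  have c1 : Commute b (e * a * e⁻¹) := by
    rw [mul_inv_eq_one, mul_inv_eq_iff_eq_mul] at h1; exact h1.symm
  have c3 : Commute b (e * b * e) := by
    rw [mul_inv_eq_one] at h3
    change _ = _
    simpa only [pow_two, mul_assoc] using h3
  rw [mul_inv_eq_one] at h2
  have d : a⁻¹ * e * a = e * a * e * a⁻¹ * e⁻¹ := by
    calc a⁻¹ * e * a = a⁻¹ * (e * a) ^ 2 * a⁻¹ * e⁻¹ := by simp only [pow_two]; group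
      _ = a⁻¹ * (a * e) ^ 2 * a⁻¹ * e⁻¹ := by rw [h2]
      _ = _ := by simp only [pow_two]; group
  have x : a⁻¹ * e * a * (b * e ^ 2 * a)⁻¹ * a⁻¹ * e⁻¹ * a =
      ((e * a * e⁻¹) * (e * b * e))⁻¹ := by
    calc a⁻¹ * e * a * (b * e ^ 2 * a)⁻¹ * a⁻¹ * e⁻¹ * a
        = ((a⁻¹ * e * a) * b * e * a)⁻¹ := by simp only [pow_two]; group
      _ = (e * a * e * a⁻¹ * e⁻¹ * b * e * a)⁻¹ := by rw [d]
      _ = (e * a * e * a⁻¹ * e⁻¹ * (b * (e * a * e⁻¹)) * e)⁻¹ := by group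
      _ = (e * a * e * a⁻¹ * e⁻¹ * ((e * a * e⁻¹) * b) * e)⁻¹ := by rw [c1.eq]
      _ = _ := by group
  rw [x, mul_inv_eq_one, mul_inv_eq_iff_eq_mul]
  exact (c1.mul_right c3).inv_right

/-- Images of the generators of the first presentation. -/
def mapAB : GenA → PresentedGroup GenB.relsB
  | .e1 => PresentedGroup.of .e
  | .e2 => PresentedGroup.of .e
  | .l0 => (PresentedGroup.of .l2 * PresentedGroup.of .e ^ 2 * PresentedGroup.of .l1)⁻¹
  | .l1 => PresentedGroup.of .l1
  | .l2 => PresentedGroup.of .l2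

/-- Images of the generators of the second presentation. -/
def mapBA : GenB → PresentedGroup GenA.relsA
  | .e => PresentedGroup.of .e1
  | .l1 => PresentedGroup.of .l1
  | .l2 => PresentedGroup.of .l2

/-- What it means for a homomorphism to kill the relators of the first presentation. -/
theorem relsA_iff {G : Type*} [Group G] (f : FreeGroup GenA →* G) (e ee l0 a b : G)
    (he : f (of .e1) = e) (hee : f (of .e2) = ee) (hl : f (of .l0) = l0) (ha : f (of .l1) = a)
    (hb : f (of .l2) = b) :
    (∀ r ∈ GenA.relsA, f r = 1) ↔
      e * ee⁻¹ = 1 ∧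
      (e * a * e⁻¹) * b * (e * a * e⁻¹)⁻¹ * b⁻¹ = 1 ∧
      (a * e) ^ 2 * ((e * a) ^ 2)⁻¹ = 1 ∧
      (b * e) ^ 2 * ((e * b) ^ 2)⁻¹ = 1 ∧
      (e * a * e⁻¹) * l0 * (e * a * e⁻¹)⁻¹ * l0⁻¹ = 1 ∧
      (l0 * (a⁻¹ * e * a)) ^ 2 * (((a⁻¹ * e * a) * l0) ^ 2)⁻¹ = 1 ∧
      (l0⁻¹ * a⁻¹ * e * a * l0) * (b * e * b⁻¹)⁻¹ = 1 ∧
      b * (a⁻¹ * e * a * l0 * a⁻¹ * e⁻¹ * a) * b⁻¹ *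
        (a⁻¹ * e * a * l0 * a⁻¹ * e⁻¹ * a)⁻¹ = 1 ∧
      b * e ^ 2 * a * l0 = 1 := by
  simp only [GenA.relsA, GenA.E, GenA.L0, GenA.L1, GenA.L2, Set.mem_insert_iff,
    Set.mem_singleton_iff, forall_eq_or_imp, forall_eq,
    _root_.map_mul, _root_.map_inv, _root_.map_pow, he, hee, hl, ha, hb]

/-- What it means for a homomorphism to kill the relators of the second presentation. -/
theorem relsB_iff {G : Type*} [Group G] (f : FreeGroup GenB →* G) (e a b : G)
    (he : f (of .e) = e) (ha : f (of .l1) = a) (hb : f (of .l2) = b) :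
    (∀ r ∈ GenB.relsB, f r = 1) ↔
      (e * a * e⁻¹) * b * (e * a * e⁻¹)⁻¹ * b⁻¹ = 1 ∧
      (a * e) ^ 2 * ((e * a) ^ 2)⁻¹ = 1 ∧
      (b * e) ^ 2 * ((e * b) ^ 2)⁻¹ = 1 ∧
      (a * b * e) ^ 2 * ((e * a * b) ^ 2)⁻¹ = 1 := by
  simp only [GenB.relsB, Set.mem_insert_iff, Set.mem_singleton_iff, forall_eq_or_imp, forall_eq,
    _root_.map_mul, _root_.map_inv, _root_.map_pow, he, ha, hb]

theorem mapAB_rels : ∀ r ∈ GenA.relsA, FreeGroup.lift mapAB r = 1 := by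
  obtain ⟨h1, h2, h3, h4⟩ := (relsB_iff (PresentedGroup.mk GenB.relsB) _ _ _ rfl rfl rfl).1
    (fun r hr => PresentedGroup.one_of_mem hr)
  refine (relsA_iff _ _ _ _ _ _ FreeGroup.lift_apply_of FreeGroup.lift_apply_of
    FreeGroup.lift_apply_of FreeGroup.lift_apply_of FreeGroup.lift_apply_of).2
    ⟨mul_inv_cancel _, h1, h2, h3, aux_rel5 _ _ _ h1 h2, (aux_rel6 _ _ _).2 h4, ?_,
    aux_rel8 _ _ _ h1 h2 h3, mul_inv_cancel _⟩
  simp only [mapAB, pow_two]; group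

theorem relsA_eqs :
    (PresentedGroup.of .e1 : PresentedGroup GenA.relsA) = PresentedGroup.of .e2 ∧
    (PresentedGroup.of .l0 : PresentedGroup GenA.relsA) =
      (PresentedGroup.of .l2 * PresentedGroup.of .e1 ^ 2 * PresentedGroup.of .l1)⁻¹ ∧
    ∀ r ∈ GenB.relsB, FreeGroup.lift mapBA r = 1 := by
  obtain ⟨h0, h1, h2, h3, -, h6, -, -, h9⟩ :=
    (relsA_iff (PresentedGroup.mk GenA.relsA) _ _ _ _ _ rfl rfl rfl rfl rfl).1
    (fun r hr => PresentedGroup.one_of_mem hr)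
  have hnine := eq_inv_of_mul_eq_one_right h9
  rw [hnine] at h6
  exact ⟨mul_inv_eq_one.1 h0, hnine, (relsB_iff _ _ _ _ FreeGroup.lift_apply_of
    FreeGroup.lift_apply_of FreeGroup.lift_apply_of).2 ⟨h1, h2, h3, (aux_rel6 _ _ _).1 h6⟩⟩

/-- The group presented by generators `e₁, e₂, ℓ₀, ℓ₁, ℓ₂` and the nine listed relations is
isomorphic to the group presented by generators `e, ℓ₁, ℓ₂` and the four listed relations. -/
theorem presentation_simplification :
    Nonempty (PresentedGroup GenA.relsA ≃* PresentedGroup GenB.relsB) := by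
  obtain ⟨he, hl, hr⟩ := relsA_eqs
  refine ⟨MonoidHom.toMulEquiv (PresentedGroup.toGroup mapAB_rels) (PresentedGroup.toGroup hr)
    ?_ ?_⟩
  · ext x
    cases x <;> simp [mapAB, mapBA, he, hl]
  · ext x
    cases x <;> simp [mapAB, mapBA]
end

section
/- Let n be an odd positive integer and let f(x,y,z) = x² + y² + z² + 2(xz − xy + yz). Then the polynomial F_n(x,y,z) = f(x^n, y^n, z^n) = x^{2n} + y^{2n} + z^{2n} + 2(x^n z^n − x^n y^n + y^n z^n) is irreducible in the polynomial ring ℂ[x,y,z]. -/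
open MvPolynomial

noncomputable section

/-- `F_n(x,y,z) = f(xⁿ, yⁿ, zⁿ)`. -/
def Fn (n : ℕ) : MvPolynomial (Fin 3) ℂ :=
  bind₁ (fun i => X i ^ n) fPoly

lemma aux_not_sq (n : ℕ) (hpos : 0 < n) (g : ℂ) (hg : g ^ n = -Complex.I)
    (h : (X 0 - C g * X 1 : MvPolynomial (Fin 2) ℂ) ^ 2 ∣ X 0 ^ n + C Complex.I * X 1 ^ n) :
    False := by
  obtain ⟨q, hq⟩ := h
  have h1 := congrArg (fun p => eval ![g, 1] (pderiv (0 : Fin 2) p)) hq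
  have hg0 : g ≠ 0 := by
    rintro rfl
    rw [zero_pow hpos.ne'] at hg
    exact Complex.I_ne_zero (by simpa using hg.symm)
  simp [pderiv_X, Derivation.leibniz, Derivation.leibniz_pow, hpos.ne', hg0] at h1

lemma aux_irr (n : ℕ) (hpos : 0 < n) :
    Prime (X 0 ^ n + X 1 ^ n + C Complex.I * X 2 ^ n : MvPolynomial (Fin 3) ℂ) := by
  obtain ⟨g, hg⟩ := IsAlgClosed.exists_pow_nat_eq (-Complex.I) hpos
  rw [← UniqueFactorizationMonoid.irreducible_iff_prime,
    ← MulEquiv.irreducible_iff (finSuccEquiv ℂ 2)]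
  set c : MvPolynomial (Fin 2) ℂ := X 0 ^ n + C Complex.I * X 1 ^ n with hc
  have e : finSuccEquiv ℂ 2 (X 0 ^ n + X 1 ^ n + C Complex.I * X 2 ^ n) =
      Polynomial.X ^ n + Polynomial.C c := by
    have h1 : finSuccEquiv ℂ 2 (X 1) = Polynomial.C (X 0) := finSuccEquiv_X_succ (j := 0)
    have h2 : finSuccEquiv ℂ 2 (X 2) = Polynomial.C (X 1) := finSuccEquiv_X_succ (j := 1)
    have h3 : finSuccEquiv ℂ 2 (C Complex.I) = Polynomial.C (C Complex.I) := by
      simp [finSuccEquiv_apply]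
    rw [map_add, map_add, map_mul, map_pow, map_pow, map_pow, finSuccEquiv_X_zero, h1, h2, h3, hc]
    simp only [map_add, map_mul, map_pow]
    ring
  rw [e]
  have hL : Prime (X 0 - C g * X 1 : MvPolynomial (Fin 2) ℂ) := by
    rw [← UniqueFactorizationMonoid.irreducible_iff_prime,
      ← MulEquiv.irreducible_iff (finSuccEquiv ℂ 1)]
    have : finSuccEquiv ℂ 1 (X 0 - C g * X 1) = Polynomial.X - Polynomial.C (C g * X 0) := by
      have h1 : finSuccEquiv ℂ 1 (X 1) = Polynomial.C (X 0) := finSuccEquiv_X_succ (j := 0)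
      have h3 : finSuccEquiv ℂ 1 (C g) = Polynomial.C (C g) := by
        simp [finSuccEquiv_apply]
      rw [map_sub, map_mul, finSuccEquiv_X_zero, h1, h3, map_mul]
    rw [this]
    exact Polynomial.irreducible_X_sub_C _
  have hmon : (Polynomial.X ^ n + Polynomial.C c).Monic := Polynomial.monic_X_pow_add_C c hpos.ne'
  have hdeg : (Polynomial.X ^ n + Polynomial.C c).natDegree = n := Polynomial.natDegree_X_pow_add_C
  have hP : (Ideal.span {(X 0 - C g * X 1 : MvPolynomial (Fin 2) ℂ)}).IsPrime :=
    (Ideal.span_singleton_prime hL.ne_zero).2 hL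
  apply Polynomial.irreducible_of_eisenstein_criterion hP
  · rw [hmon.leadingCoeff]
    exact fun h => hP.ne_top ((Ideal.eq_top_iff_one _).2 h)
  · intro m hm
    rw [Polynomial.degree_eq_natDegree hmon.ne_zero, hdeg] at hm
    have hm' : m < n := by exact_mod_cast hm
    rw [Polynomial.coeff_add, Polynomial.coeff_X_pow, if_neg hm'.ne, zero_add, Polynomial.coeff_C]
    split_ifs
    · rw [Ideal.mem_span_singleton]
      have := sub_dvd_pow_sub_pow (X 0 : MvPolynomial (Fin 2) ℂ) (C g * X 1) n
      rw [mul_pow, ← C_pow, hg] at this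
      simpa [hc] using this
    · exact Ideal.zero_mem _
  · rw [Polynomial.degree_eq_natDegree hmon.ne_zero, hdeg]
    exact_mod_cast hpos
  · rw [Ideal.span_singleton_pow, Ideal.mem_span_singleton]
    intro h
    apply aux_not_sq n hpos g hg
    rwa [Polynomial.coeff_add, Polynomial.coeff_X_pow, if_neg hpos.ne, zero_add,
      Polynomial.coeff_C_zero] at h
  · exact hmon.isPrimitive

/-- substitution with signs -/
def sgn (s t : ℂ) : MvPolynomial (Fin 3) ℂ →ₐ[ℂ] MvPolynomial (Fin 3) ℂ :=
  aeval ![X 0, C s * X 1, C t * X 2]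

lemma sgn_sgn (s t : ℂ) (hs : s * s = 1) (ht : t * t = 1) :
    (sgn s t).comp (sgn s t) = AlgHom.id ℂ _ := by
  apply MvPolynomial.algHom_ext
  intro i
  fin_cases i
  · simp [sgn]
  · simp [sgn, ← mul_assoc, ← C_mul, hs, algHom_C]
  · simp [sgn, ← mul_assoc, ← C_mul, ht, algHom_C]

def PP (n : ℕ) (s t : ℂ) : MvPolynomial (Fin 3) ℂ :=
  X 0 ^ n + C s * X 1 ^ n + C (t * Complex.I) * X 2 ^ n

def sqm : MvPolynomial (Fin 3) ℂ →ₐ[ℂ] MvPolynomial (Fin 3) ℂ :=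
  aeval (fun i => X i ^ 2)

lemma sgn_sqm (s t : ℂ) (hs : s * s = 1) (ht : t * t = 1) (p : MvPolynomial (Fin 3) ℂ) :
    sgn s t (sqm p) = sqm p := by
  have : (sgn s t).comp sqm = sqm := by
    apply MvPolynomial.algHom_ext
    intro i
    fin_cases i
    · simp [sgn, sqm]
    · simp [sgn, sqm, mul_pow, ← C_pow, pow_two s, hs]
    · simp [sgn, sqm, mul_pow, ← C_pow, pow_two t, ht]
  exact DFunLike.congr_fun this p

lemma sgn_PP (n : ℕ) (s t : ℂ) (hs : s ^ n = s) (ht : t ^ n = t) :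
    sgn s t (PP n 1 1) = PP n s t := by
  simp only [sgn, PP, map_add, map_mul, map_pow, aeval_X, algHom_C, algebraMap_eq, one_mul, map_one]
  simp [mul_pow, ← C_pow, hs, ht]
  ring

lemma PP_prime (n : ℕ) (hpos : 0 < n) (s t : ℂ) (hs : s * s = 1) (ht : t * t = 1)
    (hs' : s ^ n = s) (ht' : t ^ n = t) : Prime (PP n s t) := by
  let e : MvPolynomial (Fin 3) ℂ ≃ₐ[ℂ] MvPolynomial (Fin 3) ℂ :=
    AlgEquiv.ofAlgHom (sgn s t) (sgn s t) (sgn_sgn s t hs ht) (sgn_sgn s t hs ht)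
  have h : Prime (PP n 1 1) := by simpa [PP] using aux_irr n hpos
  have := (MulEquiv.prime_iff e).2 h
  rw [← sgn_PP n s t hs' ht']
  exact this

lemma PP_not_dvd_left (n : ℕ) (hpos : 0 < n) (s t t' : ℂ) (hs : s ≠ 0) (s' : ℂ)
    (hne : s ≠ s') : ¬ PP n s t ∣ PP n s' t' := by
  rintro ⟨q, hq⟩
  obtain ⟨b, hb⟩ := IsAlgClosed.exists_pow_nat_eq (-s⁻¹) hpos
  have h := congrArg (eval ![1, b, 0]) hq
  simp [PP, hpos.ne', hb, hs] at h
  apply hne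
  field_simp at h
  linear_combination h

lemma PP_not_dvd_right (n : ℕ) (hpos : 0 < n) (s s' t : ℂ) (ht : t ≠ 0) (t' : ℂ)
    (hne : t ≠ t') : ¬ PP n s t ∣ PP n s' t' := by
  rintro ⟨q, hq⟩
  obtain ⟨b, hb⟩ := IsAlgClosed.exists_pow_nat_eq (-(t * Complex.I)⁻¹) hpos
  have hI := Complex.I_ne_zero
  have h := congrArg (eval ![1, 0, b]) hq
  have h2 : 1 + t * Complex.I * -(t * Complex.I)⁻¹ = 0 := by field_simp; ring
  simp only [PP, map_add, map_mul, map_pow, eval_X, eval_C] at h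
  simp [hpos.ne'] at h
  rw [hb, h2, zero_mul] at h
  apply hne
  field_simp at h
  linear_combination h

lemma Fn_eq (n : ℕ) : Fn n = X 0 ^ (2 * n) + X 1 ^ (2 * n) + X 2 ^ (2 * n) +
        2 * (X 0 ^ n * X 2 ^ n - X 0 ^ n * X 1 ^ n + X 1 ^ n * X 2 ^ n) := by
  have h2 : bind₁ (fun i => (X i : MvPolynomial (Fin 3) ℂ) ^ n) 2 = 2 := map_ofNat _ 2
  simp only [Fn, fPoly, map_add, map_mul, map_sub, map_pow, bind₁_X_right]
  rw [h2]
  ring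

lemma sqm_Fn (n : ℕ) :
    sqm (Fn n) = PP n 1 1 * PP n (-1) 1 * PP n 1 (-1) * PP n (-1) (-1) := by
  have hI : (C Complex.I : MvPolynomial (Fin 3) ℂ) ^ 2 = -1 := by
    rw [← C_pow, Complex.I_sq]; simp
  have h2 : sqm 2 = 2 := map_ofNat _ 2
  rw [Fn_eq]
  simp only [map_add, map_mul, map_sub, map_pow, h2, PP]
  simp only [sqm, aeval_X, map_neg, map_one]
  generalize (C Complex.I : MvPolynomial (Fin 3) ℂ) = j at *
  have e : ∀ i : Fin 3, ((X i : MvPolynomial (Fin 3) ℂ) ^ 2) ^ n = (X i ^ n) ^ 2 := fun i => by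
    ring
  have e' : ∀ i : Fin 3, ((X i : MvPolynomial (Fin 3) ℂ) ^ 2) ^ (2 * n) = (X i ^ n) ^ 4 :=
    fun i => by ring
  simp only [e, e']
  generalize (X 0 : MvPolynomial (Fin 3) ℂ) ^ n = a
  generalize (X 1 : MvPolynomial (Fin 3) ℂ) ^ n = b
  generalize (X 2 : MvPolynomial (Fin 3) ℂ) ^ n = c
  linear_combination (2 * a ^ 2 * c ^ 2 + 2 * b ^ 2 * c ^ 2 - c ^ 4 * (j ^ 2 - 1)) * hI

lemma isUnit_of_sqm (p : MvPolynomial (Fin 3) ℂ) (h : IsUnit (sqm p)) : IsUnit p := by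
  have h1 : sqm p = expand 2 p := by
    have : sqm = expand 2 := by
      apply MvPolynomial.algHom_ext
      intro i
      rw [expand_X, sqm, aeval_X]
    rw [this]
  rw [h1] at h
  exact (isLocalHom_expand ℂ (Fin 3) (two_ne_zero : (2 : ℕ) ≠ 0)).map_nonunit p h

lemma key (n : ℕ) (hpos : 0 < n) (hodd : Odd n) (G H : MvPolynomial (Fin 3) ℂ)
    (hGH : Fn n = G * H) (hd : PP n 1 1 ∣ sqm G) : IsUnit H := by
  have hm : (-1 : ℂ) ^ n = -1 := hodd.neg_one_pow
  have hn1 : (1 : ℂ) ≠ -1 := by norm_num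
  have d (s t : ℂ) (hs : s * s = 1) (ht : t * t = 1)
    (hs' : s ^ n = s) (ht' : t ^ n = t) : PP n s t ∣ sqm G := by
    rw [← sgn_PP n s t hs' ht', ← sgn_sqm s t hs ht]
    exact map_dvd _ hd
  have pr := PP_prime n hpos
  have p2 := pr (-1) 1 (by simp) (by simp) hm (by simp)
  have p3 := pr 1 (-1) (by simp) (by simp) (by simp) hm
  have p4 := pr (-1) (-1) (by simp) (by simp) hm hm
  have d2 := d (-1) 1 (by simp) (by simp) hm (by simp)
  have d3 := d 1 (-1) (by simp) (by simp) (by simp) hm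
  have d4 := d (-1) (-1) (by simp) (by simp) hm hm
  have L := PP_not_dvd_left n hpos
  have R := PP_not_dvd_right n hpos
  have hm0 : (-1 : ℂ) ≠ 0 := by norm_num
  obtain ⟨q, hq⟩ := hd
  rw [hq] at d2 d3 d4
  have d2 := (p2.dvd_or_dvd d2).resolve_left (L _ _ _ hm0 _ hn1.symm)
  have d3 := (p3.dvd_or_dvd d3).resolve_left (R _ _ _ hm0 _ hn1.symm)
  have d4 := (p4.dvd_or_dvd d4).resolve_left (L _ _ _ hm0 _ hn1.symm)
  obtain ⟨q, rfl⟩ := d2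
  have d3 := (p3.dvd_or_dvd d3).resolve_left (R _ _ _ hm0 _ hn1.symm)
  have d4 := (p4.dvd_or_dvd d4).resolve_left (R _ _ _ hm0 _ hn1.symm)
  obtain ⟨q, rfl⟩ := d3
  have d4 := (p4.dvd_or_dvd d4).resolve_left (L _ _ _ hm0 _ hn1.symm)
  obtain ⟨q, rfl⟩ := d4
  have e := sqm_Fn n
  rw [hGH, map_mul, hq] at e
  have p1 := pr 1 1 (by simp) (by simp) (by simp) (by simp)
  have hne := mul_ne_zero (mul_ne_zero (mul_ne_zero p1.ne_zero p2.ne_zero) p3.ne_zero) p4.ne_zero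
  apply isUnit_of_sqm
  apply IsUnit.of_mul_eq_one q
  apply mul_left_cancel₀ hne
  rw [mul_one]
  refine Eq.trans ?_ e
  ring

/-- `F_n(x,y,z) = x^{2n} + y^{2n} + z^{2n} + 2(xⁿzⁿ − xⁿyⁿ + yⁿzⁿ)`, and for `n` odd
and positive this polynomial is irreducible in `ℂ[x,y,z]`. -/
theorem Fn_irreducible_of_odd (n : ℕ) (hpos : 0 < n) (hodd : Odd n) :
    Fn n = X 0 ^ (2 * n) + X 1 ^ (2 * n) + X 2 ^ (2 * n) +
        2 * (X 0 ^ n * X 2 ^ n - X 0 ^ n * X 1 ^ n + X 1 ^ n * X 2 ^ n) ∧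
      Irreducible (Fn n) := by
  refine ⟨Fn_eq n, ?_⟩
  have p1 := PP_prime n hpos 1 1 (by simp) (by simp) (by simp) (by simp)
  have hdv : PP n 1 1 ∣ sqm (Fn n) := by
    rw [sqm_Fn, mul_assoc, mul_assoc]
    exact dvd_mul_right _ _
  constructor
  · intro h
    exact p1.not_isUnit (isUnit_of_dvd_unit hdv (h.map sqm))
  · intro G H h
    rw [h, map_mul] at hdv
    rcases p1.dvd_or_dvd hdv with hd | hd
    · exact Or.inr (key n hpos hodd G H h hd)
    · exact Or.inl (key n hpos hodd H G (by rw [h, mul_comm]) hd)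

end
end

section
/- Let k ≥ 1 and n = 2k. Each of the four polynomials g₁ = x^k − y^k + i z^k, g₂ = x^k − y^k − i z^k, g₃ = x^k + y^k + i z^k, g₄ = x^k + y^k − i z^k is irreducible in ℂ[x,y,z], no two of them are associates, and each defines a nonsingular projective plane curve: the three partial derivatives ∂g_j/∂x, ∂g_j/∂y, ∂g_j/∂z have no common zero in ℂ³ ∖ {(0,0,0)}. Consequently, for n even the curve C̃_n = {f(x^n,y^n,z^n) = 0} ⊂ ℙ²(ℂ) has exactly four irreducible components, each nonsingular. -/
open MvPolynomial

noncomputable section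

/-- The curve `C̃_n = {F_n = 0} ⊆ ℙ²(ℂ)`. -/
def curveCn (n : ℕ) : Set (Projectivization ℂ (Fin 3 → ℂ)) :=
  {p | eval p.rep (Fn n) = 0}

/-- The four factors `g₁ = x^k − y^k + i z^k`, `g₂ = x^k − y^k − i z^k`,
`g₃ = x^k + y^k + i z^k`, `g₄ = x^k + y^k − i z^k` of `f(x^{2k}, y^{2k}, z^{2k})`. -/
def gFactor (k : ℕ) : Fin 4 → MvPolynomial (Fin 3) ℂ :=
  ![X 0 ^ k - X 1 ^ k + C Complex.I * X 2 ^ k,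
    X 0 ^ k - X 1 ^ k - C Complex.I * X 2 ^ k,
    X 0 ^ k + X 1 ^ k + C Complex.I * X 2 ^ k,
    X 0 ^ k + X 1 ^ k - C Complex.I * X 2 ^ k]

/-- The component of `C̃_{2k}` defined by `g_j = 0` in `ℙ²(ℂ)`. -/
def componentSet (k : ℕ) (j : Fin 4) : Set (Projectivization ℂ (Fin 3 → ℂ)) :=
  {p | eval p.rep (gFactor k j) = 0}

/-- coefficient of `y^k` in the `j`-th factor -/
def cA : Fin 4 → ℂ := ![-1, -1, 1, 1]

/-- coefficient of `z^k` in the `j`-th factor -/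
def cB : Fin 4 → ℂ := ![Complex.I, -Complex.I, Complex.I, -Complex.I]

theorem cA_ne (j : Fin 4) : cA j ≠ 0 := by
  fin_cases j <;> simp [cA]

theorem cB_ne (j : Fin 4) : cB j ≠ 0 := by
  fin_cases j <;> simp [cB]

theorem cAB_inj (j j' : Fin 4) (h : j ≠ j') : cA j ≠ cA j' ∨ cB j ≠ cB j' := by
  have h1 : (-1 : ℂ) ≠ 1 := by norm_num
  have h2 : Complex.I ≠ -Complex.I := by
    intro h
    have := congrArg Complex.im h
    norm_num at this
  fin_cases j <;> fin_cases j' <;> simp [cA, cB, h1, h1.symm, h2, h2.symm] at h ⊢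

theorem gFactor_eq (k : ℕ) (j : Fin 4) :
    gFactor k j = X 0 ^ k + C (cA j) * X 1 ^ k + C (cB j) * X 2 ^ k := by
  fin_cases j <;> simp [gFactor, cA, cB] <;> ring

theorem eval_gFactor (k : ℕ) (j : Fin 4) (v : Fin 3 → ℂ) :
    eval v (gFactor k j) = v 0 ^ k + cA j * v 1 ^ k + cB j * v 2 ^ k := by
  simp [gFactor_eq]

theorem exists_root (k : ℕ) (hk : 1 ≤ k) (a : ℂ) : ∃ r : ℂ, r ^ k = a :=
  IsAlgClosed.exists_pow_nat_eq a (by omega)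

theorem irr_aux (k : ℕ) (hk : 1 ≤ k) (a b : ℂ) (ha : a ≠ 0) (hb : b ≠ 0) :
    Irreducible (X 0 ^ k + C a * X 1 ^ k + C b * X 2 ^ k : MvPolynomial (Fin 3) ℂ) := by
  rw [← MulEquiv.irreducible_iff (finSuccEquiv ℂ 2)]
  set c : MvPolynomial (Fin 2) ℂ := C a * X 0 ^ k + C b * X 1 ^ k with hc
  have himg : finSuccEquiv ℂ 2 (X 0 ^ k + C a * X 1 ^ k + C b * X 2 ^ k)
      = Polynomial.X ^ k + Polynomial.C c := by
    have e1 : (1 : Fin 3) = Fin.succ 0 := rfl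
    have e2 : (2 : Fin 3) = Fin.succ 1 := rfl
    have hC : ∀ t : ℂ, finSuccEquiv ℂ 2 (C t) = Polynomial.C (C t) := fun t => by
      simp [finSuccEquiv_apply]
    rw [e1, e2]
    simp only [map_add, map_mul, map_pow, finSuccEquiv_X_zero, finSuccEquiv_X_succ, hC, hc]
    ring
  rw [himg]
  obtain ⟨r, hr⟩ := exists_root k hk (-b / a)
  have hr0 : r ≠ 0 := by
    rintro rfl
    rw [zero_pow (by omega)] at hr
    exact (div_ne_zero (neg_ne_zero.mpr hb) ha) hr.symm
  let w : Fin 2 → ℂ := ![r, 1]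
  have hmon : (Polynomial.X ^ k + Polynomial.C c).Monic :=
    Polynomial.monic_X_pow_add_C c (by omega)
  have hnd : (Polynomial.X ^ k + Polynomial.C c).natDegree = k :=
    Polynomial.natDegree_X_pow_add_C
  have hP : (RingHom.ker (eval w)).IsPrime := RingHom.ker_isPrime _
  have hcP : c ∈ RingHom.ker (eval w) := by
    rw [RingHom.mem_ker]
    simp [hc, w, hr]
    field_simp
    ring
  have hder : ∀ p ∈ (RingHom.ker (eval w)) ^ 2, eval w (pderiv 0 p) = 0 := by
    intro p hp
    rw [pow_two] at hp
    refine Submodule.mul_induction_on hp ?_ ?_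
    · intro m hm n hn
      rw [RingHom.mem_ker] at hm hn
      simp [hm, hn]
    · intro x y hx hy
      simp [hx, hy]
  refine Polynomial.irreducible_of_eisenstein_criterion hP ?_ ?_ ?_ ?_ ?_
  · rw [hmon.leadingCoeff]
    exact fun h => hP.ne_top ((Ideal.eq_top_iff_one _).mpr h)
  · intro n hn
    rw [Polynomial.degree_eq_natDegree hmon.ne_zero, hnd] at hn
    have hn' : n < k := by exact_mod_cast hn
    rw [Polynomial.coeff_add, Polynomial.coeff_X_pow, if_neg (by omega), zero_add,
      Polynomial.coeff_C]
    split_ifs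
    · exact hcP
    · exact Ideal.zero_mem _
  · rw [Polynomial.degree_eq_natDegree hmon.ne_zero, hnd]
    exact_mod_cast hk
  · intro h
    have h1 := hder _ h
    have : (Polynomial.X ^ k + Polynomial.C c).coeff 0 = c := by
      rw [Polynomial.coeff_add, Polynomial.coeff_X_pow, if_neg (by omega), zero_add,
        Polynomial.coeff_C_zero]
    rw [this] at h1
    simp [hc, w, pderiv_X, ha, hr0] at h1
    omega
  · exact hmon.isPrimitive

theorem mem_comp_mk (k : ℕ) (j : Fin 4) (v : Fin 3 → ℂ) (hv : v ≠ 0) :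
    Projectivization.mk ℂ v hv ∈ componentSet k j ↔
      v 0 ^ k + cA j * v 1 ^ k + cB j * v 2 ^ k = 0 := by
  obtain ⟨c, hc⟩ := Projectivization.exists_smul_eq_mk_rep ℂ v hv
  have hc0 : (c : ℂ) ^ k ≠ 0 := pow_ne_zero _ c.ne_zero
  simp only [componentSet, Set.mem_setOf_eq, eval_gFactor]
  rw [← hc]
  have : (c • v) 0 ^ k + cA j * (c • v) 1 ^ k + cB j * (c • v) 2 ^ k
      = (c : ℂ) ^ k * (v 0 ^ k + cA j * v 1 ^ k + cB j * v 2 ^ k) := by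
    simp only [Pi.smul_apply, Units.smul_def, smul_eq_mul, mul_pow]
    ring
  rw [this, mul_eq_zero, or_iff_right hc0]

theorem comp_ne (k : ℕ) (hk : 1 ≤ k) (j j' : Fin 4) (h : j ≠ j') :
    componentSet k j ≠ componentSet k j' := by
  intro he
  have hk0 : k ≠ 0 := by omega
  rcases cAB_inj j j' h with h | h
  · obtain ⟨r, hr⟩ := exists_root k hk (-cA j)
    have hv : (![r, 1, 0] : Fin 3 → ℂ) ≠ 0 := fun h => by simpa using congrFun h 1
    have h1 := (mem_comp_mk k j _ hv).mpr (by simp [hr, hk0])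
    rw [he, mem_comp_mk] at h1
    simp [hr, hk0] at h1
    exact h (by linear_combination -h1)
  · obtain ⟨r, hr⟩ := exists_root k hk (-cB j)
    have hv : (![r, 0, 1] : Fin 3 → ℂ) ≠ 0 := fun h => by simpa using congrFun h 2
    have h1 := (mem_comp_mk k j _ hv).mpr (by simp [hr, hk0])
    rw [he, mem_comp_mk] at h1
    simp [hr, hk0] at h1
    exact h (by linear_combination -h1)

theorem Fn_eq_s5 (k : ℕ) : Fn (2 * k) = ∏ j, gFactor k j := by
  have hI : (C Complex.I : MvPolynomial (Fin 3) ℂ) ^ 2 = -1 := by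
    rw [← C_pow, Complex.I_sq]; simp
  simp only [Fn, fPoly, gFactor, Fin.prod_univ_four, map_add, map_mul, map_sub, map_pow,
    bind₁_X_right, map_ofNat, Matrix.cons_val]
  generalize (C Complex.I : MvPolynomial (Fin 3) ℂ) = t at *
  simp only [mul_comm 2 k, pow_mul]
  generalize (X 0 : MvPolynomial (Fin 3) ℂ) ^ k = x
  generalize (X 1 : MvPolynomial (Fin 3) ℂ) ^ k = y
  generalize (X 2 : MvPolynomial (Fin 3) ℂ) ^ k = z
  linear_combination (2 * z ^ 2 * (x ^ 2 + y ^ 2) - z ^ 4 * (t ^ 2 - 1)) * hI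

/-- For `k ≥ 1` and `n = 2k`: each of `g₁, g₂, g₃, g₄` is irreducible in `ℂ[x,y,z]`, no two
are associates, each defines a nonsingular projective plane curve (the partial derivatives
have no common zero in `ℂ³ ∖ {0}`); consequently the curve `C̃_n` is the union of the four
pairwise distinct irreducible components `{g_j = 0}`, each nonsingular. -/
theorem Cn_four_nonsingular_components (k : ℕ) (hk : 1 ≤ k) :
    (∀ j : Fin 4, Irreducible (gFactor k j)) ∧
    (∀ j j' : Fin 4, j ≠ j' → ¬ Associated (gFactor k j) (gFactor k j')) ∧
    (∀ j : Fin 4, ∀ v : Fin 3 → ℂ, v ≠ 0 →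
      ¬ (∀ i : Fin 3, eval v (pderiv i (gFactor k j)) = 0)) ∧
    (curveCn (2 * k) = ⋃ j : Fin 4, componentSet k j) ∧
    (∀ j j' : Fin 4, j ≠ j' → componentSet k j ≠ componentSet k j') := by
  refine ⟨fun j => ?_, fun j j' h ha => ?_, fun j v hv hz => ?_, ?_, comp_ne k hk⟩
  · rw [gFactor_eq]
    exact irr_aux k hk _ _ (cA_ne j) (cB_ne j)
  · apply comp_ne k hk j j' h
    obtain ⟨u, hu⟩ := ha
    ext p
    have hu' : eval p.rep (u : MvPolynomial (Fin 3) ℂ) ≠ 0 :=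
      (u.isUnit.map (eval p.rep)).ne_zero
    simp only [componentSet, Set.mem_setOf_eq, ← hu, map_mul, mul_eq_zero, hu', or_false]
  · apply hv
    have hk0 : k ≠ 0 := by omega
    have h0 := hz 0
    have h1 := hz 1
    have h2 := hz 2
    rw [gFactor_eq] at h0 h1 h2
    simp [pderiv_X, Pi.single_apply, hk0, cA_ne, cB_ne] at h0 h1 h2
    ext i
    fin_cases i
    · exact h0.1
    · exact h1.1
    · exact h2.1
  · ext p
    simp only [curveCn, componentSet, Set.mem_setOf_eq, Set.mem_iUnion, Fn_eq_s5, map_prod,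
      Finset.prod_eq_zero_iff, Finset.mem_univ, true_and]

end
end

section
/- Let n ≥ 3 be odd, and let S ⊂ ℙ²(ℂ) be the set of 3n singular points of C̃_n, namely S = {[1:ζ:0] : ζ^n = 1} ∪ {[0:1:ζ] : ζ^n = −1} ∪ {[1:0:ζ] : ζ^n = −1}. Then the ℂ-vector space of homogeneous polynomials of degree n−1 in ℂ[x,y,z] vanishing at every point of S has dimension (n−3)(n−2)/2. In particular, since the virtual dimension of this space is n(n+1)/2 − 3n, the superabundance equals (n−3)(n−2)/2 − (n(n+1)/2 − 3n) = 3. -/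
open MvPolynomial

noncomputable section

/-- Fixed representative vectors of the `3n` singular points of `C̃_n`:
`(1, ζ, 0)` with `ζⁿ = 1`, `(0, 1, ζ)` with `ζⁿ = −1`, and `(1, 0, ζ)` with `ζⁿ = −1`. -/
def singReps (n : ℕ) : Set (Fin 3 → ℂ) :=
  {v | ∃ ζ : ℂ,
    (ζ ^ n = 1 ∧ v = ![1, ζ, 0]) ∨
    (ζ ^ n = -1 ∧ v = ![0, 1, ζ]) ∨
    (ζ ^ n = -1 ∧ v = ![1, 0, ζ])}

/-- The space of homogeneous polynomials of degree `n − 1` in `ℂ[x,y,z]` vanishing at every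
singular point of `C̃_n`. -/
def adjointSystem (n : ℕ) : Submodule ℂ (MvPolynomial (Fin 3) ℂ) :=
  homogeneousSubmodule (Fin 3) ℂ (n - 1) ⊓
    ⨅ v ∈ singReps n, LinearMap.ker (aeval v : MvPolynomial (Fin 3) ℂ →ₐ[ℂ] ℂ).toLinearMap

lemma three_univ : ∀ i j k : Fin 3, i ≠ j → i ≠ k → j ≠ k →
    (Finset.univ : Finset (Fin 3)) = {i, j, k} := by decide

/-- `X ^ n = c` has `n` distinct solutions in `ℂ` for `c ≠ 0`. -/
lemma exists_roots_finset (n : ℕ) (hn : 0 < n) (c : ℂ) (hc : c ≠ 0) :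
    ∃ s : Finset ℂ, s.card = n ∧ ∀ x ∈ s, x ^ n = c := by
  classical
  have hp := Complex.isPrimitiveRoot_exp n hn.ne'
  refine ⟨(Polynomial.nthRoots n c).toFinset, ?_, ?_⟩
  · rw [Multiset.toFinset_card_of_nodup (hp.nthRoots_nodup hc), hp.card_nthRoots, if_pos]
    exact IsAlgClosed.exists_pow_nat_eq c hn
  · intro x hx
    rw [Multiset.mem_toFinset, Polynomial.mem_nthRoots hn] at hx
    exact hx

/-- A form of degree `n - 1` vanishing at `n` points of the line `x_k = 0` has no monomial
free of `x_k`. -/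
lemma no_monomial (n : ℕ) (hn : 0 < n) (c : ℂ) (hc : c ≠ 0) (i j k : Fin 3)
    (hij : i ≠ j) (hik : i ≠ k) (hjk : j ≠ k)
    (P : MvPolynomial (Fin 3) ℂ) (hP : P.IsHomogeneous (n - 1))
    (hv : ∀ x : ℂ, x ^ n = c →
      aeval (fun t : Fin 3 => if t = j then x else if t = k then 0 else 1) P = 0)
    (e : Fin 3 →₀ ℕ) (he : e ∈ P.support) (hek : e k = 0) : False := by
  classical
  have hprod : ∀ {M : Type} [CommMonoid M] (f : Fin 3 → M), ∏ t, f t = f i * f j * f k := by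
    intro M _ f
    have hu : (Finset.univ : Finset (Fin 3)) = {i, j, k} := three_univ i j k hij hik hjk
    rw [hu, Finset.prod_insert (by simp [hij, hik]), Finset.prod_insert (by simp [hjk]),
      Finset.prod_singleton, mul_assoc]
  have hdeg : ∀ d ∈ P.support, d i + d j + d k = n - 1 := by
    intro d hd
    have h1 := hP (mem_support_iff.mp hd)
    have h1 : d.degree = n - 1 := by
      rw [Finsupp.degree_eq_weight_one]; exact h1
    rw [Finsupp.degree_eq_sum] at h1
    rw [← h1]
    have hu : (Finset.univ : Finset (Fin 3)) = {i, j, k} := three_univ i j k hij hik hjk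
    rw [hu, Finset.sum_insert (by simp [hij, hik]), Finset.sum_insert (by simp [hjk]),
      Finset.sum_singleton, add_assoc]
  obtain ⟨s, hs, hsr⟩ := exists_roots_finset n hn c hc
  let q : Polynomial ℂ := ∑ d ∈ P.support,
    if d k = 0 then Polynomial.monomial (d j) (coeff d P) else 0
  have hq0 : q = 0 := by
    refine Polynomial.eq_zero_of_natDegree_lt_card_of_eval_eq_zero' q s ?_ ?_
    · intro x hx
      rw [← hv x (hsr x hx), aeval_def, eval₂_eq', Polynomial.eval_finsetSum]
      refine Finset.sum_congr rfl fun d _ => ?_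
      rw [hprod]
      by_cases h : d k = 0
      · simp [h, hij, hik, Polynomial.eval_monomial]
      · simp [h, hjk.symm]
    · rw [hs]
      refine lt_of_le_of_lt (Polynomial.natDegree_sum_le_of_forall_le (n := n - 1) _ _ ?_)
        (by omega)
      intro d hd
      have := hdeg d hd
      split_ifs
      · exact (Polynomial.natDegree_monomial_le _).trans (by omega)
      · simp
  have hc0 : q.coeff (e j) = coeff e P := by
    simp only [q]
    rw [Polynomial.finsetSum_coeff, Finset.sum_eq_single e]
    · simp [hek]
    · intro d hd hde
      by_cases h : d k = 0
      · rw [if_pos h, Polynomial.coeff_monomial, if_neg]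
        intro hj
        apply hde
        have h1 := hdeg d hd
        have h2 := hdeg e he
        ext t
        have ht : t = i ∨ t = j ∨ t = k := by
          have := Finset.mem_univ t
          rw [three_univ i j k hij hik hjk] at this
          simpa using this
        rcases ht with rfl | rfl | rfl <;> omega
      · simp [h]
    · intro h; exact absurd he h
  rw [hq0] at hc0
  exact mem_support_iff.mp he (by simpa using hc0.symm)

/-- Exponents of degree `n - 1` with all entries positive. -/
def posExps (n : ℕ) : Set (Fin 3 →₀ ℕ) := {d | d.degree = n - 1 ∧ ∀ t, d t ≠ 0}

lemma adjointSystem_eq (n : ℕ) (hn : 3 ≤ n) :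
    adjointSystem n = restrictSupport ℂ (posExps n) := by
  ext P
  simp only [adjointSystem, Submodule.mem_inf, Submodule.mem_iInf, LinearMap.mem_ker,
    AlgHom.toLinearMap_apply, mem_homogeneousSubmodule, mem_restrictSupport_iff]
  constructor
  · rintro ⟨hP, hv⟩ d hd
    have hd' : d ∈ P.support := hd
    refine ⟨?_, ?_⟩
    · rw [Finsupp.degree_eq_weight_one]
      exact hP (mem_support_iff.mp hd')
    · intro t ht
      fin_cases t
      · refine no_monomial n (by omega) (-1) (by simp) 1 2 0 (by decide) (by decide) (by decide)
          P hP ?_ d hd' ht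
        intro x hx
        refine Eq.trans ?_ (hv ![0, 1, x] ⟨x, Or.inr (Or.inl ⟨hx, rfl⟩)⟩)
        congr 2
        funext t; fin_cases t <;> simp
      · refine no_monomial n (by omega) (-1) (by simp) 0 2 1 (by decide) (by decide) (by decide)
          P hP ?_ d hd' ht
        intro x hx
        refine Eq.trans ?_ (hv ![1, 0, x] ⟨x, Or.inr (Or.inr ⟨hx, rfl⟩)⟩)
        congr 2
        funext t; fin_cases t <;> simp
      · refine no_monomial n (by omega) 1 (by simp) 0 1 2 (by decide) (by decide) (by decide)
          P hP ?_ d hd' ht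
        intro x hx
        refine Eq.trans ?_ (hv ![1, x, 0] ⟨x, Or.inl ⟨hx, rfl⟩⟩)
        congr 2
        funext t; fin_cases t <;> simp
  · intro h
    refine ⟨?_, ?_⟩
    · intro d hd
      have h1 := (h (mem_support_iff.mpr hd)).1
      rw [Finsupp.degree_eq_weight_one] at h1
      exact h1
    · rintro v ⟨x, hv⟩
      have h0 : ∃ t, v t = 0 := by
        rcases hv with ⟨_, rfl⟩ | ⟨_, rfl⟩ | ⟨_, rfl⟩
        · exact ⟨2, rfl⟩
        · exact ⟨0, rfl⟩
        · exact ⟨1, rfl⟩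
      obtain ⟨t, ht⟩ := h0
      rw [aeval_def, eval₂_eq']
      refine Finset.sum_eq_zero fun d hd => ?_
      rw [Finset.prod_eq_zero (Finset.mem_univ t), mul_zero]
      rw [ht, zero_pow ((h hd).2 t)]

lemma card_posExps (n : ℕ) (hn : 3 ≤ n) :
    Nat.card (posExps n) = (n - 3) * (n - 2) / 2 := by
  let T : Finset (Σ _ : ℕ, ℕ) := (Finset.range (n - 3)).sigma fun i => Finset.range (i + 1)
  have hT : T.card = (n - 3) * (n - 2) / 2 := by
    simp only [T, Finset.card_sigma, Finset.card_range]
    have h := Finset.sum_range_succ' (fun i => i) (n - 3)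
    rw [add_zero] at h
    rw [← h, Finset.sum_range_id, mul_comm]
    congr 2
    omega
  have hmem : ∀ d : Fin 3 →₀ ℕ, d ∈ posExps n ↔
      d 0 + d 1 + d 2 = n - 1 ∧ d 0 ≠ 0 ∧ d 1 ≠ 0 ∧ d 2 ≠ 0 := by
    intro d
    simp [posExps, Finsupp.degree_eq_sum, Fin.sum_univ_three, Fin.forall_fin_succ]
  rw [← hT, ← Nat.card_eq_finsetCard]
  refine Nat.card_congr (Equiv.ofBijective
    (fun d => (⟨⟨d.1 0 + d.1 1 - 2, d.1 1 - 1⟩, ?_⟩ : T)) ⟨?_, ?_⟩)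
  · have := (hmem _).1 d.2
    simp only [T, Finset.mem_sigma, Finset.mem_range]
    omega
  · rintro ⟨d, hd⟩ ⟨e, he⟩ h
    simp only [Subtype.mk.injEq, Sigma.mk.injEq, heq_eq_eq] at h
    rw [hmem] at hd he
    ext t
    fin_cases t <;> simp <;> omega
  · rintro ⟨⟨a, b⟩, hab⟩
    simp only [T, Finset.mem_sigma, Finset.mem_range] at hab
    refine ⟨⟨Finsupp.equivFunOnFinite.symm ![a - b + 1, b + 1, n - 3 - a], ?_⟩, ?_⟩
    · rw [hmem]
      simp
      omega
    · simp
      omega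

/-- For odd `n ≥ 3`, the space of homogeneous polynomials of degree `n − 1` vanishing at the
`3n` singular points of `C̃_n` has dimension `(n−3)(n−2)/2`; in particular, since the virtual
dimension is `n(n+1)/2 − 3n`, the superabundance is
`(n−3)(n−2)/2 − (n(n+1)/2 − 3n) = 3`. -/
theorem superabundance_of_singular_points (n : ℕ) (hn : 3 ≤ n) (hodd : Odd n) :
    Module.finrank ℂ (adjointSystem n) = (n - 3) * (n - 2) / 2 ∧
    ((n : ℤ) - 3) * ((n : ℤ) - 2) / 2 - ((n : ℤ) * ((n : ℤ) + 1) / 2 - 3 * (n : ℤ)) = 3 := by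
  refine ⟨?_, ?_⟩
  · rw [adjointSystem_eq n hn, Module.finrank_eq_nat_card_basis (basisRestrictSupport ℂ (posExps n)),
      card_posExps n hn]
  · obtain ⟨k, rfl⟩ := hodd
    push_cast
    have h1 : (2 * (k : ℤ) + 1 - 3) * (2 * (k : ℤ) + 1 - 2) = 2 * ((k - 1) * (2 * k - 1)) := by ring
    have h2 : (2 * (k : ℤ) + 1) * (2 * (k : ℤ) + 1 + 1) = 2 * ((2 * k + 1) * (k + 1)) := by ring
    rw [h1, h2, Int.mul_ediv_cancel_left _ two_ne_zero, Int.mul_ediv_cancel_left _ two_ne_zero]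
    ring

end
end

section
/- Let n ≥ 1 be odd and let P_n be the group presented by generators ε_{i,j}, i,j ∈ ℤ/nℤ, and relations ε_{i+2,j} = ε_{i+1,j}⁻¹ ε_{i,j} ε_{i+1,j}, ε_{i,j+2} = ε_{i,j+1}⁻¹ ε_{i,j} ε_{i,j+1} for all i,j ∈ ℤ/nℤ, together with ∏_{i=0}^{n−1}(ε_{i,i} ε_{i,i+1}) = 1 (indices mod n). Then the abelianization of P_n is isomorphic to ℤ/2nℤ. -/
/-- The relators of the presentation `P_n` of `π₁(ℙ²(ℂ) ∖ C̃_n)`: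
`ε_{i+2,j} = ε_{i+1,j}⁻¹ ε_{i,j} ε_{i+1,j}`, `ε_{i,j+2} = ε_{i,j+1}⁻¹ ε_{i,j} ε_{i,j+1}` and
`ε_{0,0} ε_{0,1} ε_{1,1} ε_{1,2} ⋯ ε_{n−1,n−1} ε_{n−1,0} = 1`. -/
def relsCn (n : ℕ) : Set (FreeGroup (ZMod n × ZMod n)) :=
  {r | (∃ i j : ZMod n, r = FreeGroup.of (i + 2, j) *
          ((FreeGroup.of (i + 1, j))⁻¹ * FreeGroup.of (i, j) * FreeGroup.of (i + 1, j))⁻¹) ∨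
       (∃ i j : ZMod n, r = FreeGroup.of (i, j + 2) *
          ((FreeGroup.of (i, j + 1))⁻¹ * FreeGroup.of (i, j) * FreeGroup.of (i, j + 1))⁻¹) ∨
       r = ((List.range n).map (fun i =>
          FreeGroup.of ((i : ZMod n), (i : ZMod n)) *
          FreeGroup.of ((i : ZMod n), (i : ZMod n) + 1))).prod}

theorem length_castRange (n m : ℕ) :
    (do let a ← List.range m; pure (a : ZMod n) : List (ZMod n)).length = m := by
  simp

theorem relsCn_hom_const (n : ℕ) (r : FreeGroup (ZMod n × ZMod n)) (hr : r ∈ relsCn n) :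
    FreeGroup.lift (fun _ : ZMod n × ZMod n => Multiplicative.ofAdd (1 : ZMod (2 * n))) r = 1 := by
  rcases hr with ⟨i, j, rfl⟩ | ⟨i, j, rfl⟩ | rfl
  · simp
  · simp
  · rw [map_list_prod, List.map_map]
    have : (⇑(FreeGroup.lift
        (fun _ : ZMod n × ZMod n => Multiplicative.ofAdd (1 : ZMod (2 * n)))) ∘
        fun i : ZMod n => FreeGroup.of (i, i) *
          FreeGroup.of (i, i + 1)) =
        fun _ => Multiplicative.ofAdd (2 : ZMod (2 * n)) := by
      funext i
      simp only [Function.comp, map_mul, FreeGroup.lift_apply_of, ← ofAdd_add]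
      norm_num
    rw [this, List.map_const', List.prod_replicate, length_castRange, ← ofAdd_nsmul,
      nsmul_eq_mul]
    have h : (2 : ZMod (2 * n)) * n = 0 := by exact_mod_cast ZMod.natCast_self (2 * n)
    rw [mul_comm (n : ZMod (2 * n)) 2, h, ofAdd_zero]

/-- The class of a generator in the abelianization. -/
def genAb (n : ℕ) (p : ZMod n × ZMod n) : Abelianization (PresentedGroup (relsCn n)) :=
  Abelianization.of (PresentedGroup.of p)

theorem genAb_eq_lift (n : ℕ) (r : FreeGroup (ZMod n × ZMod n)) (hr : r ∈ relsCn n) :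
    FreeGroup.lift (genAb n) r = 1 := by
  have h : FreeGroup.lift (genAb n) =
      (Abelianization.of).comp (PresentedGroup.mk (relsCn n)) := by
    ext p
    simp [genAb, PresentedGroup.of]
  rw [h, MonoidHom.comp_apply, PresentedGroup.one_of_mem hr, map_one]

theorem genAb_left (n : ℕ) (i j : ZMod n) : genAb n (i + 2, j) = genAb n (i, j) := by
  have h := genAb_eq_lift n _ (Or.inl ⟨i, j, rfl⟩)
  simpa [mul_inv_eq_one] using h

theorem genAb_right (n : ℕ) (i j : ZMod n) : genAb n (i, j + 2) = genAb n (i, j) := by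
  have h := genAb_eq_lift n _ (Or.inr (Or.inl ⟨i, j, rfl⟩))
  simpa [mul_inv_eq_one] using h

theorem zmod_const_of_odd {α : Type*} (n : ℕ) (hn : 1 ≤ n) (hodd : Odd n) (f : ZMod n → α)
    (hf : ∀ i, f (i + 2) = f i) (i : ZMod n) : f i = f 0 := by
  have h : ∀ m : ℕ, f (2 * m) = f 0 := by
    intro m
    induction m with
    | zero => simp
    | succ m ih => rw [← ih, ← hf (2 * m)]; push_cast; ring_nf
  obtain ⟨k, hk⟩ := hodd
  have : NeZero n := ⟨by omega⟩
  have h2 : (2 : ZMod n) * k + 1 = 0 := by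
    have h4 : ((2 * k + 1 : ℕ) : ZMod n) = 0 :=
      (congrArg (Nat.cast : ℕ → ZMod n) hk.symm).trans (ZMod.natCast_self n)
    exact_mod_cast h4
  have h3 := h ((k + 1) * i.val)
  rw [← h3]
  congr 1
  push_cast
  rw [ZMod.natCast_zmod_val]
  linear_combination (-i) * h2

theorem genAb_const (n : ℕ) (hn : 1 ≤ n) (hodd : Odd n) (p : ZMod n × ZMod n) :
    genAb n p = genAb n (0, 0) := by
  obtain ⟨i, j⟩ := p
  rw [zmod_const_of_odd n hn hodd (fun i => genAb n (i, j)) (fun i => genAb_left n i j) i]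
  exact zmod_const_of_odd n hn hodd (fun j => genAb n (0, j)) (fun j => genAb_right n 0 j) j

theorem genAb_pow (n : ℕ) (hn : 1 ≤ n) (hodd : Odd n) : genAb n (0, 0) ^ (2 * n) = 1 := by
  have h := genAb_eq_lift n _ (Or.inr (Or.inr rfl))
  rw [map_list_prod, List.map_map] at h
  have h' : (⇑(FreeGroup.lift (genAb n)) ∘
        fun i : ZMod n => FreeGroup.of (i, i) *
          FreeGroup.of (i, i + 1)) =
        fun _ => genAb n (0, 0) ^ 2 := by
    funext i
    simp only [Function.comp, map_mul, FreeGroup.lift_apply_of]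
    rw [genAb_const n hn hodd (_, _), genAb_const n hn hodd (i, i + 1), sq]
  rw [h', List.map_const', List.prod_replicate, length_castRange, ← pow_mul] at h
  exact h

/-- For odd `n ≥ 1`, the abelianization of the presented group `P_n` is `ℤ/2nℤ`. -/
theorem abelianization_Pn_of_odd (n : ℕ) (hn : 1 ≤ n) (hodd : Odd n) :
    Nonempty (Abelianization (PresentedGroup (relsCn n)) ≃* Multiplicative (ZMod (2 * n))) := by
  let F : Abelianization (PresentedGroup (relsCn n)) →* Multiplicative (ZMod (2 * n)) :=
    Abelianization.lift (PresentedGroup.toGroup (relsCn_hom_const n))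
  have hF : ∀ p, F (genAb n p) = Multiplicative.ofAdd 1 := by
    intro p
    simp [F, genAb]
  let g : ZMod (2 * n) →+ Additive (Abelianization (PresentedGroup (relsCn n))) :=
    ZMod.lift (2 * n) ⟨zmultiplesHom _ (Additive.ofMul (genAb n (0, 0))), by
      rw [zmultiplesHom_apply, natCast_zsmul, ← ofMul_pow, genAb_pow n hn hodd, ofMul_one]⟩
  have hg : g 1 = Additive.ofMul (genAb n (0, 0)) := by
    have := ZMod.lift_coe (2 * n) ⟨zmultiplesHom _ (Additive.ofMul (genAb n (0, 0))), by
      rw [zmultiplesHom_apply, natCast_zsmul, ← ofMul_pow, genAb_pow n hn hodd, ofMul_one]⟩ 1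
    simpa [g] using this
  let G : Multiplicative (ZMod (2 * n)) →* Abelianization (PresentedGroup (relsCn n)) :=
    AddMonoidHom.toMultiplicativeLeft g
  have hG : G (Multiplicative.ofAdd 1) = genAb n (0, 0) := by
    change (g 1).toMul = _
    rw [hg]; rfl
  refine ⟨MonoidHom.toMulEquiv F G ?_ ?_⟩
  · apply Abelianization.hom_ext
    apply PresentedGroup.ext
    intro p
    change G (F (genAb n p)) = genAb n p
    rw [hF, hG, genAb_const n hn hodd p]
  · have : NeZero (2 * n) := ⟨by omega⟩
    refine MonoidHom.ext fun x => ?_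
    have hx : x = (Multiplicative.ofAdd (1 : ZMod (2 * n))) ^ (x.toAdd.val) := by
      rw [← ofAdd_nsmul, nsmul_one, ZMod.natCast_zmod_val]; rfl
    rw [hx, map_pow, MonoidHom.comp_apply, hG, hF, MonoidHom.id_apply]
end

section
/- Let n = 2k ≥ 2 be even and let P_n be the group presented by generators ε_{i,j}, i,j ∈ ℤ/nℤ, and relations ε_{i+2,j} = ε_{i+1,j}⁻¹ ε_{i,j} ε_{i+1,j}, ε_{i,j+2} = ε_{i,j+1}⁻¹ ε_{i,j} ε_{i,j+1} for all i,j ∈ ℤ/nℤ, together with ∏_{i=0}^{n−1}(ε_{i,i} ε_{i,i+1}) = 1 (indices mod n). Then the abelianization of P_n is isomorphic to ℤ³ ⊕ ℤ/kℤ (i.e. ℤ³ ⊕ ℤ/(n/2)ℤ). -/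
theorem per_aux {N : ℕ} {M : Type*} (u : ZMod N → M) (h : ∀ i, u (i + 2) = u i) (m : ℕ) (j : ZMod N) :
    u (2 * (m : ZMod N) + j) = u j := by
  induction m with
  | zero => simp
  | succ m ih => rw [← ih, ← h (2 * (m : ZMod N) + j)]; congr 1; push_cast; ring

theorem prod_aux {N : ℕ} {M : Type*} [CommGroup M] (u : ZMod N → ZMod N → M)
    (h1 : ∀ i j, u (i + 2) j = u i j) (h2 : ∀ i j, u i (j + 2) = u i j) (m : ℕ) :
    ((List.range (2 * m)).map (fun i : ℕ => u (i : ZMod N) (i : ZMod N) *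
      u (i : ZMod N) ((i : ZMod N) + 1))).prod = (u 0 0 * u 0 1 * u 1 0 * u 1 1) ^ m := by
  have k1 : ∀ (m : ℕ) i j, u (2 * (m : ZMod N) + i) j = u i j :=
    fun m i j => per_aux (fun i => u i j) (fun i => h1 i j) m i
  have k2 : ∀ (m : ℕ) i j, u i (2 * (m : ZMod N) + j) = u i j :=
    fun m i j => per_aux (fun j => u i j) (fun j => h2 i j) m j
  induction m with
  | zero => simp
  | succ m ih =>
    rw [show 2 * (m + 1) = 2 * m + 1 + 1 by ring, List.prod_range_succ, List.prod_range_succ, ih,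
      pow_succ]
    have a1 : u ((2 * m : ℕ) : ZMod N) ((2 * m : ℕ) : ZMod N) = u 0 0 := by
      rw [← k1 m 0 0, ← k2 m _ 0]; simp
    have a2 : u ((2 * m : ℕ) : ZMod N) (((2 * m : ℕ) : ZMod N) + 1) = u 0 1 := by
      rw [← k1 m 0 1, ← k2 m _ 1]; simp
    have a3 : u ((2 * m + 1 : ℕ) : ZMod N) ((2 * m + 1 : ℕ) : ZMod N) = u 1 1 := by
      rw [← k1 m 1 1, ← k2 m _ 1]; simp
    have a4 : u ((2 * m + 1 : ℕ) : ZMod N) (((2 * m + 1 : ℕ) : ZMod N) + 1) = u 1 0 := by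
      rw [← k1 m 1 0, ← k2 m _ 0, ← h2 _ (2 * (m : ZMod N) + 0)]; congr 1 <;> push_cast <;> ring
    rw [a1, a2, a3, a4, mul_assoc, mul_assoc]
    congr 1
    simp only [mul_comm, mul_left_comm]

theorem cases_aux {N : ℕ} [NeZero N] (i : ZMod N) :
    ∃ m : ℕ, i = 2 * (m : ZMod N) + 0 ∨ i = 2 * (m : ZMod N) + 1 := by
  refine ⟨i.val / 2, ?_⟩
  have h := ZMod.natCast_zmod_val i
  rcases Nat.mod_two_eq_zero_or_one i.val with h0 | h0
  · left
    have : i.val = 2 * (i.val / 2) + 0 := by omega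
    conv_lhs => rw [← h, this]
    push_cast; ring
  · right
    have : i.val = 2 * (i.val / 2) + 1 := by omega
    conv_lhs => rw [← h, this]
    push_cast; ring

theorem list_aux {N : ℕ} (L : List ℕ) :
    (L >>= fun a => pure (a : ZMod N)) = L.map (fun a : ℕ => (a : ZMod N)) := by
  induction L with
  | nil => rfl
  | cons a L ih => simpa using ih

/-- images of the four classes -/
def vAux (k : ℕ) (p q : ZMod 2) : (Fin 3 → ℤ) × ZMod k :=
  if p = 0 then (if q = 0 then (![1, 0, 0], 0) else (![0, 1, 0], 0))
  else (if q = 0 then (![0, 0, 1], 0) else (![-1, -1, -1], 1))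

/-- images of the generators -/
def wAux (k : ℕ) (i j : ZMod (2 * k)) : Multiplicative ((Fin 3 → ℤ) × ZMod k) :=
  Multiplicative.ofAdd (vAux k (ZMod.castHom (dvd_mul_right 2 k) (ZMod 2) i)
    (ZMod.castHom (dvd_mul_right 2 k) (ZMod 2) j))

theorem wAux_left (k : ℕ) (i j : ZMod (2 * k)) : wAux k (i + 2) j = wAux k i j := by
  unfold wAux
  rw [map_add, map_ofNat, show (OfNat.ofNat 2 : ZMod 2) = 0 from rfl, add_zero]

theorem wAux_right (k : ℕ) (i j : ZMod (2 * k)) : wAux k i (j + 2) = wAux k i j := by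
  unfold wAux
  rw [map_add, map_ofNat, show (OfNat.ofNat 2 : ZMod 2) = 0 from rfl, add_zero]

theorem wAux_00 (k : ℕ) : wAux k 0 0 = Multiplicative.ofAdd (![1, 0, 0], 0) := by
  unfold wAux; rw [map_zero]; rfl
theorem wAux_01 (k : ℕ) : wAux k 0 1 = Multiplicative.ofAdd (![0, 1, 0], 0) := by
  unfold wAux; rw [map_zero, map_one]; rfl
theorem wAux_10 (k : ℕ) : wAux k 1 0 = Multiplicative.ofAdd (![0, 0, 1], 0) := by
  unfold wAux; rw [map_zero, map_one]; rfl
theorem wAux_11 (k : ℕ) : wAux k 1 1 = Multiplicative.ofAdd (![-1, -1, -1], 1) := by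
  unfold wAux; rw [map_one]; rfl

theorem wAux_prod (k : ℕ) : wAux k 0 0 * wAux k 0 1 * wAux k 1 0 * wAux k 1 1 =
    Multiplicative.ofAdd ((0 : Fin 3 → ℤ), (1 : ZMod k)) := by
  rw [wAux_00, wAux_01, wAux_10, wAux_11]
  simp only [← ofAdd_add, Prod.mk_add_mk, add_zero, zero_add]
  congr 2
  ext i; fin_cases i <;> simp

theorem wAux_rels (k : ℕ) : ∀ r ∈ relsCn (2 * k),
    FreeGroup.lift (fun p : ZMod (2 * k) × ZMod (2 * k) => wAux k p.1 p.2) r = 1 := by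
  rintro r (⟨i, j, rfl⟩ | ⟨i, j, rfl⟩ | rfl)
  · simp [wAux_left]
  · simp [wAux_right]
  · rw [list_aux, map_list_prod, List.map_map, List.map_map]
    have := prod_aux (wAux k) (wAux_left k) (wAux_right k) k
    rw [wAux_prod, ← ofAdd_nsmul] at this
    simp only [Function.comp_def, map_mul, FreeGroup.lift_apply_of]
    rw [this]
    simp

/-- generator in the abelianization -/
def eAux (k : ℕ) (i j : ZMod (2 * k)) : Abelianization (PresentedGroup (relsCn (2 * k))) :=
  Abelianization.of (PresentedGroup.of (i, j))

theorem eAux_rel (k : ℕ) (r) (hr : r ∈ relsCn (2 * k)) :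
    FreeGroup.lift (fun p : ZMod (2 * k) × ZMod (2 * k) => eAux k p.1 p.2) r = 1 := by
  have : FreeGroup.lift (fun p : ZMod (2 * k) × ZMod (2 * k) => eAux k p.1 p.2) =
      Abelianization.of.comp (PresentedGroup.mk (relsCn (2 * k))) := by
    ext p; simp [eAux, PresentedGroup.of]
  rw [this, MonoidHom.comp_apply, PresentedGroup.one_of_mem hr, map_one]

theorem eAux_left (k : ℕ) (i j : ZMod (2 * k)) : eAux k (i + 2) j = eAux k i j := by
  have := eAux_rel k _ (Or.inl ⟨i, j, rfl⟩)
  simpa [mul_inv_eq_one] using this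

theorem eAux_right (k : ℕ) (i j : ZMod (2 * k)) : eAux k i (j + 2) = eAux k i j := by
  have := eAux_rel k _ (Or.inr (Or.inl ⟨i, j, rfl⟩))
  simpa [mul_inv_eq_one] using this

theorem eAux_prod (k : ℕ) :
    (eAux k 0 0 * eAux k 0 1 * eAux k 1 0 * eAux k 1 1) ^ k = 1 := by
  rw [← prod_aux (eAux k) (eAux_left k) (eAux_right k) k]
  have := eAux_rel k _ (Or.inr (Or.inr rfl))
  rw [list_aux, map_list_prod, List.map_map, List.map_map] at this
  simpa only [Function.comp_def, map_mul, FreeGroup.lift_apply_of] using this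

/-- the forward map -/
def fAux (k : ℕ) : Abelianization (PresentedGroup (relsCn (2 * k))) →*
    Multiplicative ((Fin 3 → ℤ) × ZMod k) :=
  Abelianization.lift (PresentedGroup.toGroup (wAux_rels k))

theorem fAux_e (k : ℕ) (i j) : fAux k (eAux k i j) = wAux k i j := by
  simp [fAux, eAux]

/-- lattice part of the inverse map -/
def gLat {A : Type*} [AddCommGroup A] (a b c : A) : (Fin 3 → ℤ) →+ A where
  toFun x := x 0 • a + x 1 • b + x 2 • c
  map_zero' := by simp
  map_add' x y := by simp only [Pi.add_apply, add_smul]; abel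

/-- the inverse map, additively -/
def gAdd (k : ℕ) : (Fin 3 → ℤ) × ZMod k →+
    Additive (Abelianization (PresentedGroup (relsCn (2 * k)))) :=
  (gLat (Additive.ofMul (eAux k 0 0)) (Additive.ofMul (eAux k 0 1))
    (Additive.ofMul (eAux k 1 0))).coprod
  (ZMod.lift k ⟨zmultiplesHom _
    (Additive.ofMul (eAux k 0 0 * eAux k 0 1 * eAux k 1 0 * eAux k 1 1)), by
      rw [zmultiplesHom_apply, natCast_zsmul, ← ofMul_pow, eAux_prod, ofMul_one]⟩)

/-- the inverse map -/
def gAux (k : ℕ) : Multiplicative ((Fin 3 → ℤ) × ZMod k) →*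
    Abelianization (PresentedGroup (relsCn (2 * k))) :=
  AddMonoidHom.toMultiplicativeLeft (gAdd k)

theorem gAdd_apply (k : ℕ) (x : Fin 3 → ℤ) (m : ℤ) : gAdd k (x, (m : ZMod k)) =
    x 0 • Additive.ofMul (eAux k 0 0) + x 1 • Additive.ofMul (eAux k 0 1)
      + x 2 • Additive.ofMul (eAux k 1 0) +
    m • Additive.ofMul (eAux k 0 0 * eAux k 0 1 * eAux k 1 0 * eAux k 1 1) := by
  simp [gAdd, gLat]

theorem gAux_apply (k : ℕ) (x : Fin 3 → ℤ) (m : ℤ) :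
    gAux k (Multiplicative.ofAdd (x, (m : ZMod k))) =
    eAux k 0 0 ^ x 0 * eAux k 0 1 ^ x 1 * eAux k 1 0 ^ x 2 *
      (eAux k 0 0 * eAux k 0 1 * eAux k 1 0 * eAux k 1 1) ^ m :=
  gAdd_apply k x m

theorem gw_aux (k : ℕ) (hk : 1 ≤ k) (i j : ZMod (2 * k)) : gAux k (wAux k i j) = eAux k i j := by
  have : NeZero (2 * k) := ⟨by omega⟩
  have w1 := fun m i j => per_aux (fun i => wAux k i j) (fun i => wAux_left k i j) m i
  have w2 := fun m i j => per_aux (fun j => wAux k i j) (fun j => wAux_right k i j) m j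
  have e1 := fun m i j => per_aux (fun i => eAux k i j) (fun i => eAux_left k i j) m i
  have e2 := fun m i j => per_aux (fun j => eAux k i j) (fun j => eAux_right k i j) m j
  have z0 : (0 : ZMod k) = ((0 : ℤ) : ZMod k) := by simp
  have z1 : (1 : ZMod k) = ((1 : ℤ) : ZMod k) := by simp
  obtain ⟨m, rfl | rfl⟩ := cases_aux i <;> obtain ⟨l, rfl | rfl⟩ := cases_aux j <;>
    rw [w1, w2, e1, e2]
  · rw [wAux_00, z0, gAux_apply]; simp
  · rw [wAux_01, z0, gAux_apply]; simp
  · rw [wAux_10, z0, gAux_apply]; simp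
  · rw [wAux_11, z1, gAux_apply]
    simp only [Matrix.cons_val, zpow_neg, zpow_one]
    rw [← mul_inv, ← mul_inv, inv_mul_cancel_left]

theorem abelianization_Pn_of_even (k : ℕ) (hk : 1 ≤ k) :
    Nonempty (Abelianization (PresentedGroup (relsCn (2 * k))) ≃*
      Multiplicative ((Fin 3 → ℤ) × ZMod k)) := by
  refine ⟨MonoidHom.toMulEquiv (fAux k) (gAux k) ?_ ?_⟩
  · apply Abelianization.hom_ext
    apply PresentedGroup.ext
    rintro ⟨i, j⟩
    change gAux k (fAux k (eAux k i j)) = eAux k i j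
    rw [fAux_e, gw_aux k hk]
  · refine MonoidHom.ext fun y => ?_
    obtain ⟨x, m⟩ := y
    obtain ⟨m, rfl⟩ := ZMod.intCast_surjective m
    change fAux k (gAux k (Multiplicative.ofAdd (x, (m : ZMod k)))) =
      Multiplicative.ofAdd (x, (m : ZMod k))
    rw [gAux_apply]
    simp only [map_mul, map_zpow, fAux_e]
    rw [wAux_prod, wAux_00, wAux_01, wAux_10]
    simp only [← ofAdd_zsmul, ← ofAdd_add]
    congr 1
    ext i
    · fin_cases i <;> simp
    · simp
end

section
/- Let n ≥ 3 be odd and let Q_n be the group presented by generators ε₀, ε₁, …, ε_{n−1} (indices in ℤ/nℤ) and relations ε_{i+2} = ε_{i+1}⁻¹ ε_i ε_{i+1} for all i ∈ ℤ/nℤ, together with ε₀² ε₁² ⋯ ε_{n−1}² = 1. Then Q_n is isomorphic to the free product (ℤ/2ℤ) ∗ (ℤ/nℤ). -/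
/-- The relators of the presentation `Q_n`: `ε_{i+2} = ε_{i+1}⁻¹ ε_i ε_{i+1}` for all
`i ∈ ℤ/nℤ`, and `ε₀² ε₁² ⋯ ε_{n−1}² = 1`. -/
def relsQ (n : ℕ) : Set (FreeGroup (ZMod n)) :=
  {r | (∃ i : ZMod n, r = FreeGroup.of (i + 2) *
          ((FreeGroup.of (i + 1))⁻¹ * FreeGroup.of i * FreeGroup.of (i + 1))⁻¹) ∨
       r = ((List.range n).map (fun i => FreeGroup.of ((i : ZMod n)) ^ 2)).prod}


theorem aux_lift {G : Type*} [Group G] (n : ℕ) (g : G) (hg : g ^ n = 1) :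
    ∃ f : Multiplicative (ZMod n) →* G, f (Multiplicative.ofAdd 1) = g := by
  let F : ZMod n →+ Additive G := ZMod.lift n ⟨zmultiplesHom (Additive G) (Additive.ofMul g), by
    simp [← ofMul_pow, hg]⟩
  refine ⟨AddMonoidHom.toMultiplicativeLeft F, ?_⟩
  have : F ((1 : ℤ) : ZMod n) = Additive.ofMul g := by
    simp only [F, ZMod.lift_coe]
    simp
  simp only [Int.cast_one] at this
  change Additive.toMul (F 1) = g
  rw [this]; rfl

theorem aux_pow {G : Type*} [Group G] {n : ℕ} (f : Multiplicative (ZMod n) →* G) (k : ℕ) :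
    f (Multiplicative.ofAdd (k : ZMod n)) = f (Multiplicative.ofAdd 1) ^ k := by
  rw [← map_pow, ← ofAdd_nsmul]; simp

theorem aux_ext {G : Type*} [Group G] {n : ℕ} (hn : n ≠ 0) (f g : Multiplicative (ZMod n) →* G)
    (h : f (Multiplicative.ofAdd 1) = g (Multiplicative.ofAdd 1)) : f = g := by
  have : NeZero n := ⟨hn⟩
  refine MonoidHom.ext fun x => ?_
  obtain ⟨k, hk⟩ := ZMod.natCast_zmod_surjective (Multiplicative.toAdd x)
  have hx : x = Multiplicative.ofAdd (k : ZMod n) := by rw [hk]; rfl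
  rw [hx, aux_pow, aux_pow, h]

theorem aux_prod {G : Type*} [Group G] (e : ℕ → G) (d : G) (h : ∀ k, e k * e (k + 1) = d) (k : ℕ) :
    ((List.range (k + 1)).map (fun i => e i ^ 2)).prod = e 0 * d ^ k * e k := by
  induction k with
  | zero => simp [pow_two]
  | succ k ih =>
    rw [List.range_succ, List.map_append, List.prod_append, ih, pow_succ, ← h k]
    simp [pow_two, mul_assoc]

theorem aux_prod' {G : Type*} [Group G] (n : ℕ) (hn : n ≠ 0) (e : ZMod n → G) (d : G)
    (h : ∀ i, e i * e (i + 1) = d) :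
    ((List.range n).map (fun i : ℕ => e (i : ZMod n) ^ 2)).prod = e 0 * d ^ n * (e 0)⁻¹ := by
  obtain ⟨k, rfl⟩ := Nat.exists_eq_succ_of_ne_zero hn
  have h1 := aux_prod (fun i : ℕ => e (i : ZMod (k + 1))) d (fun i => by simpa using h i) k
  have h2 := h (k : ZMod (k + 1))
  have h3 : (k : ZMod (k + 1)) + 1 = 0 := by exact_mod_cast ZMod.natCast_self (k + 1)
  rw [h3] at h2
  simp only [Nat.succ_eq_add_one]
  rw [h1, pow_succ, ← h2]
  simp [mul_assoc]

theorem aux_const {G : Type*} [Group G] (n : ℕ) (hn : n ≠ 0) (e : ZMod n → G)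
    (h : ∀ i, e (i + 2) = (e (i + 1))⁻¹ * e i * e (i + 1)) (i : ZMod n) :
    e i * e (i + 1) = e 0 * e 1 := by
  have : NeZero n := ⟨hn⟩
  obtain ⟨k, rfl⟩ := ZMod.natCast_zmod_surjective i
  induction k with
  | zero => simp
  | succ k ih =>
    rw [← ih]
    have := h (k : ZMod n)
    push_cast
    rw [show (k : ZMod n) + 1 + 1 = k + 2 by ring, this]
    group

theorem aux_even {G : Type*} [Group G] (n : ℕ) (e : ZMod n → G) (d : G)
    (h : ∀ i, e i * e (i + 1) = d) (k : ℕ) :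
    e (2 * (k : ZMod n)) = (d ^ k)⁻¹ * e 0 * d ^ k := by
  induction k with
  | zero => simp
  | succ k ih =>
    have h1 := h (2 * (k : ZMod n))
    have h2 := h (2 * (k : ZMod n) + 1)
    have h3 : e (2 * (k : ZMod n) + 1 + 1) = d⁻¹ * e (2 * (k : ZMod n)) * d := by
      rw [← eq_inv_mul_iff_mul_eq] at h1 h2
      rw [h2, h1]; group
    push_cast
    rw [show 2 * ((k : ZMod n) + 1) = 2 * k + 1 + 1 by ring, h3, ih, pow_succ]
    group

theorem aux_map {G : Type*} [Group G] (n : ℕ) (F : FreeGroup (ZMod n) →* G) :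
    F ((List.range n).map (fun i => FreeGroup.of ((i : ZMod n)) ^ 2)).prod =
      ((List.range n).map (fun i : ℕ => F (FreeGroup.of (i : ZMod n)) ^ 2)).prod := by
  have h : (do let a ← List.range n; pure (a : ZMod n)) = (List.range n).map Nat.cast := by
    rw [List.map_eq_flatMap]; rfl
  rw [h, map_list_prod, List.map_map, List.map_map]
  simp [Function.comp_def]

theorem Qn_iso_free_product (n : ℕ) (hn : 3 ≤ n) (hodd : Odd n) :
    Nonempty (PresentedGroup (relsQ n) ≃*
      Monoid.Coprod (Multiplicative (ZMod 2)) (Multiplicative (ZMod n))) := by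
  have hn0 : n ≠ 0 := by omega
  have : NeZero n := ⟨hn0⟩
  obtain ⟨m, hm⟩ := hodd
  obtain ⟨h, hh⟩ : ∃ h : ℕ, h = m + 1 := ⟨_, rfl⟩
  have h2 : (2 : ZMod n) * (h : ZMod n) = 1 := by
    have : ((2 * h : ℕ) : ZMod n) = ((n + 1 : ℕ) : ZMod n) := by congr 1; omega
    simpa using this
  -- the target
  let C := Monoid.Coprod (Multiplicative (ZMod 2)) (Multiplicative (ZMod n))
  let D : ZMod n → C := fun x => Monoid.Coprod.inr (Multiplicative.ofAdd x)
  let t : C := Monoid.Coprod.inl (Multiplicative.ofAdd 1)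
  have hD : ∀ x y, D x * D y = D (x + y) := fun x y => by
    simp only [D, ofAdd_add, map_mul]
  have hD0 : D 0 = 1 := by simp [D]
  have ht : t * t = 1 := by
    simp only [t, ← map_mul, ← ofAdd_add]
    rw [show (1 : ZMod 2) + 1 = 0 from rfl]; simp
  have hDn : D 1 ^ n = 1 := by
    simp only [D, ← map_pow, ← ofAdd_nsmul]; simp
  let E : ZMod n → C := fun i => D (h - h * i) * t * D (h * i)
  have hE : ∀ i, E i * E (i + 1) = D 1 := fun i => by
    calc E i * E (i + 1) = D (h - h * i) * t * (D (h * i) * D (h - h * (i + 1))) * t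
          * D (h * (i + 1)) := by simp only [E, mul_assoc]
      _ = D (h - h * i) * (t * t) * D (h * (i + 1)) := by
          rw [hD, show (h : ZMod n) * i + (h - h * (i + 1)) = 0 by ring, hD0]
          simp only [mul_assoc, mul_one]
      _ = D 1 := by
          rw [ht, mul_one, hD]; congr 1; linear_combination h2
  have hErel : ∀ r ∈ relsQ n, FreeGroup.lift E r = 1 := by
    rintro r (⟨i, rfl⟩ | rfl)
    · have e1 := hE i
      have e2 := hE (i + 1)
      rw [show i + 1 + 1 = i + 2 by ring, ← e1, ← eq_inv_mul_iff_mul_eq] at e2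
      simp only [map_mul, map_inv, FreeGroup.lift_apply_of, e2]
      group
    · rw [aux_map]
      have := aux_prod' n hn0 E (D 1) hE
      rw [hDn] at this
      simpa using this
  let φ : PresentedGroup (relsQ n) →* C := PresentedGroup.toGroup hErel
  have hφ : ∀ i, φ (PresentedGroup.of i) = E i := fun i => PresentedGroup.toGroup.of hErel
  -- the source
  let e : ZMod n → PresentedGroup (relsQ n) := PresentedGroup.of
  have he : ∀ i, e (i + 2) = (e (i + 1))⁻¹ * e i * e (i + 1) := fun i => by
    have := PresentedGroup.one_of_mem (rels := relsQ n) (Or.inl ⟨i, rfl⟩)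
    rw [map_mul, map_inv, mul_inv_eq_one, map_mul, map_mul, map_inv] at this
    exact this
  obtain ⟨d, hd⟩ : ∃ d, d = e 0 * e 1 := ⟨_, rfl⟩
  have hc : ∀ i, e i * e (i + 1) = d := fun i => by rw [hd]; exact aux_const n hn0 e he i
  have hdn : d ^ n = 1 := by
    have h1 := aux_prod' n hn0 e d hc
    have h3 := PresentedGroup.one_of_mem (rels := relsQ n) (Or.inr rfl)
    rw [aux_map] at h3
    have h4 : ((List.range n).map (fun i : ℕ => e (i : ZMod n) ^ 2)).prod = 1 := by
      rw [← h3]; rfl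
    rw [h1] at h4
    simpa using h4
  have hev := aux_even n e d hc
  obtain ⟨s, hs⟩ : ∃ s, s = (d ^ h)⁻¹ * e 0 := ⟨_, rfl⟩
  have hs2 : s ^ 2 = 1 := by
    have h1 := hev h
    rw [h2] at h1
    have h3 : s * d ^ h = e 1 := by rw [h1, hs]
    have h4 : s * s = (d ^ h)⁻¹ * (e 0 * e 1) * (d ^ h)⁻¹ := by
      nth_rewrite 2 [← mul_inv_eq_iff_eq_mul.mpr h3.symm]
      rw [hs]; group
    have h5 : d ^ h * d ^ h = d := by
      rw [← pow_add, show h + h = n + 1 by omega, pow_succ, hdn, one_mul]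
    rw [pow_two, h4, ← hd]
    nth_rewrite 2 [← h5]
    group
  obtain ⟨f, hf⟩ := aux_lift n d hdn
  obtain ⟨g, hg⟩ := aux_lift 2 s hs2
  let ψ : C →* PresentedGroup (relsQ n) := Monoid.Coprod.lift g f
  have hψt : ψ t = s := by 
    rw [← hg]; exact Monoid.Coprod.lift_apply_inl g f _
  have hψD : ∀ x, ψ (D x) = f (Multiplicative.ofAdd x) := fun x => by
    exact Monoid.Coprod.lift_apply_inr g f _
  have hφd : φ d = D 1 := by
    rw [hd, map_mul]
    change φ (PresentedGroup.of 0) * φ (PresentedGroup.of 1) = _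
    rw [hφ, hφ]; simpa using hE 0
  have hDh : D 1 ^ h = D h := (aux_pow (Monoid.Coprod.inr : _ →* C) h).symm
  have hφs : φ s = t := by
    have : φ (e 0) = E 0 := hφ 0
    rw [hs, map_mul, map_inv, map_pow, hφd, hDh, this]
    simp [E, hD0]
  refine ⟨MonoidHom.toMulEquiv φ ψ ?_ ?_⟩
  · apply PresentedGroup.ext
    intro i
    change ψ (φ (PresentedGroup.of i)) = e i
    rw [hφ]
    obtain ⟨k, hk⟩ := ZMod.natCast_zmod_surjective ((h : ZMod n) * i)
    have hi : i = 2 * (k : ZMod n) := by rw [hk, ← mul_assoc, h2, one_mul]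
    have h6 : E i = D h * (D k)⁻¹ * t * D k := by
      simp only [E]
      rw [← hk]
      congr 2
      rw [eq_mul_inv_iff_mul_eq, hD]; congr 1; ring
    have h7 : D h * (D k)⁻¹ = (D k)⁻¹ * D h := by
      rw [mul_inv_eq_iff_eq_mul, mul_assoc, hD, eq_inv_mul_iff_mul_eq, hD, add_comm]
    rw [h6, h7, hi, hev]
    simp only [map_mul, map_inv, hψt, hψD, aux_pow, hf, hs]
    group
  · apply Monoid.Coprod.hom_ext
    · apply aux_ext two_ne_zero
      change φ (ψ t) = t
      rw [hψt, hφs]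
    · apply aux_ext hn0
      change φ (ψ (D 1)) = D 1
      rw [hψD, hf, hφd]
end
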